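/- Let p > 1, V ∈ L^∞(ℝ) and f ∈ C(ℝ×ℝ) both 1-periodic in t, with f satisfying: |f(t,u)| ≤ C(1+|u|^{q-1}) for some q > p and f(t,u)u ≥ 0; f(t,u)u/|u|^p → +∞ as |u| → ∞ uniformly in t; f(t,u) = o(|u|^{p-1}) as u → 0 uniformly in t; and there exists θ ≥ 1 with θ(f(t,u)u - pF(t,u)) ≥ f(t,su)su - pF(t,su) for all s ∈ [0,1]. Then for every λ ∈ ℝ the periodic problem -Δ_p u + |u|^{p-2}u = λV(t)|u|^{p-2}u + f(t,u), u(0)=u(1), u'(0)=u'(1), has a nontrivial weak solution u ∈ W^{1,p}(S¹). -/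

import Mathlib

open MeasureTheory intervalIntegral

/-- Continuous logarithm on a real topological vector space. -/
theorem logLift {X : Type*} [AddCommGroup X] [Module ℝ X] [TopologicalSpace X]
    [IsTopologicalAddGroup X] [ContinuousSMul ℝ X] [LocallyPathConnectedSpace X]
    (g : X → ℂ) (hg : Continuous g) (h0 : ∀ x, g x ≠ 0) (x0 : X) (e0 : ℂ)
    (he : Complex.exp e0 = g x0) :
    ∃ l : X → ℂ, Continuous l ∧ l x0 = e0 ∧ ∀ x, Complex.exp (l x) = g x := by
  obtain ⟨F, ⟨h1, h2⟩, -⟩ := Complex.isCoveringMapOn_exp.existsUnique_continuousMap_lifts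
    (⟨g, hg⟩ : C(X, ℂ)) he (fun x => h0 x)
  exact ⟨F, F.continuous, h1, fun x => congrFun h2 x⟩

theorem logUniq {X : Type*} [TopologicalSpace X] {s : Set X} (hs : IsPreconnected s)
    (l1 l2 : X → ℂ) (h1 : ContinuousOn l1 s) (h2 : ContinuousOn l2 s)
    (he : ∀ x ∈ s, Complex.exp (l1 x) = Complex.exp (l2 x)) (x0 : X) (hx0 : x0 ∈ s)
    (h0 : l1 x0 = l2 x0) : ∀ x ∈ s, l1 x = l2 x := by
  exact Complex.isCoveringMap_exp.eqOn_of_comp_eqOn hs h1 h2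
    (fun x hx => Subtype.ext (he x hx)) hx0 h0

theorem stayLemma {X : Type*} [TopologicalSpace X] {s : Set X} (hs : IsPreconnected s)
    (h : X → ℝ) (hc : ContinuousOn h s) (c1 c2 : ℝ) (n1 : ∀ x ∈ s, h x ≠ c1)
    (n2 : ∀ x ∈ s, h x ≠ c2) (x0 : X) (hx0 : x0 ∈ s) (h1 : c1 < h x0) (h2 : h x0 < c2) :
    ∀ x ∈ s, c1 < h x ∧ h x < c2 := by
  intro x hx
  have hO := (hs.image h hc).ordConnected
  constructor
  · by_contra hcon
    push Not at hcon
    obtain ⟨y, hy, e⟩ := hO.out (Set.mem_image_of_mem h hx) (Set.mem_image_of_mem h hx0)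
      ⟨hcon, h1.le⟩
    exact n1 y hy e
  · by_contra hcon
    push Not at hcon
    obtain ⟨y, hy, e⟩ := hO.out (Set.mem_image_of_mem h hx0) (Set.mem_image_of_mem h hx)
      ⟨h2.le, hcon⟩
    exact n2 y hy e

theorem stayPos {X : Type*} [TopologicalSpace X] {s : Set X} (hs : IsPreconnected s)
    (l : X → ℂ) (hc : ContinuousOn l s) (hp : ∀ x ∈ s, 0 < (Complex.exp (l x)).im)
    (x0 : X) (hx0 : x0 ∈ s) (h1 : 0 < (l x0).im) (h2 : (l x0).im < Real.pi) :
    ∀ x ∈ s, 0 < (l x).im ∧ (l x).im < Real.pi := by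
  refine stayLemma hs (fun x => (l x).im) (Complex.continuous_im.comp_continuousOn hc) 0 Real.pi
    ?_ ?_ x0 hx0 h1 h2
  · intro x hx e
    have := hp x hx
    rw [Complex.exp_im, e] at this
    simp at this
  · intro x hx e
    have := hp x hx
    rw [Complex.exp_im, e] at this
    simp at this

theorem stayNeg {X : Type*} [TopologicalSpace X] {s : Set X} (hs : IsPreconnected s)
    (l : X → ℂ) (hc : ContinuousOn l s) (hp : ∀ x ∈ s, (Complex.exp (l x)).im < 0)
    (x0 : X) (hx0 : x0 ∈ s) (h1 : -Real.pi < (l x0).im) (h2 : (l x0).im < 0) :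
    ∀ x ∈ s, -Real.pi < (l x).im ∧ (l x).im < 0 := by
  refine stayLemma hs (fun x => (l x).im) (Complex.continuous_im.comp_continuousOn hc)
    (-Real.pi) 0 ?_ ?_ x0 hx0 h1 h2
  · intro x hx e
    have := hp x hx
    rw [Complex.exp_im, e] at this
    simp at this
  · intro x hx e
    have := hp x hx
    rw [Complex.exp_im, e] at this
    simp at this

theorem stayRe {X : Type*} [TopologicalSpace X] {s : Set X} (hs : IsPreconnected s)
    (l : X → ℂ) (hc : ContinuousOn l s) (hp : ∀ x ∈ s, 0 ≤ (Complex.exp (l x)).re)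
    (x0 : X) (hx0 : x0 ∈ s) (h1 : -Real.pi < (l x0).im) (h2 : (l x0).im < Real.pi) :
    ∀ x ∈ s, -Real.pi < (l x).im ∧ (l x).im < Real.pi := by
  refine stayLemma hs (fun x => (l x).im) (Complex.continuous_im.comp_continuousOn hc)
    (-Real.pi) Real.pi ?_ ?_ x0 hx0 h1 h2
  · intro x hx e
    have := hp x hx
    rw [Complex.exp_re, e] at this
    have h3 := Real.exp_pos (l x).re
    simp at this
    linarith
  · intro x hx e
    have := hp x hx
    rw [Complex.exp_re, e] at this
    have h3 := Real.exp_pos (l x).re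
    simp at this
    linarith

/-- Escape: an area expanding map moves some point of a small ball far away. -/
theorem escape (P : ℂ → ℂ) (hP : MeasurePreserving P volume volume) (η r R : ℝ) (hη : 0 < η)
    (hr : 0 < r) :
    ∃ n : ℕ, ∃ z : ℂ, ‖z‖ < r ∧ R < ‖((fun z => (Real.exp η : ℝ) • P z)^[n]) z‖ := by
  by_contra hcon
  push Not at hcon
  set h : ℂ → ℂ := fun z => (Real.exp η : ℝ) • P z with hh
  have hmeas : Measurable h := by
    rw [hh]
    exact (hP.measurable.const_smul (Real.exp η))
  set c : ENNReal := ENNReal.ofReal (Real.exp (-2 * η)) with hc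
  have key : ∀ C : Set ℂ, MeasurableSet C → volume (h ⁻¹' C) = c * volume C := by
    intro C hC
    have e1 : h ⁻¹' C = P ⁻¹' ((fun z : ℂ => (Real.exp η : ℝ) • z) ⁻¹' C) := rfl
    rw [e1, hP.measure_preimage ((measurable_const_smul (Real.exp η) hC).nullMeasurableSet),
      Measure.addHaar_preimage_smul _ (Real.exp_pos η).ne']
    congr 2
    rw [Complex.finrank_real_complex, abs_of_pos (by positivity), ← Real.exp_nat_mul,
      ← Real.exp_neg]
    congr 1
    push_cast
    ring
  have keyn : ∀ n : ℕ, ∀ C : Set ℂ, MeasurableSet C → volume (h^[n] ⁻¹' C) = c ^ n * volume C := by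
    intro n
    induction n with
    | zero => intro C _; simp
    | succ n ih =>
      intro C hC
      rw [Function.iterate_succ', Set.preimage_comp, ih _ (hmeas hC), key C hC, pow_succ]
      ring
  have hsub : ∀ n : ℕ, volume (Metric.ball (0:ℂ) r) ≤ c ^ n * volume (Metric.closedBall (0:ℂ) R) := by
    intro n
    rw [← keyn n _ measurableSet_closedBall]
    apply measure_mono
    intro z hz
    have := hcon n z (by simpa using hz)
    simpa using this
  have hc1 : c < 1 := by
    rw [hc, ENNReal.ofReal_lt_one, Real.exp_lt_one_iff]
    linarith
  have hlim : Filter.Tendsto (fun n : ℕ => c ^ n * volume (Metric.closedBall (0:ℂ) R))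
      Filter.atTop (nhds (0 * volume (Metric.closedBall (0:ℂ) R))) := by
    apply ENNReal.Tendsto.mul_const (ENNReal.tendsto_pow_atTop_nhds_zero_of_lt_one hc1)
    right
    exact (isCompact_closedBall (0:ℂ) R).measure_lt_top.ne
  rw [zero_mul] at hlim
  have := ge_of_tendsto' hlim hsub
  have hpos := Metric.measure_ball_pos volume (0:ℂ) hr
  exact absurd this (not_le.mpr hpos)


theorem indexEta (D : ℂ → ℂ) (hDc : Continuous D)
    (hper : ∀ ζ, D (ζ + 2 * Real.pi * Complex.I) = D ζ) (hne : ∀ ζ, D ζ ≠ 0) (y0 y1 : ℝ) :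
    ∃ η : ℝ, 0 < η ∧ ∀ ζ : ℂ, y0 ≤ ζ.re → ζ.re ≤ y1 → η < ‖D ζ‖ := by
  have hK : IsCompact (Set.Icc y0 y1 ×ℂ Set.Icc 0 (2 * Real.pi)) :=
    IsCompact.reProdIm isCompact_Icc isCompact_Icc
  obtain ⟨a, ha, hle⟩ := hK.exists_forall_le' (f := fun ζ => ‖D ζ‖) (a := 0)
    hDc.norm.continuousOn (fun b _ => norm_pos_iff.mpr (hne b))
  refine ⟨a / 2, by linarith, ?_⟩
  intro ζ h1 h2
  have hp : Function.Periodic D (2 * Real.pi * Complex.I) := hper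
  set n : ℤ := ⌊ζ.im / (2 * Real.pi)⌋ with hn
  have hpi := Real.two_pi_pos
  have e : D ζ = D (ζ - n * (2 * Real.pi * Complex.I)) := (hp.sub_int_mul_eq n).symm
  rw [e]
  have hfl := Int.floor_le (ζ.im / (2 * Real.pi))
  have hfl2 := Int.lt_floor_add_one (ζ.im / (2 * Real.pi))
  rw [← hn] at hfl hfl2
  rw [le_div_iff₀ hpi] at hfl
  rw [div_lt_iff₀ hpi] at hfl2
  have := hle (ζ - n * (2 * Real.pi * Complex.I)) (by
    rw [Complex.mem_reProdIm]
    simp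
    refine ⟨⟨h1, h2⟩, hfl, by linarith⟩)
  linarith

theorem indexLemma (F : ℂ → ℂ) (hFc : Continuous F) (hFinj : Function.Injective F) (P : ℂ → ℂ)
    (hP : MeasurePreserving P volume volume) (hP0 : P 0 = 0)
    (hexp : ∀ ζ, Complex.exp (F ζ) = P (Complex.exp ζ))
    (hper : ∀ ζ, F (ζ + 2 * Real.pi * Complex.I) = F ζ + 2 * Real.pi * Complex.I)
    (B : ℝ) (hB : ∀ ζ, |(F ζ - ζ).re| ≤ B) (κ : ℝ) (hκ : 0 < κ) (y0 y1 : ℝ)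
    (hin : ∀ ζ : ℂ, ζ.re ≤ y0 → F ζ = ζ - κ * Complex.I)
    (hout : ∀ ζ : ℂ, y1 ≤ ζ.re → ζ.im < (F ζ).im) (hne : ∀ ζ, F ζ ≠ ζ)
    (l : ℂ → ℂ) (hl : Continuous l) (hle : ∀ ζ, Complex.exp (l ζ) = F ζ - ζ)
    (zi : ℂ) (hi : zi.re ≤ y0) (h1 : -Real.pi < (l zi).im) (h2 : (l zi).im < 0)
    (zo : ℂ) (ho : y1 ≤ zo.re) : 0 < (l zo).im ∧ (l zo).im < Real.pi := by
  obtain ⟨η, hη, hηD⟩ := indexEta (fun ζ => F ζ - ζ) (by fun_prop)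
    (by intro ζ; simp only [hper]; ring) (fun ζ => sub_ne_zero.mpr (hne ζ)) y0 y1
  set cl : ℝ → ℝ := fun s => max 0 (min 1 s) with hcl
  have hclc : Continuous cl := by fun_prop
  have hcl0 : ∀ s, 0 ≤ cl s := fun s => le_max_left _ _
  have hcl1 : ∀ s, cl s ≤ 1 := fun s => max_le (by norm_num) (min_le_left _ _)
  have cl0 : cl 0 = 0 := by simp [hcl]
  have cl1 : cl 1 = 1 := by simp [hcl]
  set g : ℂ × ℝ → ℂ := fun x => F x.1 - x.1 + ((cl x.2 * η : ℝ) : ℂ) with hg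
  have hgc : Continuous g := by fun_prop
  have hgim : ∀ x, (g x).im = (F x.1).im - x.1.im := by intro x; simp [hg]
  have hgin : ∀ x : ℂ × ℝ, x.1.re ≤ y0 → (g x).im < 0 := by
    intro x hx
    rw [hgim, hin _ hx]; simp [hκ]
  have hgout : ∀ x : ℂ × ℝ, y1 ≤ x.1.re → 0 < (g x).im := by
    intro x hx
    rw [hgim]; linarith [hout _ hx]
  have hg0 : ∀ x, g x ≠ 0 := by
    intro x h0
    by_cases ha : x.1.re ≤ y0
    · have := hgin x ha; rw [h0] at this; simp at this
    by_cases hb : y1 ≤ x.1.re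
    · have := hgout x hb; rw [h0] at this; simp at this
    push Not at ha hb
    have h3 := hηD x.1 ha.le hb.le
    have h4 : F x.1 - x.1 = -((cl x.2 * η : ℝ) : ℂ) := eq_neg_of_add_eq_zero_left h0
    simp only [h4] at h3
    rw [norm_neg, Complex.norm_real, Real.norm_eq_abs, abs_of_nonneg (mul_nonneg (hcl0 _) hη.le)] at h3
    nlinarith [hcl1 x.2]
  obtain ⟨l2, hl2c, hl20, hl2e⟩ := logLift g hgc hg0 (zi, 0) (l zi) (by simp [hg, cl0, hle])
  have hl2l : ∀ ζ, l2 (ζ, 0) = l ζ := by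
    intro ζ
    refine logUniq (s := Set.univ) isPreconnected_univ (fun ζ => l2 (ζ, 0)) l (by fun_prop) (by fun_prop) ?_ zi trivial hl20 ζ trivial
    intro x _
    simp [hl2e, hle, hg, cl0]
  have hS1 : IsPreconnected {x : ℂ × ℝ | x.1.re ≤ y0} := by
    apply Convex.isPreconnected
    have : {x : ℂ × ℝ | x.1.re ≤ y0} = {x | (Complex.reLm.comp (LinearMap.fst ℝ ℂ ℝ)) x ≤ y0} := rfl
    rw [this]
    exact convex_halfSpace_le (LinearMap.isLinear _) _
  have hS2 : IsPreconnected {x : ℂ × ℝ | y1 ≤ x.1.re} := by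
    apply Convex.isPreconnected
    have : {x : ℂ × ℝ | y1 ≤ x.1.re} = {x | y1 ≤ (Complex.reLm.comp (LinearMap.fst ℝ ℂ ℝ)) x} := rfl
    rw [this]
    exact convex_halfSpace_ge (LinearMap.isLinear _) _
  have hinner := stayNeg hS1 l2 hl2c.continuousOn
    (fun x hx => by rw [hl2e]; exact hgin x hx) (zi, 0) hi (by rw [hl20]; exact h1) (by rw [hl20]; exact h2)
  suffices hsuf : ∃ ζ : ℂ, y1 ≤ ζ.re ∧ 0 < (l2 (ζ, 1)).im ∧ (l2 (ζ, 1)).im < Real.pi by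
    obtain ⟨ζ, hζ, ha, hb⟩ := hsuf
    have := stayPos hS2 l2 hl2c.continuousOn
      (fun x hx => by rw [hl2e]; exact hgout x hx) (ζ, 1) hζ ha hb (zo, 0) ho
    rwa [hl2l] at this
  -- dynamics
  set H : ℂ → ℂ := fun ζ => F ζ + (η : ℂ) with hH
  have hHc : Continuous H := by fun_prop
  have hHinj : Function.Injective H := fun x y h => hFinj (add_right_cancel h)
  set h : ℂ → ℂ := fun z => (Real.exp η : ℝ) • P z with hh
  have hHexp : ∀ ζ, Complex.exp (H ζ) = h (Complex.exp ζ) := by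
    intro ζ
    simp only [hH, hh]
    rw [Complex.exp_add, hexp, Complex.real_smul, Complex.ofReal_exp, mul_comm]
  set r := Real.exp (y0 - η) with hr
  set M := max y0 (y1 + B + η) with hM
  obtain ⟨n, z, hz, hzR⟩ := escape P hP η r (Real.exp M) hη (Real.exp_pos _)
  rw [← hh] at hzR
  have hz0 : z ≠ 0 := by
    rintro rfl
    have : h^[n] 0 = 0 := by
      apply Function.iterate_fixed
      simp [hh, hP0]
    rw [this, norm_zero] at hzR
    linarith [Real.exp_pos M]
  set z0 := Complex.log z with hz0d
  have hez0 : Complex.exp z0 = z := Complex.exp_log hz0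
  have hz0re : z0.re + η < y0 := by
    have : z0.re = Real.log ‖z‖ := Complex.log_re z
    rw [this]
    have : Real.log ‖z‖ < y0 - η := by
      rw [Real.log_lt_iff_lt_exp (norm_pos_iff.mpr hz0)]; exact hz
    linarith
  have hHn : ∀ j : ℕ, Complex.exp (H^[j] z0) = h^[j] z := by
    intro j
    induction j with
    | zero => simp [hez0]
    | succ j ih => rw [Function.iterate_succ_apply', Function.iterate_succ_apply', hHexp, ih]
  have hend : M < (H^[n] z0).re := by
    rw [← hHn, Complex.norm_exp] at hzR
    exact Real.exp_lt_exp.mp hzR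
  set v : ℂ := (η : ℂ) - κ * Complex.I with hv
  set lam : ℝ → ℂ := fun t => z0 + t * v with hlam
  have hlamre : ∀ t, (lam t).re = z0.re + t * η := by intro t; simp [hlam, hv]
  have hlaminj : Function.Injective lam := by
    intro a b hab
    have := congrArg Complex.re hab
    rw [hlamre, hlamre] at this
    have h3 : a * η = b * η := by linarith
    exact mul_right_cancel₀ hη.ne' h3
  have hHlam : ∀ t, t ≤ 1 → H (lam t) = lam (t + 1) := by
    intro t ht
    simp only [hH]
    rw [hin _ (by rw [hlamre]; nlinarith)]
    simp only [hlam, hv]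
    push_cast
    ring
  have hHjlam : ∀ j : ℕ, ∀ s : ℝ, s + j ≤ 2 → H^[j] (lam s) = lam (s + j) := by
    intro j
    induction j with
    | zero => intro s _; simp
    | succ j ih =>
      intro s hs
      push_cast at hs
      rw [Function.iterate_succ_apply', ih s (by linarith), hHlam _ (by linarith)]
      push_cast
      congr 1
      ring
  set γ : ℝ → ℂ := fun t => H^[n] (lam (t - n)) with hγ
  have hγc : Continuous γ := by
    have : Continuous lam := by fun_prop
    exact (hHc.iterate n).comp (by fun_prop)
  have hγinj : Function.Injective γ := by
    intro a b hab
    have := hlaminj ((hHinj.iterate n) hab)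
    linarith
  have hγstep : ∀ t : ℝ, t ≤ n → γ (t + 1) = H (γ t) := by
    intro t ht
    simp only [hγ]
    rw [← Function.iterate_succ_apply' H n, Function.iterate_succ_apply, hHlam _ (by linarith)]
    congr 2
    ring
  have hγlam : ∀ t, t ≤ 2 → γ t = lam t := by
    intro t ht
    simp only [hγ]
    rw [hHjlam n _ (by linarith)]
    congr 1; ring
  have hγ0 : γ 0 = z0 := by rw [hγlam 0 (by norm_num)]; simp [hlam]
  have hγn : γ n = H^[n] z0 := by simp [hγ, hlam]
  have hup : ∀ ξ : ℂ, z0.re ≤ ξ.re → z0.re ≤ (H ξ).re := by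
    intro ξ hξ
    by_contra hcon
    push Not at hcon
    have e1 : (H ξ).re = (F ξ).re + η := by simp [hH]
    have e2 : (F ξ).re < z0.re := by linarith
    have e3 : F (F ξ + κ * Complex.I) = F ξ := by
      rw [hin _ (by simp; linarith)]; ring
    have e4 := congrArg Complex.re (hFinj e3)
    simp at e4
    linarith
  have hγlow : ∀ j : ℕ, ∀ t : ℝ, 0 ≤ t → t ≤ n → t ≤ j + 1 → z0.re ≤ (γ t).re := by
    intro j
    induction j with
    | zero =>
      intro t h0 h1 h2
      rw [hγlam t (by push_cast at h2; linarith), hlamre]; nlinarith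
    | succ j ih =>
      intro t h0 h1 h2
      push_cast at h2
      by_cases ht : t ≤ 1
      · rw [hγlam t (by linarith), hlamre]; nlinarith
      · push Not at ht
        have : t = (t - 1) + 1 := by ring
        rw [this, hγstep _ (by linarith)]
        exact hup _ (ih _ (by linarith) (by linarith) (by linarith))
  obtain ⟨T, ⟨hT0, hTn⟩, hTmax⟩ := isCompact_Icc.exists_isMaxOn (s := Set.Icc (0:ℝ) n)
    ⟨0, by simp⟩ (f := fun t => (γ t).re) (by fun_prop)
  have hTmax' : ∀ t : ℝ, 0 ≤ t → t ≤ n → (γ t).re ≤ (γ T).re := fun t h0 h1 => hTmax ⟨h0, h1⟩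
  have hTM : M < (γ T).re := by
    have := hTmax' n (by positivity) le_rfl
    rw [hγn] at this
    linarith
  have hT1 : 1 < T := by
    by_contra hcon
    push Not at hcon
    rw [hγlam T (by linarith), hlamre] at hTM
    have := le_max_left y0 (y1 + B + η)
    nlinarith
  have hγT : γ T = H (γ (T - 1)) := by
    rw [← hγstep _ (by linarith)]; congr 1; ring
  have hTout : y1 ≤ (γ (T - 1)).re := by
    have h3 := le_max_right y0 (y1 + B + η)
    have h4 := (abs_le.mp (hB (γ (T - 1)))).2
    rw [hγT] at hTM
    simp [hH] at hTM h4
    linarith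
  -- the second homotopy
  set ca : ℝ → ℝ := fun a => max 0 (min (T - 1) a) with hca
  have hcac : Continuous ca := by fun_prop
  have hca0 : ∀ s, 0 ≤ ca s := fun s => le_max_left _ _
  have hca1 : ∀ s, ca s ≤ T - 1 := fun s => max_le (by linarith) (min_le_left _ _)
  have ca0 : ca 0 = 0 := by
    simp only [hca]; rw [min_eq_right (by linarith)]; simp
  have ca1 : ca (T - 1) = T - 1 := by
    simp only [hca]; rw [min_self, max_eq_right (by linarith)]
  set bb : ℝ × ℝ → ℝ := fun x => ca x.1 + 1 + cl x.2 * (T - ca x.1 - 1) with hbb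
  have hbbc : Continuous bb := by fun_prop
  have hbb1 : ∀ x, ca x.1 + 1 ≤ bb x := by
    intro x
    have := mul_nonneg (hcl0 x.2) (by linarith [hca1 x.1] : 0 ≤ T - ca x.1 - 1)
    simp only [hbb]; linarith
  have hbb2 : ∀ x, bb x ≤ T := by
    intro x
    have := mul_le_of_le_one_left (by linarith [hca1 x.1] : 0 ≤ T - ca x.1 - 1) (hcl1 x.2)
    simp only [hbb]; linarith
  set m : ℝ × ℝ → ℂ := fun x => γ (bb x) - γ (ca x.1) with hm
  have hmc : Continuous m := by fun_prop
  have hm0 : ∀ x, m x ≠ 0 := by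
    intro x h0
    have := hγinj (sub_eq_zero.mp h0)
    linarith [hbb1 x]
  have hm00 : ∀ a, m (a, 0) = g (γ (ca a), 1) := by
    intro a
    simp only [hm, hbb, cl0, hg, cl1]
    rw [zero_mul, add_zero, hγstep _ (by linarith [hca1 a])]
    simp [hH]; ring
  obtain ⟨l3, hl3c, hl30, hl3e⟩ := logLift m hmc hm0 (0, 0) (l2 (γ 0, 1)) (by
    rw [hl2e, hm00, ca0])
  have hl3l : ∀ a, l3 (a, 0) = l2 (γ (ca a), 1) := by
    intro a
    refine logUniq (s := Set.univ) isPreconnected_univ (fun a => l3 (a, 0)) (fun a => l2 (γ (ca a), 1))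
      (by fun_prop) (by fun_prop) ?_ 0 trivial (by simp only [hl30, ca0]) a trivial
    intro x _
    simp only [hl3e, hl2e, hm00]
  have hstart := hinner (γ 0, 1) (by simp only [Set.mem_ofPred_eq]; rw [hγ0]; linarith)
  have s1 := stayRe (s := {(0:ℝ)} ×ˢ (Set.univ : Set ℝ)) (isPreconnected_singleton.prod isPreconnected_univ)
    l3 hl3c.continuousOn (by
      rintro ⟨a, c⟩ ⟨ha, -⟩
      obtain rfl : a = 0 := ha
      rw [hl3e]
      have h3 := hbb1 (0, c)
      have h4 := hbb2 (0, c)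
      simp only [ca0] at h3
      obtain ⟨j, hj⟩ := exists_nat_ge (bb (0, c))
      have h5 := hγlow j (bb (0, c)) (by linarith) (by linarith) (by linarith)
      simp only [hm, ca0, hγ0, Complex.sub_re]
      linarith) (0, 0) (by simp) (by rw [hl30]; exact hstart.1)
      (by rw [hl30]; linarith [hstart.2, Real.pi_pos]) (0, 1) (by simp)
  have s2 := stayRe (s := (Set.univ : Set ℝ) ×ˢ {(1:ℝ)}) (isPreconnected_univ.prod isPreconnected_singleton)
    l3 hl3c.continuousOn (by
      rintro ⟨a, c⟩ ⟨-, hc⟩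
      obtain rfl : c = 1 := hc
      rw [hl3e]
      have h3 : bb (a, 1) = T := by simp only [hbb, cl1]; ring
      have h4 := hTmax' (ca a) (hca0 a) (by linarith [hca1 a])
      simp only [hm, h3, Complex.sub_re]
      linarith) (0, 1) (by simp) s1.1 s1.2 (T - 1, 1) (by simp)
  have s3 := stayRe (s := {T - 1} ×ˢ (Set.univ : Set ℝ)) (isPreconnected_singleton.prod isPreconnected_univ)
    l3 hl3c.continuousOn (by
      rintro ⟨a, c⟩ ⟨ha, -⟩
      obtain rfl : a = T - 1 := ha
      rw [hl3e]
      have h3 : bb (T - 1, c) = T := by simp only [hbb, ca1]; ring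
      have h4 := hTmax' (T - 1) (by linarith) (by linarith)
      simp only [hm, h3, ca1, Complex.sub_re]
      linarith) (T - 1, 1) (by simp) s2.1 s2.2 (T - 1, 0) (by simp)
  rw [hl3l, ca1] at s3
  refine ⟨γ (T - 1), hTout, ?_, s3.2⟩
  by_contra hcon
  push Not at hcon
  have h5 := hgout (γ (T - 1), 1) hTout
  rw [← hl2e, Complex.exp_im] at h5
  have h6 := Real.sin_nonpos_of_nonpos_of_neg_pi_le hcon s3.1.le
  nlinarith [Real.exp_pos (l2 (γ (T - 1), 1)).re]

theorem poincareBirkhoff (F : ℂ ≃ₜ ℂ) (P Pinv : ℂ → ℂ)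
    (hP : MeasurePreserving P volume volume) (hP0 : P 0 = 0)
    (hPi : MeasurePreserving Pinv volume volume) (hPi0 : Pinv 0 = 0)
    (hexp : ∀ ζ, Complex.exp (F ζ) = P (Complex.exp ζ))
    (hexpi : ∀ ζ, Complex.exp (F.symm ζ) = Pinv (Complex.exp ζ))
    (hper : ∀ ζ, F (ζ + 2 * Real.pi * Complex.I) = F ζ + 2 * Real.pi * Complex.I)
    (B : ℝ) (hB : ∀ ζ, |(F ζ - ζ).re| ≤ B) (κ : ℝ) (hκ : 0 < κ) (y0 y1 : ℝ)
    (hin : ∀ ζ : ℂ, ζ.re ≤ y0 → F ζ = ζ - κ * Complex.I)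
    (hout : ∀ ζ : ℂ, y1 ≤ ζ.re → ζ.im < (F ζ).im) : ∃ ζ, F ζ = ζ := by
  by_contra hcon
  push Not at hcon
  have hBn : 0 ≤ B := le_trans (abs_nonneg _) (hB 0)
  set zi : ℂ := (y0 : ℂ) with hzi
  have hzire : zi.re ≤ y0 := by simp [hzi]
  obtain ⟨l, hlc, hl0, hle⟩ := logLift (fun ζ => F ζ - ζ) (by fun_prop)
    (fun ζ => sub_ne_zero.mpr (hcon ζ)) zi (Complex.log (-(κ : ℂ) * Complex.I)) (by
      rw [Complex.exp_log (by simp [hκ.ne']), hin _ hzire]; ring)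
  have him : (l zi).im = -(Real.pi / 2) := by
    rw [hl0, Complex.log_im]
    have : (-(κ : ℂ) * Complex.I) = (κ : ℝ) * (-Complex.I) := by ring
    rw [this, Complex.arg_real_mul _ hκ, Complex.arg_neg_I]
  have hpi := Real.pi_pos
  have A1 := indexLemma F F.continuous F.injective P hP hP0 hexp hper B hB κ hκ y0 y1 hin hout hcon
    l hlc hle zi hzire (by linarith) (by linarith)
  set cj : ℂ → ℂ := fun z => starRingEnd ℂ z with hcj
  have hcjc : Continuous cj := Complex.continuous_conj
  have hcj2 : ∀ z, cj (cj z) = z := Complex.conj_conj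
  have hsper : ∀ ζ, F.symm (ζ + 2 * Real.pi * Complex.I) = F.symm ζ + 2 * Real.pi * Complex.I := by
    intro ζ
    rw [Homeomorph.symm_apply_eq, hper, F.apply_symm_apply]
  have hsper' : ∀ ζ, F.symm (ζ - 2 * Real.pi * Complex.I) = F.symm ζ - 2 * Real.pi * Complex.I := by
    intro ζ
    have := hsper (ζ - 2 * Real.pi * Complex.I)
    rw [sub_add_cancel] at this
    rw [this]; ring
  have hsre : ∀ ζ, |(F.symm ζ - ζ).re| ≤ B := by
    intro ζ
    have := hB (F.symm ζ)
    rw [F.apply_symm_apply] at this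
    rw [← abs_neg]
    convert this using 2
    simp
  have hcjm : MeasurePreserving cj volume volume :=
    Complex.conjLIE.measurePreserving
  have hsin : ∀ ζ : ℂ, ζ.re ≤ y0 → F.symm ζ = ζ + κ * Complex.I := by
    intro ζ h
    rw [Homeomorph.symm_apply_eq, hin _ (by simpa using h)]; ring
  have key : ∀ ζ, ζ.re ≤ y0 → -Real.pi < (l ζ).im ∧ (l ζ).im < 0 := by
    have hS1 : IsPreconnected {x : ℂ | x.re ≤ y0} := (convex_halfSpace_re_le y0).isPreconnected
    refine stayNeg hS1 l hlc.continuousOn ?_ zi hzire (by linarith) (by linarith)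
    intro x hx
    rw [hle, hin x hx]
    simp [hκ]
  have cj2 : (starRingEnd ℂ) 2 = 2 := Complex.conj_ofNat 2
  set G : ℂ → ℂ := fun ζ => cj (F.symm (cj ζ)) with hG
  have A2 := indexLemma G (by fun_prop)
    (by
      intro a b hab
      have h1 := congrArg cj hab
      simp only [hG, hcj2] at h1
      have h2 := congrArg cj (F.symm.injective h1)
      simpa only [hcj2] using h2)
    (fun z => cj (Pinv (cj z))) (hcjm.comp (hPi.comp hcjm)) (by simp [hcj, hPi0])
    (by
      intro ζ
      simp only [hG, hcj]
      rw [Complex.exp_conj, hexpi, ← Complex.exp_conj])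
    (by
      intro ζ
      have e1 : cj (ζ + 2 * Real.pi * Complex.I) = cj ζ - 2 * Real.pi * Complex.I := by
        simp [hcj, cj2]; ring
      simp only [hG]
      rw [e1, hsper']
      simp [hcj, cj2])
    B (by
      intro ζ
      have := hsre (cj ζ)
      simpa [hG, hcj] using this)
    κ hκ y0 (y1 + B)
    (by
      intro ζ hζ
      simp only [hG]
      rw [hsin _ (by simpa [hcj] using hζ)]
      simp [hcj]; ring)
    (by
      intro ζ hζ
      have h1 := (abs_le.mp (hsre (cj ζ))).1
      have h2 := hout (F.symm (cj ζ)) (by simp [hcj] at h1 ⊢; linarith)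
      rw [F.apply_symm_apply] at h2
      simp [hcj] at h2
      simp [hG, hcj]
      linarith)
    (by
      intro ζ h
      have h1 := congrArg cj h
      simp only [hG, hcj2] at h1
      rw [Homeomorph.symm_apply_eq] at h1
      exact hcon _ h1.symm)
    (fun ζ => cj (l (F.symm (cj ζ)) + Real.pi * Complex.I)) (by fun_prop)
    (by
      intro ζ
      simp only [hG, hcj]
      rw [Complex.exp_conj, Complex.exp_add, Complex.exp_pi_mul_I, hle, F.apply_symm_apply]
      simp)
    zi hzire
    (by
      have := (key (F.symm (cj zi)) (by rw [hsin _ (by simpa [hcj] using hzire)]; simpa [hcj] using hzire)).2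
      simp [hcj] at this ⊢
      linarith)
    (by
      have := (key (F.symm (cj zi)) (by rw [hsin _ (by simpa [hcj] using hzire)]; simpa [hcj] using hzire)).1
      simp [hcj] at this ⊢
      linarith)
  have B1 := A1 (F.symm (((y1 + B : ℝ) : ℂ))) (by
    have := (abs_le.mp (hsre ((y1 + B : ℝ) : ℂ))).1
    simp at this ⊢
    linarith)
  have B2 := A2 ((y1 + B : ℝ) : ℂ) (by simp)
  have e : cj ((y1 + B : ℝ) : ℂ) = ((y1 + B : ℝ) : ℂ) := Complex.conj_ofReal _
  simp only [e] at B2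
  have e2 : ∀ z : ℂ, (cj (z + Real.pi * Complex.I)).im = -z.im - Real.pi := by
    intro z; simp [hcj]; ring
  rw [e2] at B2
  linarith [B1.1, B2.1]


/-- Data of a lifted area preserving map. -/
structure LiftPair (F : ℂ ≃ₜ ℂ) (P Pinv : ℂ → ℂ) : Prop where
  hP : MeasurePreserving P volume volume
  hP0 : P 0 = 0
  hPi : MeasurePreserving Pinv volume volume
  hPi0 : Pinv 0 = 0
  hexp : ∀ ζ, Complex.exp (F ζ) = P (Complex.exp ζ)
  hexpi : ∀ ζ, Complex.exp (F.symm ζ) = Pinv (Complex.exp ζ)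
  hper : ∀ ζ, F (ζ + 2 * Real.pi * Complex.I) = F ζ + 2 * Real.pi * Complex.I

theorem LiftPair.refl : LiftPair (Homeomorph.refl ℂ) id id :=
  ⟨MeasurePreserving.id _, rfl, MeasurePreserving.id _, rfl, fun _ => rfl, fun _ => rfl,
    fun _ => rfl⟩

theorem LiftPair.trans {F G : ℂ ≃ₜ ℂ} {P Pi Q Qi : ℂ → ℂ} (h : LiftPair F P Pi)
    (k : LiftPair G Q Qi) : LiftPair (F.trans G) (Q ∘ P) (Pi ∘ Qi) where
  hP := k.hP.comp h.hP
  hP0 := by simp [h.hP0, k.hP0]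
  hPi := h.hPi.comp k.hPi
  hPi0 := by simp [h.hPi0, k.hPi0]
  hexp ζ := by simp [h.hexp, k.hexp]
  hexpi ζ := by simp [h.hexpi, k.hexpi]
  hper ζ := by simp [h.hper, k.hper]

/-- lift of a map of the punctured plane through `exp`. -/
noncomputable def liftMap (s : ℂ → ℂ) (ζ : ℂ) : ℂ := ζ + Complex.log (s (Complex.exp ζ) / Complex.exp ζ)

theorem liftMap_exp (s : ℂ → ℂ) (hs : ∀ z, z ≠ 0 → s z / z ∈ Complex.slitPlane) (ζ : ℂ) :
    Complex.exp (liftMap s ζ) = s (Complex.exp ζ) := by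
  have h := Complex.exp_ne_zero ζ
  rw [liftMap, Complex.exp_add, Complex.exp_log (Complex.slitPlane_ne_zero (hs _ h))]
  field_simp

theorem liftMap_cont (s : ℂ → ℂ) (hsc : Continuous s)
    (hs : ∀ z, z ≠ 0 → s z / z ∈ Complex.slitPlane) : Continuous (liftMap s) := by
  unfold liftMap
  apply continuous_id.add
  apply Continuous.clog
  · exact (hsc.comp Complex.continuous_exp).div Complex.continuous_exp Complex.exp_ne_zero
  · intro ζ; exact hs _ (Complex.exp_ne_zero ζ)

theorem liftMap_inv (s s' : ℂ → ℂ) 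
    (hs : ∀ z, z ≠ 0 → s z / z ∈ Complex.slitPlane) (hinv : ∀ z, s' (s z) = z) (ζ : ℂ) :
    liftMap s' (liftMap s ζ) = ζ := by
  have h := Complex.exp_ne_zero ζ
  rw [liftMap, liftMap_exp s hs, hinv]
  rw [liftMap]
  have : Complex.exp ζ / s (Complex.exp ζ) = (s (Complex.exp ζ) / Complex.exp ζ)⁻¹ := by
    rw [inv_div]
  rw [this, Complex.log_inv _ (Complex.slitPlane_arg_ne_pi (hs _ h))]
  ring

theorem liftMap_per (s : ℂ → ℂ) (ζ : ℂ) :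
    liftMap s (ζ + 2 * Real.pi * Complex.I) = liftMap s ζ + 2 * Real.pi * Complex.I := by
  simp only [liftMap, Complex.exp_periodic ζ]
  ring

theorem liftExists (s s' : ℂ → ℂ) (hsc : Continuous s) (hsc' : Continuous s')
    (hs : ∀ z, z ≠ 0 → s z / z ∈ Complex.slitPlane)
    (hs' : ∀ z, z ≠ 0 → s' z / z ∈ Complex.slitPlane)
    (hinv : ∀ z, s' (s z) = z) (hinv' : ∀ z, s (s' z) = z)
    (hm : MeasurePreserving s volume volume) (hm' : MeasurePreserving s' volume volume)
    (h0 : s 0 = 0) (h0' : s' 0 = 0) :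
    ∃ F : ℂ ≃ₜ ℂ, LiftPair F s s' ∧ ∀ ζ, F ζ = liftMap s ζ :=
  ⟨⟨⟨liftMap s, liftMap s', liftMap_inv s s' hs hinv, liftMap_inv s' s hs' hinv'⟩,
    liftMap_cont s hsc hs, liftMap_cont s' hsc' hs'⟩,
    ⟨hm, h0, hm', h0', liftMap_exp s hs, liftMap_exp s' hs', liftMap_per s⟩, fun _ => rfl⟩

noncomputable def driftMap (g : ℝ → ℝ) (z : ℂ) : ℂ := z + g z.re * Complex.I
noncomputable def kickMap (g : ℝ → ℝ) (z : ℂ) : ℂ := z - g z.im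

theorem skew_mp (g : ℝ → ℝ) (hg : Continuous g) :
    MeasurePreserving (fun x : ℝ × ℝ => (x.1, x.2 + g x.1)) volume volume := by
  have := MeasurePreserving.skew_product (μa := (volume : Measure ℝ)) (μb := (volume : Measure ℝ))
    (μc := (volume : Measure ℝ)) (μd := (volume : Measure ℝ)) (f := id)
    (MeasurePreserving.id _) (g := fun x y => y + g x) (by fun_prop)
    (Filter.Eventually.of_forall fun x => (measurePreserving_add_right volume (g x)).map_eq)
  exact this

theorem drift_mp (g : ℝ → ℝ) (hg : Continuous g) : MeasurePreserving (driftMap g) volume volume := by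
  have h1 := Complex.volume_preserving_equiv_real_prod
  have h2 := (h1.symm Complex.measurableEquivRealProd).comp ((skew_mp g hg).comp h1)
  have e : driftMap g = (Complex.measurableEquivRealProd.symm ∘
      (fun x : ℝ × ℝ => (x.1, x.2 + g x.1)) ∘ Complex.measurableEquivRealProd) := by
    funext z
    apply Complex.ext <;> simp [driftMap, Complex.measurableEquivRealProd_symm_apply]
  rw [e]
  exact h2

theorem kick_mp (g : ℝ → ℝ) (hg : Continuous g) : MeasurePreserving (kickMap g) volume volume := by
  have h1 := Complex.volume_preserving_equiv_real_prod
  have hsw : MeasurePreserving (Prod.swap : ℝ × ℝ → ℝ × ℝ) volume volume := Measure.measurePreserving_swap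
  have h2 := (h1.symm Complex.measurableEquivRealProd).comp (hsw.comp
    ((skew_mp (fun x => - g x) hg.neg).comp (hsw.comp h1)))
  have e : kickMap g = (Complex.measurableEquivRealProd.symm ∘ Prod.swap ∘
      (fun x : ℝ × ℝ => (x.1, x.2 + (fun x => - g x) x.1)) ∘ Prod.swap ∘ Complex.measurableEquivRealProd) := by
    funext z
    apply Complex.ext <;> simp [kickMap, Complex.measurableEquivRealProd_symm_apply, sub_eq_add_neg]
  rw [e]
  exact h2

theorem slit_aux (g x y : ℝ) (hxy : ¬ (x = 0 ∧ y = 0)) (hx : x = 0 → g = 0) (q : ℂ)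
    (hq : q.im = g * x / (x ^ 2 + y ^ 2)) (hq0 : g = 0 → q = 1) : q ∈ Complex.slitPlane := by
  rw [Complex.mem_slitPlane_iff]
  by_cases hg : g = 0
  · left; rw [hq0 hg]; simp
  · right
    have hx' : x ≠ 0 := fun h => hg (hx h)
    rw [hq]
    have : 0 < x ^ 2 + y ^ 2 := by positivity
    positivity

theorem drift_q (g : ℝ → ℝ) (z : ℂ) (hz : z ≠ 0) :
    driftMap g z / z = 1 + g z.re * Complex.I / z := by
  rw [driftMap]; field_simp

theorem kick_q (g : ℝ → ℝ) (z : ℂ) (hz : z ≠ 0) :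
    kickMap g z / z = 1 + (-(g z.im) : ℂ) / z := by
  rw [kickMap]; field_simp; ring

theorem drift_im (c : ℝ) (z : ℂ) : (c * Complex.I / z).im = c * z.re / (z.re ^ 2 + z.im ^ 2) := by
  rw [Complex.div_im, Complex.normSq_apply]
  simp
  ring

theorem kick_im (c : ℝ) (z : ℂ) : ((-(c : ℂ)) / z).im = c * z.im / (z.im ^ 2 + z.re ^ 2) := by
  rw [Complex.div_im, Complex.normSq_apply]
  simp
  ring

theorem drift_slit (g : ℝ → ℝ) (h0 : g 0 = 0) (z : ℂ) (hz : z ≠ 0) :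
    driftMap g z / z ∈ Complex.slitPlane := by
  apply slit_aux (g z.re) z.re z.im (fun h => hz (Complex.ext h.1 h.2)) (fun h => by rw [h, h0])
  · rw [drift_q g z hz, Complex.add_im, drift_im]; simp
  · intro h; rw [drift_q g z hz, h]; simp

theorem kick_slit (g : ℝ → ℝ) (h0 : g 0 = 0) (z : ℂ) (hz : z ≠ 0) :
    kickMap g z / z ∈ Complex.slitPlane := by
  apply slit_aux (g z.im) z.im z.re (fun h => hz (Complex.ext h.2 h.1)) (fun h => by rw [h, h0])
  · rw [kick_q g z hz, Complex.add_im, kick_im]; simp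
  · intro h; rw [kick_q g z hz, h]; simp

theorem driftLift (g : ℝ → ℝ) (hg : Continuous g) (h0 : g 0 = 0) :
    ∃ F : ℂ ≃ₜ ℂ, LiftPair F (driftMap g) (driftMap (fun x => - g x)) ∧
      ∀ ζ, F ζ = liftMap (driftMap g) ζ := by
  apply liftExists
  · unfold driftMap; fun_prop
  · unfold driftMap; fun_prop
  · exact drift_slit g h0
  · exact drift_slit _ (by simp [h0])
  · intro z; simp [driftMap]
  · intro z; simp [driftMap]
  · exact drift_mp g hg
  · exact drift_mp _ hg.neg
  · simp [driftMap, h0]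
  · simp [driftMap, h0]

theorem kickLift (g : ℝ → ℝ) (hg : Continuous g) (h0 : g 0 = 0) :
    ∃ F : ℂ ≃ₜ ℂ, LiftPair F (kickMap g) (kickMap (fun x => - g x)) ∧
      ∀ ζ, F ζ = liftMap (kickMap g) ζ := by
  apply liftExists
  · unfold kickMap; fun_prop
  · unfold kickMap; fun_prop
  · exact kick_slit g h0
  · exact kick_slit _ (by simp [h0])
  · intro z; simp [kickMap]
  · intro z; simp [kickMap]
  · exact kick_mp g hg
  · exact kick_mp _ hg.neg
  · simp [kickMap, h0]
  · simp [kickMap, h0]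

theorem log_est (w : ℂ) (e : ℝ) (he : e ≤ 1 / 2) (hw : ‖w‖ ≤ e) :
    ‖Complex.log (1 + w)‖ ≤ 2 * e ∧ w.im - e ^ 2 ≤ (Complex.log (1 + w)).im := by
  have h1 := Complex.norm_log_one_add_sub_self_le (z := w) (by linarith)
  have hn := norm_nonneg w
  have h2 : ‖w‖ ^ 2 * (1 - ‖w‖)⁻¹ / 2 ≤ ‖w‖ ^ 2 := by
    have : (1 - ‖w‖)⁻¹ ≤ 2 := by
      rw [inv_le_comm₀ (by linarith) (by norm_num)]; linarith
    nlinarith [sq_nonneg ‖w‖]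
  have h3 : ‖w‖ ^ 2 ≤ e ^ 2 := by gcongr
  constructor
  · have : Complex.log (1 + w) = (Complex.log (1 + w) - w) + w := by ring
    rw [this]
    refine (norm_add_le _ _).trans ?_
    nlinarith
  · have h4 := Complex.abs_im_le_norm (Complex.log (1 + w) - w)
    rw [Complex.sub_im] at h4
    have := (abs_le.mp h4).1
    linarith

/-- one lifted shear: estimates.  `e` bounds the relative size, `h` is the step. -/
theorem driftEst (g : ℝ → ℝ) (C h Om : ℝ) (hC : 0 ≤ C) (hh : 0 ≤ h) (hCh : C * h ≤ 1 / 2)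
    (hg : ∀ x, |g x| ≤ C * h * |x|) (hg2 : ∀ x, |g x - h * Om * x| ≤ C * h) (ζ : ℂ) :
    ‖liftMap (driftMap g) ζ - ζ‖ ≤ 2 * (C * h) ∧
    h * (Om * Real.cos ζ.im ^ 2 - C * Real.exp (-ζ.re)) - (C * h) ^ 2
      ≤ (liftMap (driftMap g) ζ).im - ζ.im := by
  set z := Complex.exp ζ with hz
  have hz0 : z ≠ 0 := Complex.exp_ne_zero ζ
  have e1 : liftMap (driftMap g) ζ - ζ = Complex.log (1 + g z.re * Complex.I / z) := by
    rw [liftMap, ← hz, drift_q g z hz0]; ring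
  have hn : 0 < ‖z‖ := norm_pos_iff.mpr hz0
  have hw : ‖g z.re * Complex.I / z‖ ≤ C * h := by
    rw [norm_div, norm_mul, Complex.norm_I, Complex.norm_real, Real.norm_eq_abs, div_le_iff₀ hn]
    have := Complex.abs_re_le_norm z
    have h2 := hg z.re
    have h3 : C * h * |z.re| ≤ C * h * ‖z‖ := by gcongr
    linarith
  obtain ⟨h1, h2⟩ := log_est _ _ hCh hw
  rw [← e1] at h1 h2
  refine ⟨h1, ?_⟩
  rw [Complex.sub_im, drift_im] at h2
  have hre : z.re = Real.exp ζ.re * Real.cos ζ.im := Complex.exp_re ζ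
  have him : z.im = Real.exp ζ.re * Real.sin ζ.im := Complex.exp_im ζ
  set r := Real.exp ζ.re with hr
  have hr0 : 0 < r := Real.exp_pos _
  have hden : z.re ^ 2 + z.im ^ 2 = r ^ 2 := by
    rw [hre, him]; nlinarith [Real.sin_sq_add_cos_sq ζ.im]
  rw [hden] at h2
  have hei : Real.exp (-ζ.re) = r⁻¹ := Real.exp_neg _
  rw [hei]
  have h3 := hg2 z.re
  have h4 : -(C * h * |z.re|) ≤ (g z.re - h * Om * z.re) * z.re := by
    have : |(g z.re - h * Om * z.re) * z.re| ≤ C * h * |z.re| := by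
      rw [abs_mul]; gcongr
    linarith [(abs_le.mp this).1]
  have h5 : |z.re| ≤ r := by
    rw [hre, abs_mul, abs_of_pos hr0]
    nlinarith [Real.abs_cos_le_one ζ.im]
  have h6 : h * (Om * Real.cos ζ.im ^ 2 - C * r⁻¹) ≤ g z.re * z.re / r ^ 2 := by
    rw [le_div_iff₀ (by positivity)]
    have : h * (Om * Real.cos ζ.im ^ 2 - C * r⁻¹) * r ^ 2 = h * Om * z.re * z.re - C * h * r := by
      rw [hre]; field_simp
    rw [this]
    have : C * h * |z.re| ≤ C * h * r := by gcongr
    linarith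
  linarith

theorem kickEst (g : ℝ → ℝ) (C h Om : ℝ) (hC : 0 ≤ C) (hh : 0 ≤ h) (hCh : C * h ≤ 1 / 2)
    (hg : ∀ x, |g x| ≤ C * h * |x|) (hg2 : ∀ x, |g x - h * Om * x| ≤ C * h) (ζ : ℂ) :
    ‖liftMap (kickMap g) ζ - ζ‖ ≤ 2 * (C * h) ∧
    h * (Om * Real.sin ζ.im ^ 2 - C * Real.exp (-ζ.re)) - (C * h) ^ 2
      ≤ (liftMap (kickMap g) ζ).im - ζ.im := by
  set z := Complex.exp ζ with hz
  have hz0 : z ≠ 0 := Complex.exp_ne_zero ζ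
  have e1 : liftMap (kickMap g) ζ - ζ = Complex.log (1 + (-(g z.im) : ℂ) / z) := by
    rw [liftMap, ← hz, kick_q g z hz0]; ring
  have hn : 0 < ‖z‖ := norm_pos_iff.mpr hz0
  have hw : ‖(-(g z.im) : ℂ) / z‖ ≤ C * h := by
    rw [norm_div, norm_neg, Complex.norm_real, Real.norm_eq_abs, div_le_iff₀ hn]
    have := Complex.abs_im_le_norm z
    have h2 := hg z.im
    have h3 : C * h * |z.im| ≤ C * h * ‖z‖ := by gcongr
    linarith
  obtain ⟨h1, h2⟩ := log_est _ _ hCh hw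
  rw [← e1] at h1 h2
  refine ⟨h1, ?_⟩
  rw [Complex.sub_im, kick_im] at h2
  have hre : z.re = Real.exp ζ.re * Real.cos ζ.im := Complex.exp_re ζ
  have him : z.im = Real.exp ζ.re * Real.sin ζ.im := Complex.exp_im ζ
  set r := Real.exp ζ.re with hr
  have hr0 : 0 < r := Real.exp_pos _
  have hden : z.im ^ 2 + z.re ^ 2 = r ^ 2 := by
    rw [hre, him]; nlinarith [Real.sin_sq_add_cos_sq ζ.im]
  rw [hden] at h2
  have hei : Real.exp (-ζ.re) = r⁻¹ := Real.exp_neg _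
  rw [hei]
  have h3 := hg2 z.im
  have h4 : -(C * h * |z.im|) ≤ (g z.im - h * Om * z.im) * z.im := by
    have : |(g z.im - h * Om * z.im) * z.im| ≤ C * h * |z.im| := by
      rw [abs_mul]; gcongr
    linarith [(abs_le.mp this).1]
  have h5 : |z.im| ≤ r := by
    rw [him, abs_mul, abs_of_pos hr0]
    nlinarith [Real.abs_sin_le_one ζ.im]
  have h6 : h * (Om * Real.sin ζ.im ^ 2 - C * r⁻¹) ≤ g z.im * z.im / r ^ 2 := by
    rw [le_div_iff₀ (by positivity)]
    have : h * (Om * Real.sin ζ.im ^ 2 - C * r⁻¹) * r ^ 2 = h * Om * z.im * z.im - C * h * r := by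
      rw [him]; field_simp
    rw [this]
    have : C * h * |z.im| ≤ C * h * r := by gcongr
    linarith
  linarith


theorem stepLift (g1 g2 : ℝ → ℝ) (hg1 : Continuous g1) (hg2 : Continuous g2)
    (C h Om δ : ℝ) (hδ : 0 < δ) (hC : 0 ≤ C) (hh : 0 ≤ h) (hCh : C * h ≤ 1 / 2) (hOm : 0 ≤ Om)
    (hb1 : ∀ x, |g1 x| ≤ C * h * |x|) (ho1 : ∀ x, |g1 x - h * Om * x| ≤ C * h)
    (hb2 : ∀ x, |g2 x| ≤ C * h * |x|) (ho2 : ∀ x, |g2 x - h * Om * x| ≤ C * h)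
    (hv1 : ∀ x, |x| ≤ δ → g1 x = 0) (hv2 : ∀ x, |x| ≤ δ → g2 x = 0) :
    ∃ (F : ℂ ≃ₜ ℂ) (P Pinv : ℂ → ℂ), LiftPair F P Pinv ∧
      (∀ ζ, (Complex.exp (F ζ)).im = (Complex.exp ζ).im + g1 (Complex.exp ζ).re) ∧
      (∀ ζ, (Complex.exp (F ζ)).re = (Complex.exp ζ).re - g2 (Complex.exp (F ζ)).im) ∧
      (∀ ζ, ‖F ζ - ζ‖ ≤ 4 * (C * h)) ∧
      (∀ ζ, h * (Om - 2 * C * h * Om - 2 * C * Real.exp (-ζ.re + 1)) - 2 * (C * h) ^ 2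
        ≤ (F ζ).im - ζ.im) ∧
      (∀ ζ : ℂ, Real.exp ζ.re ≤ δ → F ζ = ζ) := by
  have h10 : g1 0 = 0 := hv1 0 (by simpa using hδ.le)
  have h20 : g2 0 = 0 := hv2 0 (by simpa using hδ.le)
  obtain ⟨F1, L1, e1⟩ := driftLift g1 hg1 h10
  obtain ⟨F2, L2, e2⟩ := kickLift g2 hg2 h20
  have est1 := driftEst g1 C h Om hC hh hCh hb1 ho1
  have est2 := kickEst g2 C h Om hC hh hCh hb2 ho2
  simp only [← e1] at est1
  simp only [← e2] at est2
  have hCh0 : 0 ≤ C * h := by positivity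
  refine ⟨F1.trans F2, _, _, L1.trans L2, ?_, ?_, ?_, ?_, ?_⟩
  · intro ζ
    simp only [Homeomorph.trans_apply, L2.hexp, L1.hexp]
    simp [driftMap, kickMap]
  · intro ζ
    simp only [Homeomorph.trans_apply, L2.hexp, L1.hexp]
    simp [driftMap, kickMap]
  · intro ζ
    have a1 := (est1 ζ).1
    have a2 := (est2 (F1 ζ)).1
    have : (F1.trans F2) ζ - ζ = (F2 (F1 ζ) - F1 ζ) + (F1 ζ - ζ) := by simp
    rw [this]
    refine (norm_add_le _ _).trans ?_
    linarith
  · intro ζ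
    obtain ⟨n1, i1⟩ := est1 ζ
    obtain ⟨n2, i2⟩ := est2 (F1 ζ)
    simp only [Homeomorph.trans_apply]
    set ξ := F1 ζ with hξ
    have hre := Complex.abs_re_le_norm (ξ - ζ)
    have him := Complex.abs_im_le_norm (ξ - ζ)
    rw [Complex.sub_re] at hre
    rw [Complex.sub_im] at him
    have hre1 := (abs_le.mp (hre.trans n1)).1
    have ex1 : Real.exp (-ζ.re) ≤ Real.exp (-ζ.re + 1) := Real.exp_le_exp.mpr (by linarith)
    have ex2 : Real.exp (-ξ.re) ≤ Real.exp (-ζ.re + 1) := Real.exp_le_exp.mpr (by linarith)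
    have hs : Real.sin ξ.im ^ 2 - Real.sin ζ.im ^ 2 = Real.sin (ξ.im - ζ.im) * Real.sin (ξ.im + ζ.im) := by
      rw [Real.sin_sub, Real.sin_add]
      have c1 := Real.sin_sq_add_cos_sq ξ.im
      have c2 := Real.sin_sq_add_cos_sq ζ.im
      linear_combination (Real.sin ζ.im ^ 2) * c1 - Real.sin ξ.im ^ 2 * c2
    have hs2 : |Real.sin ξ.im ^ 2 - Real.sin ζ.im ^ 2| ≤ 2 * (C * h) := by
      rw [hs, abs_mul]
      have q1 := Real.abs_sin_le_abs (x := ξ.im - ζ.im)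
      have q2 := Real.abs_sin_le_one (ξ.im + ζ.im)
      have q3 : |Real.sin (ξ.im - ζ.im)| ≤ 2 * (C * h) := q1.trans (him.trans n1)
      nlinarith [abs_nonneg (Real.sin (ξ.im - ζ.im)), abs_nonneg (Real.sin (ξ.im + ζ.im))]
    have hs3 := (abs_le.mp hs2).1
    have c2 := Real.sin_sq_add_cos_sq ζ.im
    have hs4 : 1 - 2 * (C * h) ≤ Real.cos ζ.im ^ 2 + Real.sin ξ.im ^ 2 := by linarith
    have hs5 : h * Om * (1 - 2 * (C * h)) ≤ h * Om * (Real.cos ζ.im ^ 2 + Real.sin ξ.im ^ 2) := by gcongr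
    have hs6 : h * C * Real.exp (-ζ.re) ≤ h * C * Real.exp (-ζ.re + 1) := by gcongr
    have hs7 : h * C * Real.exp (-ξ.re) ≤ h * C * Real.exp (-ζ.re + 1) := by gcongr
    nlinarith
  · intro ζ hζ
    have hn : ‖Complex.exp ζ‖ ≤ δ := by rw [Complex.norm_exp]; exact hζ
    have f1 : F1 ζ = ζ := by
      rw [e1, liftMap, driftMap, hv1 _ ((Complex.abs_re_le_norm _).trans hn)]
      simp
    have f2 : F2 ζ = ζ := by
      rw [e2, liftMap, kickMap, hv2 _ ((Complex.abs_im_le_norm _).trans hn)]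
      simp
    simp [f1, f2]

theorem discretePB (g1 g2 : ℕ → ℝ → ℝ) (hg1 : ∀ j, Continuous (g1 j)) (hg2 : ∀ j, Continuous (g2 j))
    (C Om δ : ℝ) (N : ℕ) (hN : 0 < N) (hδ : 0 < δ) (hC : 0 ≤ C) (hCh : C * (1 / N : ℝ) ≤ 1 / 2)
    (hOm : 0 ≤ Om)
    (hb1 : ∀ j x, |g1 j x| ≤ C * (1 / N : ℝ) * |x|)
    (ho1 : ∀ j x, |g1 j x - (1 / N : ℝ) * Om * x| ≤ C * (1 / N : ℝ))
    (hb2 : ∀ j x, |g2 j x| ≤ C * (1 / N : ℝ) * |x|)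
    (ho2 : ∀ j x, |g2 j x - (1 / N : ℝ) * Om * x| ≤ C * (1 / N : ℝ))
    (hv1 : ∀ j x, |x| ≤ δ → g1 j x = 0) (hv2 : ∀ j x, |x| ≤ δ → g2 j x = 0)
    (k : ℕ) (hk : 1 ≤ k) (y1 : ℝ)
    (hy1 : 2 * Real.pi * k < Om - 2 * C * (1 / N) * Om - 2 * C * Real.exp (-(y1 - 4 * C) + 1)
      - 2 * C ^ 2 * (1 / N)) :
    ∃ ζ : ℕ → ℂ, ζ N = ζ 0 + 2 * Real.pi * k * Complex.I ∧
      (∀ j, (Complex.exp (ζ (j + 1))).im = (Complex.exp (ζ j)).im + g1 j (Complex.exp (ζ j)).re) ∧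
      (∀ j, (Complex.exp (ζ (j + 1))).re = (Complex.exp (ζ j)).re - g2 j (Complex.exp (ζ (j + 1))).im) ∧
      (∀ j, ‖ζ (j + 1) - ζ j‖ ≤ 4 * C * (1 / N)) ∧
      Real.log δ ≤ (ζ 0).re ∧ (ζ 0).re ≤ y1 ∧ 0 ≤ (ζ 0).im ∧ (ζ 0).im ≤ 2 * Real.pi := by
  set h : ℝ := 1 / N with hh
  have hNr : (0 : ℝ) < N := by exact_mod_cast hN
  have hh0 : 0 < h := by positivity
  have hhN : h * N = 1 := by rw [hh]; field_simp
  choose S P Pinv hL hS1 hS2 hS3 hS4 hS5 using fun j => stepLift (g1 j) (g2 j) (hg1 j) (hg2 j)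
    C h Om δ hδ hC hh0.le hCh hOm (hb1 j) (ho1 j) (hb2 j) (ho2 j) (hv1 j) (hv2 j)
  set G : ℕ → (ℂ ≃ₜ ℂ) := fun n => Nat.rec (Homeomorph.refl ℂ) (fun j f => f.trans (S j)) n with hG
  have G0 : ∀ ζ, G 0 ζ = ζ := fun ζ => rfl
  have Gs : ∀ j ζ, G (j + 1) ζ = S j (G j ζ) := fun j ζ => rfl
  have hGL : ∀ j, ∃ Q Qi, LiftPair (G j) Q Qi := by
    intro j
    induction j with
    | zero => exact ⟨_, _, LiftPair.refl⟩
    | succ j ih =>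
      obtain ⟨Q, Qi, hq⟩ := ih
      exact ⟨_, _, hq.trans (hL j)⟩
  have hdist : ∀ j ζ, ‖G j ζ - ζ‖ ≤ 4 * (C * h) * j := by
    intro j ζ
    induction j with
    | zero => simp [G0]
    | succ j ih =>
      rw [Gs]
      have : S j (G j ζ) - ζ = (S j (G j ζ) - G j ζ) + (G j ζ - ζ) := by ring
      rw [this]
      refine (norm_add_le _ _).trans ?_
      have := hS3 j (G j ζ)
      push_cast
      linarith
  have hdist1 : ∀ j, j ≤ N → ∀ ζ, ‖G j ζ - ζ‖ ≤ 4 * C := by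
    intro j hj ζ
    refine (hdist j ζ).trans ?_
    have : (j : ℝ) ≤ N := by exact_mod_cast hj
    have h2 : 4 * (C * h) * j ≤ 4 * (C * h) * N := by gcongr
    have h3 : 4 * (C * h) * N = 4 * C * (h * N) := by ring
    rw [h3, hhN] at h2
    linarith
  have hfix : ∀ j (ζ : ℂ), Real.exp ζ.re ≤ δ → G j ζ = ζ := by
    intro j ζ hζ
    induction j with
    | zero => rfl
    | succ j ih => rw [Gs, ih, hS5 j ζ hζ]
  set κ := Om - 2 * C * h * Om - 2 * C * Real.exp (-(y1 - 4 * C) + 1) - 2 * C ^ 2 * h with hκ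
  have hrot : ∀ ζ : ℂ, y1 ≤ ζ.re → ∀ j, j ≤ N → h * κ * j ≤ (G j ζ).im - ζ.im := by
    intro ζ hζ j
    induction j with
    | zero => intro _; simp [G0]
    | succ j ih =>
      intro hj
      have i1 := ih (by omega)
      have i2 := hS4 j (G j ζ)
      have i3 := hdist1 j (by omega) ζ
      have i4 := (abs_le.mp ((Complex.abs_re_le_norm (G j ζ - ζ)).trans i3)).1
      rw [Complex.sub_re] at i4
      have i5 : Real.exp (-(G j ζ).re + 1) ≤ Real.exp (-(y1 - 4 * C) + 1) :=
        Real.exp_le_exp.mpr (by linarith)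
      have i6 : h * (2 * C * Real.exp (-(G j ζ).re + 1)) ≤ h * (2 * C * Real.exp (-(y1 - 4 * C) + 1)) := by
        gcongr
      rw [Gs]
      push_cast
      have : h * κ = h * (Om - 2 * C * h * Om - 2 * C * Real.exp (-(y1 - 4 * C) + 1)) - 2 * (C * h) ^ 2 := by
        rw [hκ]; ring
      rw [mul_add, mul_one, this]
      rw [this] at i1
      nlinarith
  obtain ⟨Q, Qi, hq⟩ := hGL N
  have hpi := Real.pi_pos
  have hk0 : (1 : ℝ) ≤ k := by exact_mod_cast hk
  set T : ℂ ≃ₜ ℂ := Homeomorph.addRight (-(2 * Real.pi * k * Complex.I)) with hT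
  have hTa : ∀ ζ, T ζ = ζ - 2 * Real.pi * k * Complex.I := by intro ζ; simp [hT, sub_eq_add_neg]
  have hTs : ∀ ζ, T.symm ζ = ζ + 2 * Real.pi * k * Complex.I := by
    intro ζ; rw [Homeomorph.symm_apply_eq, hTa]; ring
  have eper : ∀ ζ : ℂ, Complex.exp (ζ + 2 * Real.pi * k * Complex.I) = Complex.exp ζ := by
    intro ζ
    rw [Complex.exp_eq_exp_iff_exists_int]
    exact ⟨k, by push_cast; ring⟩
  have eper' : ∀ ζ : ℂ, Complex.exp (ζ - 2 * Real.pi * k * Complex.I) = Complex.exp ζ := by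
    intro ζ
    rw [← eper (ζ - 2 * Real.pi * k * Complex.I), sub_add_cancel]
  have hTL : LiftPair T id id := by
    refine ⟨MeasurePreserving.id _, rfl, MeasurePreserving.id _, rfl, ?_, ?_, ?_⟩
    · intro ζ; rw [hTa, eper']; rfl
    · intro ζ; rw [hTs, eper]; rfl
    · intro ζ; rw [hTa, hTa]; ring
  have hTq := hq.trans hTL
  obtain ⟨ξ, hξ⟩ := poincareBirkhoff ((G N).trans T) _ _ hTq.hP hTq.hP0 hTq.hPi hTq.hPi0 hTq.hexp
    hTq.hexpi hTq.hper (4 * C) (by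
      intro ζ
      have := (Complex.abs_re_le_norm _).trans (hdist1 N le_rfl ζ)
      simpa [hTa] using this) (2 * Real.pi * k) (by positivity) (Real.log δ) y1 (by
      intro ζ hζ
      have : Real.exp ζ.re ≤ δ := by
        rw [← Real.exp_log hδ]; exact Real.exp_le_exp.mpr hζ
      rw [Homeomorph.trans_apply, hfix N ζ this, hTa]
      push_cast; ring) (by
      intro ζ hζ
      have h1 := hrot ζ hζ N le_rfl
      have h2 : h * κ * N = κ := by rw [mul_right_comm, hhN, one_mul]
      rw [h2] at h1
      rw [Homeomorph.trans_apply, hTa]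
      simp
      linarith)
  -- normalise the imaginary part
  have hGp : Function.Periodic (fun ζ => G N ζ - ζ) (2 * Real.pi * Complex.I) := by
    intro ζ; simp only [hq.hper]; ring
  set n : ℤ := ⌊ξ.im / (2 * Real.pi)⌋ with hn
  have hfl := Int.floor_le (ξ.im / (2 * Real.pi))
  have hfl2 := Int.lt_floor_add_one (ξ.im / (2 * Real.pi))
  rw [← hn] at hfl hfl2
  rw [le_div_iff₀ Real.two_pi_pos] at hfl
  rw [div_lt_iff₀ Real.two_pi_pos] at hfl2
  set ξ' := ξ - n * (2 * Real.pi * Complex.I) with hξ'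
  have hfixed : G N ξ' - ξ' = 2 * Real.pi * k * Complex.I := by
    have e1 := hGp.sub_int_mul_eq n (x := ξ)
    rw [hξ', e1]
    rw [Homeomorph.trans_apply, hTa] at hξ
    linear_combination hξ
  have hre : ξ'.re = ξ.re := by simp [hξ']
  have him : ξ'.im = ξ.im - n * (2 * Real.pi) := by simp [hξ']
  refine ⟨fun j => G j ξ', ?_, ?_, ?_, ?_, ?_, ?_, ?_, ?_⟩
  · simp only [G0]; linear_combination hfixed
  · intro j; simp only [Gs]; exact hS1 j _
  · intro j; simp only [Gs]; exact hS2 j _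
  · intro j; simp only [Gs]; have := hS3 j (G j ξ'); linarith
  · simp only [G0]
    by_contra hcon
    push Not at hcon
    have : Real.exp ξ'.re ≤ δ := by
      rw [← Real.exp_log hδ]; exact Real.exp_le_exp.mpr hcon.le
    rw [hfix N _ this, sub_self] at hfixed
    have := congrArg Complex.im hfixed
    simp at this
    rcases this with h | h
    · linarith
  · simp only [G0]
    by_contra hcon
    push Not at hcon
    have h1 := hrot ξ' hcon.le N le_rfl
    have h2 : h * κ * N = κ := by rw [mul_right_comm, hhN, one_mul]
    rw [h2, ← Complex.sub_im, hfixed] at h1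
    simp at h1
    linarith
  · simp only [G0]; rw [him]; linarith
  · simp only [G0]; rw [him]; linarith


open Filter Topology in
theorem lipSubseq (g : ℕ → ℝ → ℂ) (K : NNReal) (hL : ∀ n, LipschitzWith K (g n)) (M : ℝ)
    (hb : ∀ n, ‖g n 0‖ ≤ M) :
    ∃ φ : ℕ → ℕ, StrictMono φ ∧ ∃ G : ℝ → ℂ, LipschitzWith K G ∧
      ∀ t, Tendsto (fun n => g (φ n) t) atTop (𝓝 (G t)) := by
  have hbt : ∀ n t, ‖g n t‖ ≤ M + K * |t| := by
    intro n t
    have h1 := (hL n).dist_le_mul t 0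
    rw [dist_eq_norm, Real.dist_eq, sub_zero] at h1
    have : g n t = (g n t - g n 0) + g n 0 := by ring
    rw [this]
    refine (norm_add_le _ _).trans ?_
    linarith [hb n]
  have hcomp : IsCompact (Set.pi Set.univ (fun q : ℚ => Metric.closedBall (0:ℂ) (M + K * |(q:ℝ)|))) :=
    isCompact_univ_pi fun q => isCompact_closedBall _ _
  obtain ⟨G0, -, φ, hφ, hG0⟩ := hcomp.tendsto_subseq (x := fun n => fun q : ℚ => g n q) (by
    intro n q _
    simpa using hbt n q)
  rw [tendsto_pi_nhds] at hG0
  have hcau : ∀ t : ℝ, CauchySeq (fun n => g (φ n) t) := by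
    intro t
    rw [Metric.cauchySeq_iff]
    intro ε hε
    obtain ⟨q, hq1, hq2⟩ := exists_rat_btwn (show t < t + ε / (3 * (K + 1)) by
      have : (0:ℝ) < 3 * (K + 1) := by positivity
      have := div_pos hε this
      linarith)
    have hc := (hG0 q).cauchySeq
    rw [Metric.cauchySeq_iff] at hc
    obtain ⟨N, hN⟩ := hc (ε / 3) (by linarith)
    refine ⟨N, fun m hm n hn => ?_⟩
    have h1 := hN m hm n hn
    simp only [Function.comp] at h1
    have hd : dist t (q:ℝ) ≤ ε / (3 * (K + 1)) := by
      rw [Real.dist_eq, abs_sub_comm, abs_of_pos (by linarith)]; linarith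
    have hKd : K * dist t (q:ℝ) < ε / 3 := by
      have h5 : (0:ℝ) < K + 1 := by positivity
      have h4 : (K:ℝ) * dist t (q:ℝ) ≤ K * (ε / (3 * (K + 1))) := by gcongr
      have : (K:ℝ) * (ε / (3 * (K + 1))) < ε / 3 := by
        rw [mul_div_assoc', div_lt_div_iff₀ (by positivity) (by norm_num)]
        nlinarith
      linarith
    have h2 := (hL (φ m)).dist_le_mul t q
    have h3 := (hL (φ n)).dist_le_mul t q
    have h6 := dist_triangle4 (g (φ m) t) (g (φ m) q) (g (φ n) q) (g (φ n) t)
    rw [dist_comm (g (φ n) q)] at h6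
    linarith
  choose G hG using fun t => cauchySeq_tendsto_of_complete (hcau t)
  refine ⟨φ, hφ, G, ?_, hG⟩
  apply LipschitzWith.of_dist_le_mul
  intro x y
  exact le_of_tendsto' ((hG x).dist (hG y)) (fun n => (hL (φ n)).dist_le_mul x y)

open Filter Topology in
theorem intLimit (c : ℕ → ℝ → ℝ → ℝ) (c0 : ℝ → ℝ → ℝ)
    (hm : ∀ n, Measurable (Function.uncurry (c n))) (x : ℕ → ℝ → ℝ) (x0 : ℝ → ℝ)
    (hx : ∀ n, Measurable (x n)) (B : ℝ) (hB : ∀ n s, s ∈ Set.Icc (0:ℝ) 1 → |c n s (x n s)| ≤ B)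
    (hlim : ∀ s ∈ Set.Icc (0:ℝ) 1, Tendsto (fun n => c n s (x n s)) atTop (𝓝 (c0 s (x0 s))))
    (t : ℝ) (ht : t ∈ Set.Icc (0:ℝ) 1) (τ : ℕ → ℝ) (hτ : ∀ n, τ n ∈ Set.Icc (0:ℝ) 1)
    (hτt : Tendsto τ atTop (𝓝 t)) :
    Tendsto (fun n => ∫ s in (0:ℝ)..(τ n), c n s (x n s)) atTop (𝓝 (∫ s in (0:ℝ)..t, c0 s (x0 s))) := by
  have hmeas : ∀ n, Measurable (fun s => c n s (x n s)) := fun n =>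
    (hm n).comp (measurable_id.prodMk (hx n))
  have hB0 : 0 ≤ B := (abs_nonneg _).trans (hB 0 0 (by simp))
  have hsub : ∀ a b : ℝ, a ∈ Set.Icc (0:ℝ) 1 → b ∈ Set.Icc (0:ℝ) 1 → Set.uIoc a b ⊆ Set.Icc 0 1 := by
    intro a b ha hb s hs
    rw [Set.uIoc, Set.mem_Ioc] at hs
    exact ⟨(le_min ha.1 hb.1).trans hs.1.le, hs.2.trans (max_le ha.2 hb.2)⟩
  have hIntg : ∀ n a b, a ∈ Set.Icc (0:ℝ) 1 → b ∈ Set.Icc (0:ℝ) 1 →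
      IntervalIntegrable (fun s => c n s (x n s)) volume a b := by
    intro n a b ha hb
    refine (intervalIntegrable_const (c := B)).mono_fun (hmeas n).aestronglyMeasurable ?_
    refine (ae_restrict_iff' measurableSet_uIoc).mpr (Filter.Eventually.of_forall fun s hs => ?_)
    simp only [Real.norm_eq_abs, abs_of_nonneg hB0]
    exact hB n s (hsub a b ha hb hs)
  have h0 : (0:ℝ) ∈ Set.Icc (0:ℝ) 1 := by simp
  have e : ∀ n, ∫ s in (0:ℝ)..(τ n), c n s (x n s) =
      (∫ s in (0:ℝ)..t, c n s (x n s)) + ∫ s in t..(τ n), c n s (x n s) := fun n =>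
    (integral_add_adjacent_intervals (hIntg n _ _ h0 ht) (hIntg n _ _ ht (hτ n))).symm
  simp only [e]
  have l1 : Tendsto (fun n => ∫ s in (0:ℝ)..t, c n s (x n s)) atTop (𝓝 (∫ s in (0:ℝ)..t, c0 s (x0 s))) := by
    apply intervalIntegral.tendsto_integral_filter_of_dominated_convergence (fun _ => B)
    · exact Filter.Eventually.of_forall fun n => (hmeas n).aestronglyMeasurable
    · exact Filter.Eventually.of_forall fun n => Filter.Eventually.of_forall fun s hs =>
        hB n s (hsub _ _ h0 ht hs)
    · exact intervalIntegrable_const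
    · exact Filter.Eventually.of_forall fun s hs => hlim s (hsub _ _ h0 ht hs)
  have l2 : Tendsto (fun n => ∫ s in t..(τ n), c n s (x n s)) atTop (𝓝 0) := by
    apply squeeze_zero_norm (a := fun n => B * |τ n - t|)
    · intro n
      exact norm_integral_le_of_norm_le_const fun s hs => hB n s (hsub _ _ ht (hτ n) hs)
    · have : Tendsto (fun n => B * |τ n - t|) atTop (𝓝 (B * |t - t|)) :=
        ((hτt.sub_const t).abs).const_mul B
      simpa using this
  simpa using l1.add l2

theorem gridSum (c : ℝ → ℝ → ℝ) (hm : Measurable (Function.uncurry c)) (X : ℕ → ℝ) (N : ℕ)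
    (hN : 0 < N) (C : ℝ) (hc : ∀ s x, |c s x| ≤ C * |x|) (Y : ℕ → ℝ)
    (hY : ∀ j, Y (j + 1) = Y j + ∫ s in ((j:ℝ) / N)..(((j:ℝ) + 1) / N), c s (X j)) (m : ℕ) :
    Y m = Y 0 + ∫ s in (0:ℝ)..((m:ℝ) / N), c s (X ⌊s * N⌋₊) := by
  have hNr : (0:ℝ) < N := by exact_mod_cast hN
  have hcx : ∀ x a b, IntervalIntegrable (fun s => c s x) volume a b := by
    intro x a b
    refine (intervalIntegrable_const (c := C * |x|)).mono_fun
      (hm.comp (measurable_id.prodMk measurable_const)).aestronglyMeasurable ?_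
    refine Filter.Eventually.of_forall fun s => ?_
    simp only [Real.norm_eq_abs]
    exact (hc s x).trans (le_abs_self _)
  have hcell : ∀ j : ℕ, Set.EqOn (fun s => c s (X j)) (fun s => c s (X ⌊s * N⌋₊))
      (Set.Ioo ((j:ℝ) / N) (((j:ℝ) + 1) / N)) := by
    intro j s hs
    obtain ⟨h1, h2⟩ := hs
    rw [div_lt_iff₀ hNr] at h1
    rw [lt_div_iff₀ hNr] at h2
    have : ⌊s * N⌋₊ = j := by
      rw [Nat.floor_eq_iff (by linarith [(Nat.cast_nonneg j : (0:ℝ) ≤ j)])]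
      exact ⟨h1.le, h2⟩
    simp only [this]
  have hle : ∀ j : ℕ, ((j:ℝ) / N) ≤ (((j:ℝ) + 1) / N) := fun j => by gcongr; linarith
  have hae : ∀ j : ℕ, (fun s => c s (X j)) =ᵐ[volume.restrict (Set.uIoc ((j:ℝ) / N) (((j:ℝ) + 1) / N))]
      (fun s => c s (X ⌊s * N⌋₊)) := by
    intro j
    rw [Set.uIoc_of_le (hle j), ← Measure.restrict_congr_set Ioo_ae_eq_Ioc]
    exact (ae_restrict_iff' measurableSet_Ioo).mpr (Filter.Eventually.of_forall fun s hs => hcell j hs)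
  have hIntg : ∀ j : ℕ, IntervalIntegrable (fun s => c s (X ⌊s * N⌋₊)) volume ((j:ℝ) / N) (((j:ℝ) + 1) / N) :=
    fun j => (hcx (X j) _ _).congr_ae (hae j)
  have hall : ∀ m : ℕ, IntervalIntegrable (fun s => c s (X ⌊s * N⌋₊)) volume 0 ((m:ℝ) / N) := by
    intro m
    induction m with
    | zero => simp
    | succ m ih => push_cast; exact ih.trans (hIntg m)
  induction m with
  | zero => simp
  | succ m ih =>
    rw [hY, ih]
    push_cast
    rw [← integral_add_adjacent_intervals (hall m) (hIntg m)]
    have : ∫ s in ((m:ℝ) / N)..(((m:ℝ) + 1) / N), c s (X m) =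
        ∫ s in ((m:ℝ) / N)..(((m:ℝ) + 1) / N), c s (X ⌊s * N⌋₊) :=
      integral_congr_ae_restrict (hae m)
    rw [this]
    ring

theorem gridLip (ζ : ℕ → ℂ) (N : ℕ) (hN : 0 < N) (K : NNReal)
    (h : ∀ j, ‖ζ (j + 1) - ζ j‖ ≤ K * (1 / N)) :
    ∃ g : ℝ → ℂ, LipschitzWith (lipschitzExtensionConstant ℂ * K) g ∧ ∀ j : ℕ, g ((j:ℝ) / N) = ζ j := by
  have hNr : (0:ℝ) < N := by exact_mod_cast hN
  have hfl : ∀ j : ℕ, ⌊((j:ℝ) / N) * N⌋₊ = j := by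
    intro j; rw [div_mul_cancel₀ _ hNr.ne']; simp
  have hstep : ∀ i d : ℕ, dist (ζ (i + d)) (ζ i) ≤ K * (d / N) := by
    intro i d
    induction d with
    | zero => simp
    | succ d ih =>
      have h1 := h (i + d)
      rw [← dist_eq_norm] at h1
      have := dist_triangle (ζ (i + d + 1)) (ζ (i + d)) (ζ i)
      rw [← add_assoc]
      push_cast
      rw [add_div, mul_add]
      linarith
  have hsym : ∀ i j : ℕ, i ≤ j → dist (ζ i) (ζ j) ≤ K * dist ((i:ℝ) / N) ((j:ℝ) / N) := by
    intro i j hij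
    obtain ⟨d, rfl⟩ := Nat.exists_eq_add_of_le hij
    have h1 := hstep i d
    rw [dist_comm, dist_comm ((i:ℝ) / N), Real.dist_eq]
    push_cast
    rw [← sub_div, add_sub_cancel_left, abs_of_nonneg (by positivity)]
    exact h1
  have hLip : LipschitzOnWith K (fun t : ℝ => ζ ⌊t * N⌋₊) (Set.range fun j : ℕ => (j:ℝ) / N) := by
    apply LipschitzOnWith.of_dist_le_mul
    rintro _ ⟨i, rfl⟩ _ ⟨j, rfl⟩
    simp only [hfl]
    rcases le_total i j with hij | hij
    · exact hsym i j hij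
    · rw [dist_comm, dist_comm ((i:ℝ) / N)]; exact hsym j i hij
  obtain ⟨g, hg, hg2⟩ := hLip.extend_finite_dimension
  refine ⟨g, hg, fun j => ?_⟩
  have := hg2 (Set.mem_range_self j)
  simp only [hfl] at this
  exact this.symm


theorem tier1disc (a : ℝ → ℝ) (b : ℝ → ℝ → ℝ) (ha : Continuous a) (hb : ∀ t, Continuous (b t))
    (hbm : Measurable (Function.uncurry b)) (C Om δ : ℝ) (hδ : 0 < δ) (hC : 0 ≤ C) (hOm : 0 ≤ Om)
    (ha1 : ∀ w, |a w| ≤ C * |w|) (hb1 : ∀ t u, |b t u| ≤ C * |u|)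
    (ha2 : ∀ w, |a w - Om * w| ≤ C) (hb2 : ∀ t u, |b t u - Om * u| ≤ C)
    (hva : ∀ w, |w| ≤ δ → a w = 0) (hvb : ∀ t u, |u| ≤ δ → b t u = 0)
    (k : ℕ) (hk : 1 ≤ k) (N : ℕ) (hN : 0 < N) (hCh : C * (1 / N : ℝ) ≤ 1 / 2) (y1 : ℝ)
    (hy1 : 2 * Real.pi * k < Om - 2 * C * (1 / N) * Om - 2 * C * Real.exp (-(y1 - 4 * C) + 1)
      - 2 * C ^ 2 * (1 / N)) :
    ∃ g : ℝ → ℂ, LipschitzWith (lipschitzExtensionConstant ℂ * (4 * C).toNNReal) g ∧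
      g 1 = g 0 + 2 * Real.pi * k * Complex.I ∧
      ‖g 0‖ ≤ |y1| + |Real.log δ| + 2 * Real.pi ∧
      (∀ m : ℕ, (Complex.exp (g ((m:ℝ) / N))).im = (Complex.exp (g 0)).im +
        ∫ s in (0:ℝ)..((m:ℝ) / N), a (Complex.exp (g ((⌊s * N⌋₊ : ℕ) / (N:ℝ)))).re) ∧
      (∀ m : ℕ, (Complex.exp (g ((m:ℝ) / N))).re = (Complex.exp (g 0)).re -
        ∫ s in (0:ℝ)..((m:ℝ) / N), b s (Complex.exp (g (((⌊s * N⌋₊ : ℕ) + 1) / (N:ℝ)))).im) := by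
  have hNr : (0 : ℝ) < N := by exact_mod_cast hN
  have hbx : ∀ x : ℝ, ∀ c d, IntervalIntegrable (fun s => b s x) volume c d := by
    intro x c d
    refine (intervalIntegrable_const (c := C * |x|)).mono_fun
      (hbm.comp (measurable_id.prodMk measurable_const)).aestronglyMeasurable ?_
    refine Filter.Eventually.of_forall fun s => ?_
    simp only [Real.norm_eq_abs]
    exact (hb1 s x).trans (le_abs_self _)
  have hdiff : ∀ j : ℕ, ((j:ℝ) + 1) / N - (j:ℝ) / N = 1 / N := fun j => by ring
  have hN1 : (0:ℝ) < 1 / N := by positivity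
  set g2 : ℕ → ℝ → ℝ := fun j x => ∫ s in ((j:ℝ) / N)..(((j:ℝ) + 1) / N), b s x with hg2
  obtain ⟨ζ, z1, z2, z3, z4, z5, z6, z7, z8⟩ := discretePB (fun _ x => (1 / N : ℝ) * a x) g2
    (fun _ => by fun_prop) (fun j => by
      rw [continuous_iff_continuousAt]
      intro x0
      refine continuousAt_of_dominated_interval (bound := fun _ => C * (|x0| + 1)) ?_ ?_ ?_ ?_
      · exact Filter.Eventually.of_forall fun x =>
          (hbm.comp (measurable_id.prodMk measurable_const)).aestronglyMeasurable
      · filter_upwards [Metric.ball_mem_nhds x0 one_pos] with x hx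
        refine Filter.Eventually.of_forall fun s _ => ?_
        rw [Real.norm_eq_abs]
        refine (hb1 s x).trans ?_
        rw [Metric.mem_ball, Real.dist_eq] at hx
        have : |x| ≤ |x0| + 1 := by
          have := abs_sub_abs_le_abs_sub x x0
          linarith
        gcongr
      · exact intervalIntegrable_const
      · exact Filter.Eventually.of_forall fun s _ => (hb s).continuousAt)
    C Om δ N hN hδ hC hCh hOm
    (fun j x => by
      rw [abs_mul, abs_of_pos hN1]
      have := mul_le_mul_of_nonneg_left (ha1 x) hN1.le
      linarith)
    (fun j x => by
      rw [mul_assoc, ← mul_sub, abs_mul, abs_of_pos hN1]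
      have := mul_le_mul_of_nonneg_left (ha2 x) hN1.le
      linarith)
    (fun j x => by
      have := norm_integral_le_of_norm_le_const (a := (j:ℝ) / N) (b := ((j:ℝ) + 1) / N)
        (f := fun s => b s x) (C := C * |x|) (fun s _ => hb1 s x)
      rw [hdiff, abs_of_pos hN1, Real.norm_eq_abs] at this
      refine this.trans (le_of_eq (by ring)))
    (fun j x => by
      have e : g2 j x - (1 / N : ℝ) * Om * x =
          ∫ s in ((j:ℝ) / N)..(((j:ℝ) + 1) / N), (b s x - Om * x) := by
        rw [integral_sub (hbx x _ _) intervalIntegrable_const, intervalIntegral.integral_const, hdiff, smul_eq_mul]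
        rw [hg2]; ring
      have := norm_integral_le_of_norm_le_const (a := (j:ℝ) / N) (b := ((j:ℝ) + 1) / N)
        (f := fun s => b s x - Om * x) (C := C) (fun s _ => hb2 s x)
      rw [hdiff, abs_of_pos hN1, Real.norm_eq_abs] at this
      rw [e]; exact this)
    (fun j x hx => by rw [hva x hx, mul_zero])
    (fun j x hx => by
      simp only [hg2, hvb _ x hx]; simp)
    k hk y1 hy1
  obtain ⟨g, hg, hgz⟩ := gridLip ζ N hN (4 * C).toNNReal (fun j => by
    rw [Real.coe_toNNReal _ (by positivity)]; exact z4 j)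
  have hg0 : g 0 = ζ 0 := by simpa using hgz 0
  have hg1 : g 1 = ζ N := by
    have := hgz N
    rwa [div_self hNr.ne'] at this
  have hgz1 : ∀ j : ℕ, g (((j:ℝ) + 1) / N) = ζ (j + 1) := by
    intro j; have := hgz (j + 1); push_cast at this; exact this
  refine ⟨g, hg, by rw [hg1, hg0, z1], ?_, ?_, ?_⟩
  · rw [hg0]
    refine (Complex.norm_le_abs_re_add_abs_im _).trans ?_
    have e1 : |(ζ 0).re| ≤ |y1| + |Real.log δ| := by
      rw [abs_le]
      constructor
      · linarith [neg_abs_le (Real.log δ), abs_nonneg y1]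
      · linarith [le_abs_self y1, abs_nonneg (Real.log δ)]
    rw [abs_of_nonneg z7]
    linarith
  · intro m
    simp only [hgz, hg0]
    refine gridSum (fun _ x => a x) (ha.measurable.comp measurable_snd)
      (fun j => (Complex.exp (ζ j)).re) N hN C (fun _ x => ha1 x)
      (fun j => (Complex.exp (ζ j)).im) (fun j => ?_) m
    rw [intervalIntegral.integral_const, hdiff, smul_eq_mul]
    exact z2 j
  · intro m
    simp only [hgz, hgz1, hg0]
    have := gridSum (fun s x => - b s x) hbm.neg
      (fun j => (Complex.exp (ζ (j + 1))).im) N hN C (fun s x => by rw [abs_neg]; exact hb1 s x)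
      (fun j => (Complex.exp (ζ j)).re) (fun j => ?_) m
    · rw [this, intervalIntegral.integral_neg]; ring
    · rw [intervalIntegral.integral_neg, ← sub_eq_add_neg]
      exact z3 j

open Filter Topology in
theorem tier1 (a : ℝ → ℝ) (b : ℝ → ℝ → ℝ) (ha : Continuous a) (hb : ∀ t, Continuous (b t))
    (hbm : Measurable (Function.uncurry b)) (C Om δ : ℝ) (hδ : 0 < δ) (hC : 0 ≤ C) 
    (ha1 : ∀ w, |a w| ≤ C * |w|) (hb1 : ∀ t u, |b t u| ≤ C * |u|)
    (ha2 : ∀ w, |a w - Om * w| ≤ C) (hb2 : ∀ t u, |b t u - Om * u| ≤ C)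
    (hva : ∀ w, |w| ≤ δ → a w = 0) (hvb : ∀ t u, |u| ≤ δ → b t u = 0)
    (k : ℕ) (hk : 1 ≤ k) (hkO : 2 * Real.pi * k < Om) :
    ∃ ζ : ℝ → ℂ, Continuous ζ ∧ ζ 1 = ζ 0 + 2 * Real.pi * k * Complex.I ∧
      (∀ t ∈ Set.Icc (0:ℝ) 1, (Complex.exp (ζ t)).im = (Complex.exp (ζ 0)).im +
        ∫ s in (0:ℝ)..t, a (Complex.exp (ζ s)).re) ∧
      (∀ t ∈ Set.Icc (0:ℝ) 1, (Complex.exp (ζ t)).re = (Complex.exp (ζ 0)).re -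
        ∫ s in (0:ℝ)..t, b s (Complex.exp (ζ s)).im) := by
  have hOm : 0 ≤ Om := by
    have : 0 ≤ 2 * Real.pi * k := by have := Real.pi_pos; positivity
    linarith
  obtain ⟨y1, hy1⟩ : ∃ y1 : ℝ, 2 * Real.pi * k < Om - 2 * C * Real.exp (-(y1 - 4 * C) + 1) := by
    have h1 : Tendsto (fun y : ℝ => Om - 2 * C * Real.exp (-(y - 4 * C) + 1)) atTop (𝓝 (Om - 2 * C * 0)) := by
      refine tendsto_const_nhds.sub (tendsto_const_nhds.mul (Real.tendsto_exp_atBot.comp ?_))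
      have : Tendsto (fun y : ℝ => y - (4 * C + 1)) atTop atTop :=
        tendsto_atTop_add_const_right _ _ tendsto_id
      refine (tendsto_neg_atTop_atBot.comp this).congr fun y => ?_
      simp only [Function.comp]; ring
    rw [mul_zero, sub_zero] at h1
    exact (h1.eventually (lt_mem_nhds hkO)).exists
  have hinv : Tendsto (fun n : ℕ => (1 / (n:ℝ))) atTop (𝓝 0) := tendsto_one_div_atTop_nhds_zero_nat
  have hev : ∀ᶠ N : ℕ in atTop, 0 < N ∧ C * (1 / N : ℝ) ≤ 1 / 2 ∧
      2 * Real.pi * k < Om - 2 * C * (1 / N) * Om - 2 * C * Real.exp (-(y1 - 4 * C) + 1)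
      - 2 * C ^ 2 * (1 / N) := by
    have l1 : Tendsto (fun n : ℕ => C * (1 / (n:ℝ))) atTop (𝓝 (C * 0)) := hinv.const_mul C
    have l2 : Tendsto (fun N : ℕ => Om - 2 * C * (1 / (N:ℝ)) * Om - 2 * C * Real.exp (-(y1 - 4 * C) + 1)
      - 2 * C ^ 2 * (1 / (N:ℝ))) atTop (𝓝 (Om - 2 * C * 0 * Om - 2 * C * Real.exp (-(y1 - 4 * C) + 1)
      - 2 * C ^ 2 * 0)) :=
      ((tendsto_const_nhds.sub ((hinv.const_mul (2 * C)).mul_const Om)).sub tendsto_const_nhds).sub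
        (hinv.const_mul (2 * C ^ 2))
    have h1 := l1.eventually (gt_mem_nhds (show C * 0 < 1 / 2 by norm_num))
    have h2 := l2.eventually (lt_mem_nhds (show 2 * Real.pi * k < _ by
      simpa using hy1))
    filter_upwards [h1, h2, eventually_gt_atTop 0] with N a b c
    exact ⟨c, a.le, b⟩
  obtain ⟨N0, hN0⟩ := eventually_atTop.mp hev
  have key := fun n : ℕ => tier1disc a b ha hb hbm C Om δ hδ hC hOm ha1 hb1 ha2 hb2 hva hvb k hk
    (n + N0) (hN0 (n + N0) (by omega)).1 (hN0 (n + N0) (by omega)).2.1 y1 (hN0 (n + N0) (by omega)).2.2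
  choose g hgL hg1 hg0 hgim hgre using key
  obtain ⟨φ, hφ, G, hGL, hG⟩ := lipSubseq g _ hgL _ hg0
  set K := lipschitzExtensionConstant ℂ * (4 * C).toNNReal with hK
  -- moving points
  have hmove : ∀ (t : ℝ) (τ : ℕ → ℝ), Tendsto τ atTop (𝓝 t) →
      Tendsto (fun n => g (φ n) (τ n)) atTop (𝓝 (G t)) := by
    intro t τ hτ
    have h1 : Tendsto (fun n => g (φ n) (τ n) - g (φ n) t) atTop (𝓝 0) := by
      apply squeeze_zero_norm (a := fun n => K * |τ n - t|)
      · intro n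
        have := (hgL (φ n)).dist_le_mul (τ n) t
        rwa [dist_eq_norm, Real.dist_eq] at this
      · have : Tendsto (fun n => (K:ℝ) * |τ n - t|) atTop (𝓝 (K * |t - t|)) :=
          ((hτ.sub_const t).abs).const_mul _
        simpa using this
    simpa using h1.add (hG t)
  set N : ℕ → ℕ := fun n => φ n + N0 with hNdef
  have hNpos : ∀ n, (0:ℝ) < N n := fun n => by
    exact_mod_cast (hN0 (N n) (by simp [hNdef])).1
  have hNtop : Tendsto (fun n => (N n : ℝ)) atTop atTop :=
    tendsto_natCast_atTop_atTop.comp (tendsto_atTop_mono (fun n => Nat.le_add_right (φ n) N0) hφ.tendsto_atTop)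
  have hfl : ∀ s : ℝ, 0 ≤ s → Tendsto (fun n => ((⌊s * N n⌋₊ : ℕ) : ℝ) / (N n : ℝ)) atTop (𝓝 s) := by
    intro s hs
    exact (tendsto_nat_floor_mul_div_atTop hs).comp hNtop
  have hfl1 : ∀ s : ℝ, 0 ≤ s → Tendsto (fun n => (((⌊s * N n⌋₊ : ℕ) : ℝ) + 1) / (N n : ℝ)) atTop (𝓝 s) := by
    intro s hs
    have := (hfl s hs).add ((tendsto_inv_atTop_zero (𝕜 := ℝ)).comp hNtop)
    rw [add_zero] at this
    refine this.congr fun n => ?_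
    simp only [Function.comp]; rw [add_div, one_div]
  have hfl01 : ∀ n, ∀ s ∈ Set.Icc (0:ℝ) 1, ((⌊s * N n⌋₊ : ℕ) : ℝ) / (N n : ℝ) ∈ Set.Icc (0:ℝ) 1 := by
    intro n s hs
    have h3 := hNpos n
    refine ⟨by positivity, ?_⟩
    rw [div_le_one h3]
    refine (Nat.floor_le (by have := hs.1; positivity)).trans ?_
    nlinarith [hs.2]
  set M := |y1| + |Real.log δ| + 2 * Real.pi with hM
  have hbd : ∀ n, ∀ s ∈ Set.Icc (0:ℝ) 2, ‖Complex.exp (g n s)‖ ≤ Real.exp (M + K * 2) := by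
    intro n s hs
    rw [Complex.norm_exp]
    apply Real.exp_le_exp.mpr
    refine (Complex.re_le_norm _).trans ?_
    have h1 := (hgL n).dist_le_mul s 0
    rw [dist_eq_norm, Real.dist_eq, sub_zero, abs_of_nonneg hs.1] at h1
    have h2 : (K:ℝ) * s ≤ K * 2 := by have := hs.2; gcongr
    have : g n s = (g n s - g n 0) + g n 0 := by ring
    rw [this]
    refine (norm_add_le _ _).trans ?_
    linarith [hg0 n]
  have hexpc : Continuous Complex.exp := Complex.continuous_exp
  have hexp : ∀ (t : ℝ) (τ : ℕ → ℝ), Tendsto τ atTop (𝓝 t) →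
      Tendsto (fun n => Complex.exp (g (φ n) (τ n))) atTop (𝓝 (Complex.exp (G t))) :=
    fun t τ hτ => (hexpc.tendsto _).comp (hmove t τ hτ)
  have hre : ∀ (t : ℝ) (τ : ℕ → ℝ), Tendsto τ atTop (𝓝 t) →
      Tendsto (fun n => (Complex.exp (g (φ n) (τ n))).re) atTop (𝓝 (Complex.exp (G t)).re) :=
    fun t τ hτ => (Complex.continuous_re.tendsto _).comp (hexp t τ hτ)
  have him : ∀ (t : ℝ) (τ : ℕ → ℝ), Tendsto τ atTop (𝓝 t) →
      Tendsto (fun n => (Complex.exp (g (φ n) (τ n))).im) atTop (𝓝 (Complex.exp (G t)).im) :=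
    fun t τ hτ => (Complex.continuous_im.tendsto _).comp (hexp t τ hτ)
  have hgm : ∀ n, Measurable (g n) := fun n => (hgL n).continuous.measurable
  have hflm : ∀ n, Measurable (fun s : ℝ => ((⌊s * N n⌋₊ : ℕ) : ℝ)) := fun n => by
    have : Measurable (fun s : ℝ => s * N n) := by fun_prop
    exact (measurable_from_top (f := fun j : ℕ => (j:ℝ))).comp (Nat.measurable_floor.comp this)
  refine ⟨G, hGL.continuous, ?_, ?_, ?_⟩
  · refine tendsto_nhds_unique (hG 1) ?_
    simp only [hg1]
    exact (hG 0).add_const _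
  · intro t ht
    have l1 := him t _ (hfl t ht.1)
    refine tendsto_nhds_unique l1 ?_
    have e : ∀ n, (Complex.exp (g (φ n) (((⌊t * N n⌋₊ : ℕ) : ℝ) / (N n : ℝ)))).im = _ :=
      fun n => hgim (φ n) ⌊t * N n⌋₊
    simp only [e]
    refine (him 0 (fun _ => 0) tendsto_const_nhds).add ?_
    exact intLimit (fun _ _ x => a x) (fun _ x => a x) (fun n => ha.measurable.comp measurable_snd)
      (fun n s => (Complex.exp (g (φ n) (((⌊s * N n⌋₊ : ℕ) : ℝ) / (N n : ℝ)))).re)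
      (fun s => (Complex.exp (G s)).re)
      (fun n => Complex.measurable_re.comp (hexpc.measurable.comp ((hgm _).comp ((hflm n).div_const _))))
      (C * Real.exp (M + K * 2))
      (fun n s hs => by
        refine (ha1 _).trans (mul_le_mul_of_nonneg_left ?_ hC)
        refine (Complex.abs_re_le_norm _).trans (hbd _ _ ?_)
        have := hfl01 n s hs
        exact ⟨this.1, by linarith [this.2]⟩)
      (fun s hs => (ha.tendsto _).comp (hre s _ (hfl s hs.1))) t ht
      (fun n => ((⌊t * N n⌋₊ : ℕ) : ℝ) / (N n : ℝ)) (fun n => hfl01 n t ht) (hfl t ht.1)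
  · intro t ht
    have l1 := hre t _ (hfl t ht.1)
    refine tendsto_nhds_unique l1 ?_
    have e : ∀ n, (Complex.exp (g (φ n) (((⌊t * N n⌋₊ : ℕ) : ℝ) / (N n : ℝ)))).re = _ :=
      fun n => hgre (φ n) ⌊t * N n⌋₊
    simp only [e]
    refine (hre 0 (fun _ => 0) tendsto_const_nhds).sub ?_
    exact intLimit (fun _ s x => b s x) b (fun n => hbm)
      (fun n s => (Complex.exp (g (φ n) ((((⌊s * N n⌋₊ : ℕ) : ℝ) + 1) / (N n : ℝ)))).im)
      (fun s => (Complex.exp (G s)).im)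
      (fun n => Complex.measurable_im.comp (hexpc.measurable.comp ((hgm _).comp (((hflm n).add_const 1).div_const _))))
      (C * Real.exp (M + K * 2))
      (fun n s hs => by
        refine (hb1 _ _).trans (mul_le_mul_of_nonneg_left ?_ hC)
        refine (Complex.abs_im_le_norm _).trans (hbd _ _ ?_)
        have h4 := hfl01 n s hs
        have h3 : (1:ℝ) / N n ≤ 1 := by
          rw [div_le_one (hNpos n)]
          exact_mod_cast (hN0 (N n) (by simp [hNdef])).1
        rw [add_div]
        have h5 := hNpos n
        exact ⟨by have := h4.1; positivity, by linarith [h4.2]⟩)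
      (fun s hs => ((hb s).tendsto _).comp (him s _ (hfl1 s hs.1))) t ht
      (fun n => ((⌊t * N n⌋₊ : ℕ) : ℝ) / (N n : ℝ)) (fun n => hfl01 n t ht) (hfl t ht.1)


noncomputable def sp (s x : ℝ) : ℝ := (max x 0) ^ s - (max (-x) 0) ^ s

theorem sp_nonneg_eq {s x : ℝ} (hs : 0 < s) (hx : 0 ≤ x) : sp s x = x ^ s := by
  rw [sp, max_eq_left hx, max_eq_right (by linarith), Real.zero_rpow hs.ne', sub_zero]

theorem sp_neg (s x : ℝ) : sp s (-x) = - sp s x := by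
  simp [sp]

theorem sp_nonneg {s x : ℝ} (hs : 0 < s) (hx : 0 ≤ x) : 0 ≤ sp s x := by
  rw [sp_nonneg_eq hs hx]; positivity

theorem sp_mono {s : ℝ} (hs : 0 < s) : Monotone (sp s) := by
  intro x y hxy
  unfold sp
  have h1 : (max x 0) ^ s ≤ (max y 0) ^ s :=
    Real.rpow_le_rpow (le_max_right _ _) (max_le_max_right _ hxy) hs.le
  have h2 : (max (-y) 0) ^ s ≤ (max (-x) 0) ^ s :=
    Real.rpow_le_rpow (le_max_right _ _) (max_le_max_right _ (by linarith)) hs.le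
  linarith

theorem sp_cont {s : ℝ} (hs : 0 < s) : Continuous (sp s) := by
  unfold sp
  have h1 : Continuous fun x : ℝ => (max x 0) ^ s :=
    (by fun_prop : Continuous fun x : ℝ => max x 0).rpow_const fun x => Or.inr hs.le
  have h2 : Continuous fun x : ℝ => (max (-x) 0) ^ s :=
    (by fun_prop : Continuous fun x : ℝ => max (-x) 0).rpow_const fun x => Or.inr hs.le
  exact h1.sub h2

theorem sp_abs {s : ℝ} (hs : 0 < s) (x : ℝ) : |sp s x| = |x| ^ s := by
  rcases le_total 0 x with h | h
  · rw [abs_of_nonneg h, abs_of_nonneg (sp_nonneg hs h), sp_nonneg_eq hs h]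
  · have h' : 0 ≤ -x := by linarith
    rw [← abs_neg x, abs_of_nonneg h', ← abs_neg, ← sp_neg, abs_of_nonneg (sp_nonneg hs h'),
      sp_nonneg_eq hs h']

theorem sp_inv {s : ℝ} (hs : 0 < s) (x : ℝ) : sp s (sp (1 / s) x) = x := by
  have hs' : 0 < 1 / s := by positivity
  have key : ∀ x : ℝ, 0 ≤ x → sp s (sp (1 / s) x) = x := by
    intro x h
    rw [sp_nonneg_eq hs (sp_nonneg hs' h), sp_nonneg_eq hs' h, ← Real.rpow_mul h]
    rw [one_div_mul_cancel hs.ne', Real.rpow_one]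
  rcases le_total 0 x with h | h
  · exact key x h
  · have := key (-x) (by linarith)
    rw [sp_neg, sp_neg] at this
    linarith

theorem sp_eq {p : ℝ} (hp : 1 < p) (x : ℝ) : |x| ^ (p - 2) * x = sp (p - 1) x := by
  have hs : 0 < p - 1 := by linarith
  have key : ∀ x : ℝ, 0 ≤ x → |x| ^ (p - 2) * x = sp (p - 1) x := by
    intro x h
    rw [sp_nonneg_eq hs h, abs_of_nonneg h]
    rcases h.eq_or_lt with h0 | h0
    · rw [← h0, Real.zero_rpow hs.ne', mul_zero]
    · rw [← Real.rpow_add_one h0.ne']; congr 1; ring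
  rcases le_total 0 x with h | h
  · exact key x h
  · have := key (-x) (by linarith)
    rw [sp_neg, abs_neg] at this
    linarith

structure Sys (a g u w : ℝ → ℝ) : Prop where
  cu : Continuous u
  cw : Continuous w
  u1 : ∀ r t m : ℝ, 0 ≤ r → r ≤ t → t ≤ 1 → (∀ s ∈ Set.Icc r t, m ≤ a (w s)) → m * (t - r) ≤ u t - u r
  u2 : ∀ r t m : ℝ, 0 ≤ r → r ≤ t → t ≤ 1 → (∀ s ∈ Set.Icc r t, a (w s) ≤ m) → u t - u r ≤ m * (t - r)
  w1 : ∀ r t m : ℝ, 0 ≤ r → r ≤ t → t ≤ 1 → (∀ s ∈ Set.Icc r t, m ≤ g s) → w t - w r ≤ - (m * (t - r))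
  w2 : ∀ r t m : ℝ, 0 ≤ r → r ≤ t → t ≤ 1 → (∀ s ∈ Set.Icc r t, g s ≤ m) → - (m * (t - r)) ≤ w t - w r

theorem intMean (h : ℝ → ℝ) (hi : ∀ r t, 0 ≤ r → r ≤ t → t ≤ 1 → IntervalIntegrable h volume r t)
    (y : ℝ → ℝ) (hy : ∀ t ∈ Set.Icc (0:ℝ) 1, y t = y 0 + ∫ s in (0:ℝ)..t, h s) :
    (∀ r t m : ℝ, 0 ≤ r → r ≤ t → t ≤ 1 → (∀ s ∈ Set.Icc r t, m ≤ h s) → m * (t - r) ≤ y t - y r) ∧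
    (∀ r t m : ℝ, 0 ≤ r → r ≤ t → t ≤ 1 → (∀ s ∈ Set.Icc r t, h s ≤ m) → y t - y r ≤ m * (t - r)) := by
  have e : ∀ r t, 0 ≤ r → r ≤ t → t ≤ 1 → y t - y r = ∫ s in r..t, h s := by
    intro r t h0 h1 h2
    rw [hy t ⟨by linarith, h2⟩, hy r ⟨h0, by linarith⟩,
      ← integral_add_adjacent_intervals (hi 0 r le_rfl h0 (by linarith)) (hi r t h0 h1 h2)]
    ring
  constructor
  · intro r t m h0 h1 h2 hm
    rw [e r t h0 h1 h2]
    have := intervalIntegral.integral_mono_on h1 (intervalIntegrable_const (c := m)) (hi r t h0 h1 h2) hm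
    rw [intervalIntegral.integral_const, smul_eq_mul] at this
    linarith
  · intro r t m h0 h1 h2 hm
    rw [e r t h0 h1 h2]
    have := intervalIntegral.integral_mono_on h1 (hi r t h0 h1 h2) (intervalIntegrable_const (c := m)) hm
    rw [intervalIntegral.integral_const, smul_eq_mul] at this
    linarith

theorem Sys.ofInt (a g u w : ℝ → ℝ) (cu : Continuous u) (cw : Continuous w)
    (ia : ∀ r t, 0 ≤ r → r ≤ t → t ≤ 1 → IntervalIntegrable (fun s => a (w s)) volume r t)
    (ig : ∀ r t, 0 ≤ r → r ≤ t → t ≤ 1 → IntervalIntegrable g volume r t)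
    (hu : ∀ t ∈ Set.Icc (0:ℝ) 1, u t = u 0 + ∫ s in (0:ℝ)..t, a (w s))
    (hw : ∀ t ∈ Set.Icc (0:ℝ) 1, w t = w 0 - ∫ s in (0:ℝ)..t, g s) : Sys a g u w := by
  obtain ⟨a1, a2⟩ := intMean _ ia u hu
  obtain ⟨b1, b2⟩ := intMean (fun s => - g s) (fun r t h0 h1 h2 => (ig r t h0 h1 h2).neg) w (by
    intro t ht
    rw [intervalIntegral.integral_neg, hw t ht]; ring)
  refine ⟨cu, cw, a1, a2, ?_, ?_⟩
  · intro r t m h0 h1 h2 hm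
    have := b2 r t (-m) h0 h1 h2 (fun s hs => by linarith [hm s hs])
    linarith
  · intro r t m h0 h1 h2 hm
    have := b1 r t (-m) h0 h1 h2 (fun s hs => by linarith [hm s hs])
    linarith

theorem Sys.flip {a g u w : ℝ → ℝ} (S : Sys a g u w) (ho : ∀ x, a (-x) = - a x) :
    Sys a (fun s => - g s) (fun s => - u s) (fun s => - w s) := by
  refine ⟨S.cu.neg, S.cw.neg, ?_, ?_, ?_, ?_⟩
  · intro r t m h0 h1 h2 hm
    have := S.u2 r t (-m) h0 h1 h2 (fun s hs => by
      have := hm s hs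
      rw [ho] at this
      linarith)
    linarith
  · intro r t m h0 h1 h2 hm
    have := S.u1 r t (-m) h0 h1 h2 (fun s hs => by
      have := hm s hs
      rw [ho] at this
      linarith)
    linarith
  · intro r t m h0 h1 h2 hm
    have := S.w2 r t (-m) h0 h1 h2 (fun s hs => by linarith [hm s hs])
    linarith
  · intro r t m h0 h1 h2 hm
    have := S.w1 r t (-m) h0 h1 h2 (fun s hs => by linarith [hm s hs])
    linarith

theorem Sys.sflip {a g u w : ℝ → ℝ} (S : Sys a g u w) (ho : ∀ x, a (-x) = - a x) (σ : ℝ)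
    (hσ : σ = 1 ∨ σ = -1) :
    Sys a (fun s => σ * g s) (fun s => σ * u s) (fun s => σ * w s) := by
  rcases hσ with rfl | rfl
  · simpa using S
  · simpa using S.flip ho

theorem hump {a g u w : ℝ → ℝ} (S : Sys a g u w) (hmono : Monotone a) (ho : ∀ x, a (-x) = - a x)
    (c L R : ℝ) (hc : 0 ≤ c) (hL : 0 < L) (hcL : c + L ≤ 1) (hR : 0 ≤ R)
    (hu : ∀ s ∈ Set.Icc c (c + L), R ≤ u s) (β : ℝ → ℝ) (hβ : ∀ x, R ≤ x → 0 ≤ β x)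
    (hg : ∀ s ∈ Set.Icc c (c + L), ∀ x, R ≤ x → x ≤ u s → β x ≤ g s)
    (hG : ∀ x, R ≤ x → 2 * x < L / 3 * a (β x * L / 6)) : False := by
  have hg0 : ∀ s ∈ Set.Icc c (c + L), 0 ≤ g s := fun s hs =>
    (hβ R le_rfl).trans (hg s hs R le_rfl (hu s hs))
  have hdec : ∀ r t, c ≤ r → r ≤ t → t ≤ c + L → w t ≤ w r := by
    intro r t h1 h2 h3
    have := S.w1 r t 0 (by linarith) h2 (by linarith) (fun s hs => hg0 s ⟨by linarith [hs.1], by linarith [hs.2]⟩)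
    linarith
  set e := c + L / 3 with he
  set e' := c + 2 * L / 3 with he'
  have d : c + L = e' + L / 3 := by rw [he']; ring
  have d' : e' = e + L / 3 := by rw [he', he]; ring
  have i1 := S.u1 c e (a (w e)) hc (by linarith) (by linarith) (fun s hs =>
    hmono (hdec s e hs.1 hs.2 (by linarith)))
  have i2 := S.u2 e e' (a (w e)) (by linarith) (by linarith) (by linarith) (fun s hs =>
    hmono (hdec e s (by linarith) hs.1 (by linarith [hs.2])))
  have i3 := S.u1 e e' (a (w e')) (by linarith) (by linarith) (by linarith) (fun s hs =>
    hmono (hdec s e' (by linarith [hs.1]) hs.2 (by linarith)))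
  have i4 := S.u2 e' (c + L) (a (w e')) (by linarith) (by linarith) (by linarith) (fun s hs =>
    hmono (hdec e' s (by linarith) hs.1 (by linarith [hs.2])))
  have k1 : e - c = L / 3 := by rw [he]; ring
  have k2 : e' - e = L / 3 := by linarith
  have k3 : c + L - e' = L / 3 := by linarith
  rw [k1] at i1
  rw [k2] at i2 i3
  rw [k3] at i4
  have uc := hu c ⟨le_rfl, by linarith⟩
  have ud := hu (c + L) ⟨by linarith, le_rfl⟩
  have ue := hu e ⟨by linarith, by linarith⟩
  have ue' := hu e' ⟨by linarith, by linarith⟩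
  -- middle lower bound
  set x := min (u e) (u e') with hx
  have hxR : R ≤ x := le_min ue ue'
  have hmid : ∀ s ∈ Set.Icc e e', x ≤ u s := by
    intro s hs
    -- concavity: either w s ≥ 0 or ≤ 0
    rcases le_total 0 (a (w s)) with h | h
    · have := S.u1 e s 0 (by linarith) hs.1 (by linarith [hs.2]) (fun r hr =>
        h.trans (hmono (hdec r s (by linarith [hr.1]) hr.2 (by linarith [hs.2]))))
      have := min_le_left (u e) (u e')
      linarith
    · have := S.u2 s e' 0 (by linarith [hs.1]) hs.2 (by linarith) (fun r hr =>
        (hmono (hdec s r (by linarith [hs.1]) hr.1 (by linarith [hr.2]))).trans h)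
      have := min_le_right (u e) (u e')
      linarith
  have hdrop := S.w1 e e' (β x) (by linarith) (by linarith) (by linarith) (fun s hs =>
    hg s ⟨by linarith [hs.1], by linarith [hs.2]⟩ x hxR (hmid s hs))
  rw [k2] at hdrop
  have hGx := hG x hxR
  have b1 : u e ≤ 2 * x := by
    rw [hx]; rcases le_total (u e) (u e') with h | h
    · rw [min_eq_left h]; linarith
    · rw [min_eq_right h]; linarith
  have b2 : u e' ≤ 2 * x := by
    rw [hx]; rcases le_total (u e) (u e') with h | h
    · rw [min_eq_left h]; linarith
    · rw [min_eq_right h]; linarith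
  rcases le_total (β x * L / 6) (w e) with h | h
  · have := hmono h
    have : L / 3 * a (β x * L / 6) ≤ L / 3 * a (w e) := by gcongr
    linarith
  · have h' : w e' ≤ -(β x * L / 6) := by linarith
    have := hmono h'
    rw [ho] at this
    have : L / 3 * a (w e') ≤ L / 3 * -a (β x * L / 6) := by gcongr
    linarith

theorem slopeBound {a g u w : ℝ → ℝ} (S : Sys a g u w) (hmono : Monotone a) (ho : ∀ x, a (-x) = - a x)
    (c d s L R C0 A0 : ℝ) (hc : 0 ≤ c) (hd : d ≤ 1) (hL : 0 < L) (hcs : c + L ≤ s) (hsd : s + L ≤ d)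
    (hu : ∀ r ∈ Set.Icc c d, 0 ≤ u r) (hC0 : 0 ≤ C0) (hg : ∀ r ∈ Set.Icc c d, -C0 ≤ g r)
    (hus : u s ≤ R) (hA : R < L * a (A0 - C0)) (ha : 0 ≤ a (A0 - C0)) : |w s| ≤ A0 := by
  rw [abs_le]
  constructor
  · by_contra! h
    have := S.u2 s d (- a (A0 - C0)) (by linarith) (by linarith) hd (fun r hr => by
      rw [← ho]
      apply hmono
      have := S.w1 s r (-C0) (by linarith) hr.1 (by linarith [hr.2]) (fun q hq =>
        hg q ⟨by linarith [hq.1], by linarith [hq.2, hr.2]⟩)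
      have : C0 * (r - s) ≤ C0 * 1 := by
        apply mul_le_mul_of_nonneg_left _ hC0
        linarith [hr.2]
      linarith)
    have h2 := hu d ⟨by linarith, le_rfl⟩
    have : L * a (A0 - C0) ≤ (d - s) * a (A0 - C0) := by
      apply mul_le_mul_of_nonneg_right _ ha
      linarith
    linarith
  · by_contra! h
    have := S.u1 c s (a (A0 - C0)) hc (by linarith) (by linarith) (fun r hr => by
      apply hmono
      have := S.w1 r s (-C0) (by linarith [hr.1]) hr.2 (by linarith) (fun q hq =>
        hg q ⟨by linarith [hq.1, hr.1], by linarith [hq.2]⟩)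
      have : C0 * (s - r) ≤ C0 * 1 := by
        apply mul_le_mul_of_nonneg_left _ hC0
        linarith [hr.1]
      linarith)
    have h2 := hu c ⟨le_rfl, by linarith⟩
    have : L * a (A0 - C0) ≤ (s - c) * a (A0 - C0) := by
      apply mul_le_mul_of_nonneg_right _ ha
      linarith
    linarith

theorem chainStep {a g u w : ℝ → ℝ} (S : Sys a g u w) (hmono : Monotone a)
    (r d A C0 P Q : ℝ) (hr : 0 ≤ r) (hd : d ≤ 1) 
    (hu : ∀ s ∈ Set.Icc r d, 0 ≤ u s) (hC0 : 0 ≤ C0) (hg : ∀ s ∈ Set.Icc r d, -C0 ≤ g s)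
    (hP0 : 0 ≤ P) (hP : a (A + C0) ≤ P) (hQ0 : 0 ≤ Q)
    (hQ : ∀ s ∈ Set.Icc r d, u s ≤ A + P → g s ≤ Q)
    (hA1 : |u r| ≤ A) (hA2 : |w r| ≤ A) :
    ∀ s ∈ Set.Icc r d, |u s| ≤ A + P + C0 + Q ∧ |w s| ≤ A + P + C0 + Q := by
  have hA : 0 ≤ A := (abs_nonneg _).trans hA1
  have hmul : ∀ D s : ℝ, 0 ≤ D → s ∈ Set.Icc r d → D * (s - r) ≤ D := by
    intro D s hD hs
    have : D * (s - r) ≤ D * 1 := mul_le_mul_of_nonneg_left (by linarith [hs.2]) hD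
    linarith
  rw [abs_le] at hA1 hA2
  have hw : ∀ s ∈ Set.Icc r d, w s ≤ A + C0 := by
    intro s hs
    have := S.w1 r s (-C0) hr hs.1 (by linarith [hs.2]) (fun q hq => hg q ⟨hq.1, by linarith [hq.2, hs.2]⟩)
    have := hmul C0 s hC0 hs
    linarith
  have hus : ∀ s ∈ Set.Icc r d, u s ≤ A + P := by
    intro s hs
    have := S.u2 r s P hr hs.1 (by linarith [hs.2]) (fun q hq =>
      (hmono (hw q ⟨hq.1, by linarith [hq.2, hs.2]⟩)).trans hP)
    have := hmul P s hP0 hs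
    linarith
  intro s hs
  have h1 := hus s hs
  have h2 := hw s hs
  have h3 := S.w2 r s Q hr hs.1 (by linarith [hs.2]) (fun q hq =>
    hQ q ⟨hq.1, by linarith [hq.2, hs.2]⟩ (hus q ⟨hq.1, by linarith [hq.2, hs.2]⟩))
  have h4 := hmul Q s hQ0 hs
  have h5 := hu s hs
  rw [abs_le, abs_le]
  refine ⟨⟨by linarith, by linarith⟩, by linarith, by linarith⟩


theorem polarShift (ρ θ : ℝ) (m : ℤ) :
    ∃ σ : ℝ, (σ = 1 ∨ σ = -1) ∧ ∀ ρ θ : ℝ, σ * (ρ * Real.sin θ) = ρ * Real.sin (θ - m * Real.pi) ∧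
      σ * (ρ * Real.cos θ) = ρ * Real.cos (θ - m * Real.pi) := by
  have hs : Real.sin (m * Real.pi) = 0 := Real.sin_int_mul_pi m
  have h1 := Real.sin_sq_add_cos_sq (m * Real.pi)
  rw [hs] at h1
  refine ⟨Real.cos (m * Real.pi), ?_, ?_⟩
  · rcases mul_eq_zero.mp (show (Real.cos (m * Real.pi) - 1) * (Real.cos (m * Real.pi) + 1) = 0 by
      linarith) with h | h
    · left; linarith
    · right; linarith
  · intro ρ θ
    rw [Real.sin_sub, Real.cos_sub, hs]
    constructor <;> ring

theorem crossing {a g u w : ℝ → ℝ} (S : Sys a g u w) (hsg : ∀ x, 0 ≤ x → 0 ≤ a x)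
    (ho : ∀ x, a (-x) = - a x) (ρ θ : ℝ → ℝ) (hρ : ∀ t, 0 < ρ t) (hθ : Continuous θ)
    (hu : ∀ t, u t = ρ t * Real.sin (θ t)) (hw : ∀ t, w t = ρ t * Real.cos (θ t)) (m : ℤ) (r t : ℝ)
    (hr : 0 ≤ r) (hrt : r ≤ t) (ht : t ≤ 1) (h : m * Real.pi ≤ θ r) : m * Real.pi ≤ θ t := by
  by_contra! hlt
  obtain ⟨σ, hσ, hp⟩ := polarShift 0 0 m
  -- last time with θ ≥ mπ
  set T : Set ℝ := Set.Icc r t ∩ {s | m * Real.pi ≤ θ s} with hT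
  have hTc : IsCompact T := isCompact_Icc.inter_right (isClosed_le continuous_const hθ)
  have hTn : T.Nonempty := ⟨r, ⟨le_rfl, hrt⟩, h⟩
  obtain ⟨q, hqT, hq⟩ := hTc.exists_isGreatest hTn
  obtain ⟨⟨hq1, hq2⟩, hq3⟩ := hqT
  have hq3' : m * Real.pi ≤ θ q := hq3
  have hqt : q < t := by
    rcases hq2.eq_or_lt with e | e
    · rw [e] at hq3'; linarith
    · exact e
  have hafter : ∀ s, q < s → s ≤ t → θ s < m * Real.pi := by
    intro s h1 h2
    by_contra! h3
    have := hq (show s ∈ T from ⟨⟨by linarith, h2⟩, h3⟩)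
    linarith
  have hqe : θ q = m * Real.pi := by
    refine le_antisymm ?_ hq3'
    have h1 : Filter.Tendsto θ (nhdsWithin q (Set.Ioi q)) (nhds (θ q)) := hθ.continuousAt.continuousWithinAt
    refine le_of_tendsto h1 ?_
    filter_upwards [Ioc_mem_nhdsGT hqt] with s hs
    exact (hafter s hs.1 hs.2).le
  -- nearby θ > mπ - π/2
  have hnear : ∀ᶠ s in nhds q, m * Real.pi - Real.pi / 2 < θ s :=
    hθ.continuousAt.eventually (lt_mem_nhds (by rw [hqe]; linarith [Real.pi_pos]))
  obtain ⟨ε, hε, hball⟩ := Metric.eventually_nhds_iff.mp hnear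
  set t' := min t (q + ε / 2) with ht'
  have ht'q : q < t' := lt_min hqt (by linarith)
  have ht't : t' ≤ t := min_le_left _ _
  have hb : ∀ s ∈ Set.Icc q t', m * Real.pi - Real.pi / 2 < θ s := by
    intro s hs
    apply hball
    rw [Real.dist_eq, abs_of_nonneg (by linarith [hs.1])]
    have := min_le_right t (q + ε / 2)
    linarith [hs.2]
  have S' := S.sflip ho σ hσ
  have hup := S'.u1 q t' 0 (by linarith) ht'q.le (by linarith) (fun s hs => by
    apply hsg
    rw [hw, (hp _ _).2]
    refine mul_nonneg (hρ s).le (Real.cos_nonneg_of_neg_pi_div_two_le_of_le ?_ ?_)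
    · linarith [hb s hs]
    · rcases hs.1.eq_or_lt with e | e
      · rw [← e, hqe]; linarith [Real.pi_pos]
      · linarith [hafter s e (hs.2.trans ht't), Real.pi_pos])
  have e1 : σ * u q = 0 := by rw [hu, (hp _ _).1, hqe, sub_self, Real.sin_zero, mul_zero]
  have e2 : σ * u t' < 0 := by
    rw [hu, (hp _ _).1]
    refine mul_neg_of_pos_of_neg (hρ t') (Real.sin_neg_of_neg_of_neg_pi_lt ?_ ?_)
    · linarith [hafter t' ht'q ht't]
    · linarith [hb t' ⟨ht'q.le, le_rfl⟩, Real.pi_pos]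
  linarith

theorem levels (θ : ℝ → ℝ) (hθ : Continuous θ) (k : ℕ) (h1 : θ 1 = θ 0 + 2 * Real.pi * k)
    (hN : ∀ (m : ℤ) (r t : ℝ), 0 ≤ r → r ≤ t → t ≤ 1 → m * Real.pi ≤ θ r → m * Real.pi ≤ θ t) :
    ∃ (m0 : ℤ) (τ : ℕ → ℝ), τ 0 = 0 ∧ τ (2 * k + 1) = 1 ∧
      (∀ j ≤ 2 * k, τ j ≤ τ (j + 1)) ∧ (∀ j, 0 ≤ τ j ∧ τ j ≤ 1) ∧
      (∀ j ≤ 2 * k, ∀ t ∈ Set.Icc (τ j) (τ (j + 1)),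
        ((m0 + j : ℤ) : ℝ) * Real.pi ≤ θ t ∧ θ t ≤ ((m0 + j : ℤ) : ℝ) * Real.pi + Real.pi) ∧
      (∀ j, 1 ≤ j → j ≤ 2 * k → θ (τ j) = ((m0 + j : ℤ) : ℝ) * Real.pi) := by
  have hpi := Real.pi_pos
  set m0 : ℤ := ⌊θ 0 / Real.pi⌋ with hm0
  have f1 : (m0 : ℝ) * Real.pi ≤ θ 0 := by
    have := Int.floor_le (θ 0 / Real.pi)
    rwa [le_div_iff₀ hpi] at this
  have f2 : θ 0 < ((m0 : ℝ) + 1) * Real.pi := by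
    have := Int.lt_floor_add_one (θ 0 / Real.pi)
    rwa [div_lt_iff₀ hpi] at this
  set T : ℕ → Set ℝ := fun j => Set.Icc 0 1 ∩ {s | ((m0 + j : ℤ) : ℝ) * Real.pi ≤ θ s} with hT
  have hTc : ∀ j, IsCompact (T j) := fun j =>
    isCompact_Icc.inter_right (isClosed_le continuous_const hθ)
  have hTn : ∀ j, j ≤ 2 * k → (T j).Nonempty := by
    intro j hj
    refine ⟨1, ⟨by norm_num, le_rfl⟩, ?_⟩
    show ((m0 + j : ℤ) : ℝ) * Real.pi ≤ θ 1
    have : (j : ℝ) ≤ 2 * k := by exact_mod_cast hj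
    rw [h1]; push_cast
    nlinarith
  set τ : ℕ → ℝ := fun j => if j ≤ 2 * k then sInf (T j) else 1 with hτ
  have hle : ∀ j, j ≤ 2 * k → IsLeast (T j) (τ j) := by
    intro j hj
    simp only [hτ, hj, if_true]
    exact (hTc j).isLeast_sInf (hTn j hj)
  have hτ01 : ∀ j, 0 ≤ τ j ∧ τ j ≤ 1 := by
    intro j
    by_cases hj : j ≤ 2 * k
    · exact ((hle j hj).1).1
    · simp [hτ, hj]
  have heq : ∀ j, 1 ≤ j → j ≤ 2 * k → θ (τ j) = ((m0 + j : ℤ) : ℝ) * Real.pi := by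
    intro j hj1 hj
    have hge : ((m0 + j : ℤ) : ℝ) * Real.pi ≤ θ (τ j) := (hle j hj).1.2
    have h0 : θ 0 ≤ ((m0 + j : ℤ) : ℝ) * Real.pi := by
      have : (1:ℝ) ≤ j := by exact_mod_cast hj1
      push_cast
      nlinarith
    obtain ⟨s, hs, hse⟩ := intermediate_value_Icc (hτ01 j).1 hθ.continuousOn ⟨h0, hge⟩
    have h3 : τ j ≤ s := (hle j hj).2 ⟨⟨hs.1, hs.2.trans (hτ01 j).2⟩, hse.ge⟩
    have : s = τ j := le_antisymm hs.2 h3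
    rw [← this]; exact hse
  refine ⟨m0, τ, ?_, ?_, ?_, hτ01, ?_, heq⟩
  · refine le_antisymm ((hle 0 (by omega)).2 ⟨⟨le_rfl, by norm_num⟩, ?_⟩) (hτ01 0).1
    show ((m0 + (0:ℕ) : ℤ) : ℝ) * Real.pi ≤ θ 0
    simpa using f1
  · simp [hτ]
  · intro j hj
    by_cases hj1 : j + 1 ≤ 2 * k
    · refine (hle j hj).2 ⟨(hle _ hj1).1.1, ?_⟩
      have h3 : ((m0 + (j + 1 : ℕ) : ℤ) : ℝ) * Real.pi ≤ θ (τ (j + 1)) := (hle _ hj1).1.2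
      show ((m0 + j : ℤ) : ℝ) * Real.pi ≤ θ (τ (j + 1))
      push_cast at h3 ⊢
      nlinarith
    · have : τ (j + 1) = 1 := by simp only [hτ, hj1, if_false]
      rw [this]; exact (hτ01 j).2
  · intro j hj t ht
    have ht1 : t ≤ 1 := ht.2.trans (hτ01 _).2
    have ht0 : 0 ≤ t := (hτ01 j).1.trans ht.1
    refine ⟨hN _ (τ j) t (hτ01 j).1 ht.1 ht1 (hle j hj).1.2, ?_⟩
    by_cases hj1 : j + 1 ≤ 2 * k
    · rcases ht.2.eq_or_lt with e | e
      · rw [e, heq (j + 1) (by omega) hj1]; push_cast; linarith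
      · by_contra! h4
        have := (hle _ hj1).2 (show t ∈ T (j + 1) from ⟨⟨ht0, ht1⟩, by
          show ((m0 + (j + 1 : ℕ) : ℤ) : ℝ) * Real.pi ≤ θ t
          push_cast at h4 ⊢; linarith⟩)
        linarith
    · by_contra! h4
      have hj2 : j = 2 * k := by omega
      have := hN (m0 + j + 1) t 1 ht0 ht1 le_rfl (by push_cast at h4 ⊢; linarith)
      rw [h1, hj2] at this
      push_cast at this
      linarith

/-- pieces of constant sign -/
theorem pieces {a g u w : ℝ → ℝ} (S : Sys a g u w) (hsg : ∀ x, 0 ≤ x → 0 ≤ a x)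
    (ho : ∀ x, a (-x) = - a x) (ζ : ℝ → ℂ) (hζ : Continuous ζ) (k : ℕ)
    (hu : ∀ t, u t = (Complex.exp (ζ t)).im) (hw : ∀ t, w t = (Complex.exp (ζ t)).re)
    (hk : ζ 1 = ζ 0 + 2 * Real.pi * k * Complex.I) :
    ∃ (τ σ : ℕ → ℝ), τ 0 = 0 ∧ τ (2 * k + 1) = 1 ∧
      (∀ j ≤ 2 * k, τ j ≤ τ (j + 1)) ∧ (∀ j, 0 ≤ τ j ∧ τ j ≤ 1) ∧ (∀ j, σ j = 1 ∨ σ j = -1) ∧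
      (∀ j ≤ 2 * k, ∀ t ∈ Set.Icc (τ j) (τ (j + 1)), 0 ≤ σ j * u t) ∧
      (∀ j, 1 ≤ j → j + 1 ≤ 2 * k → u (τ j) = 0 ∧ ∃ s ∈ Set.Icc (τ j) (τ (j + 1)), w s = 0 ∧ u s ≠ 0) := by
  have hcθ : Continuous fun t => (ζ t).im := Complex.continuous_im.comp hζ
  have hu' : ∀ t, u t = Real.exp (ζ t).re * Real.sin (ζ t).im := fun t => by
    rw [hu, Complex.exp_im]
  have hw' : ∀ t, w t = Real.exp (ζ t).re * Real.cos (ζ t).im := fun t => by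
    rw [hw, Complex.exp_re]
  obtain ⟨m0, τ, t0, t1, t2, t3, t4, t5⟩ := levels (fun t => (ζ t).im) hcθ k (by
      have := congrArg Complex.im hk
      simpa using this)
    (crossing S hsg ho (fun t => Real.exp (ζ t).re) (fun t => (ζ t).im) (fun t => Real.exp_pos _) hcθ hu' hw')
  choose σ hσ hp using fun j : ℕ => polarShift 0 0 (m0 + j)
  refine ⟨τ, σ, t0, t1, t2, t3, hσ, ?_, ?_⟩
  · intro j hj t ht
    rw [hu', (hp j _ _).1]
    refine mul_nonneg (Real.exp_pos _).le (Real.sin_nonneg_of_nonneg_of_le_pi ?_ ?_)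
    · linarith [(t4 j hj t ht).1]
    · linarith [(t4 j hj t ht).2]
  · intro j hj1 hj2
    have e1 := t5 j hj1 (by omega)
    have e2 := t5 (j + 1) (by omega) hj2
    have hsu : ∀ t, (ζ t).im = ((m0 + j : ℤ) : ℝ) * Real.pi → u t = 0 := by
      intro t ht
      rw [hu', ht, Real.sin_int_mul_pi, mul_zero]
    refine ⟨hsu _ e1, ?_⟩
    have hpi := Real.pi_pos
    obtain ⟨s, hs, hse⟩ := intermediate_value_Icc (t2 j (by omega)) hcθ.continuousOn
      (show ((m0 + j : ℤ) : ℝ) * Real.pi + Real.pi / 2 ∈ _ from ⟨by simp only [e1]; linarith, by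
        simp only [e2]; push_cast; linarith⟩)
    refine ⟨s, hs, ?_, ?_⟩
    · have h3 := (hp j (Real.exp (ζ s).re) (ζ s).im).2
      simp only at hse
      rw [← hw', hse, add_sub_cancel_left, Real.cos_pi_div_two, mul_zero] at h3
      rcases hσ j with h | h <;> rw [h] at h3 <;> linarith
    · intro h0
      have h3 := (hp j (Real.exp (ζ s).re) (ζ s).im).1
      simp only at hse
      rw [← hu', hse, add_sub_cancel_left, Real.sin_pi_div_two, h0, mul_zero, mul_one] at h3
      exact (Real.exp_pos _).ne h3

theorem longPiece (τ : ℕ → ℝ) (n : ℕ) (h0 : τ 0 = 0) (hn : τ n = 1) (hnp : 0 < n) :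
    ∃ j < n, 1 / (n:ℝ) ≤ τ (j + 1) - τ j := by
  by_contra! h
  have key : ∀ j, j < n → τ (j + 1) < (j + 1) * (1 / (n:ℝ)) := by
    intro j
    induction j with
    | zero => intro hj; have := h 0 hj; simp [h0] at this ⊢; exact this
    | succ j ih =>
      intro hj
      have := h (j + 1) hj
      have := ih (by omega)
      push_cast
      linarith
  obtain ⟨m, rfl⟩ : ∃ m, n = m + 1 := ⟨n - 1, by omega⟩
  have := key m (by omega)
  rw [hn] at this
  push_cast at this
  rw [mul_one_div, div_self (by positivity)] at this
  linarith

/-- lower bound -/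
theorem lowerBound {a g u w : ℝ → ℝ} (S : Sys a g u w) (k : ℕ) (hk : 1 ≤ k) (τ : ℕ → ℝ)
    (hτ : ∀ j ≤ 2 * k, τ j ≤ τ (j + 1)) (hτ1 : ∀ j, 0 ≤ τ j ∧ τ j ≤ 1)
    (hz : ∀ j, 1 ≤ j → j + 1 ≤ 2 * k → u (τ j) = 0 ∧ ∃ s ∈ Set.Icc (τ j) (τ (j + 1)), w s = 0 ∧ u s ≠ 0)
    (s C1 l : ℝ) (hs : 0 < s) (hC1 : 0 < C1) (hl : 0 < l) (hl1 : l * (l * C1) ^ (1 / s) < 1)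
    (hkl : 1 < (2 * k - 1) * l)
    (ha : ∀ t ∈ Set.Icc (0:ℝ) 1, |a (w t)| ≤ |w t| ^ (1 / s))
    (hg : ∀ t ∈ Set.Icc (0:ℝ) 1, |g t| ≤ C1 * |u t| ^ s) : False := by
  have step : ∀ j, 1 ≤ j → j + 1 ≤ 2 * k → l < τ (j + 1) - τ j := by
    intro j hj1 hj2
    by_contra! hlen
    obtain ⟨hu0, q, hq, hwq, huq⟩ := hz j hj1 hj2
    have c0 := (hτ1 j).1
    have d1 := (hτ1 (j + 1)).2
    have hcd := hτ j (by omega)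
    set c := τ j
    set d := τ (j + 1)
    obtain ⟨x, hx, hmax⟩ := isCompact_Icc.exists_isMaxOn (Set.nonempty_Icc.mpr hcd)
      (S.cu.abs.continuousOn (s := Set.Icc c d))
    have hmax' : ∀ y ∈ Set.Icc c d, |u y| ≤ |u x| := fun y hy => hmax hy
    set μ := |u x| with hμ
    have hμ0 : 0 < μ := (abs_pos.mpr huq).trans_le (hmax' q hq)
    have hgb : ∀ y ∈ Set.Icc c d, |g y| ≤ C1 * μ ^ s := by
      intro y hy
      refine (hg y ⟨by linarith [hy.1], by linarith [hy.2]⟩).trans ?_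
      have := Real.rpow_le_rpow (abs_nonneg _) (hmax' y hy) hs.le
      gcongr
    set D := C1 * μ ^ s with hD
    have hD0 : 0 < D := by positivity
    have hwb : ∀ y ∈ Set.Icc c d, |w y| ≤ D * l := by
      intro y hy
      rw [abs_le]
      rcases le_total q y with h | h
      · have i1 := S.w1 q y (-D) (by linarith [hq.1]) h (by linarith [hy.2]) (fun r hr => by
          have := abs_le.mp (hgb r ⟨by linarith [hq.1, hr.1], by linarith [hy.2, hr.2]⟩); exact this.1)
        have i2 := S.w2 q y D (by linarith [hq.1]) h (by linarith [hy.2]) (fun r hr => by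
          have := abs_le.mp (hgb r ⟨by linarith [hq.1, hr.1], by linarith [hy.2, hr.2]⟩); exact this.2)
        have : D * (y - q) ≤ D * l := mul_le_mul_of_nonneg_left (by linarith [hy.2, hq.1]) hD0.le
        constructor <;> linarith
      · have i1 := S.w1 y q (-D) (by linarith [hy.1]) h (by linarith [hq.2]) (fun r hr => by
          have := abs_le.mp (hgb r ⟨by linarith [hy.1, hr.1], by linarith [hq.2, hr.2]⟩); exact this.1)
        have i2 := S.w2 y q D (by linarith [hy.1]) h (by linarith [hq.2]) (fun r hr => by
          have := abs_le.mp (hgb r ⟨by linarith [hy.1, hr.1], by linarith [hq.2, hr.2]⟩); exact this.2)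
        have : D * (q - y) ≤ D * l := mul_le_mul_of_nonneg_left (by linarith [hq.2, hy.1]) hD0.le
        constructor <;> linarith
    set P := (D * l) ^ (1 / s) with hP
    have hP0 : 0 < P := by positivity
    have hab : ∀ y ∈ Set.Icc c d, |a (w y)| ≤ P := by
      intro y hy
      refine (ha y ⟨by linarith [hy.1], by linarith [hy.2]⟩).trans ?_
      exact Real.rpow_le_rpow (abs_nonneg _) (hwb y hy) (by positivity)
    have j1 := S.u1 c x (-P) c0 hx.1 (by linarith [hx.2]) (fun r hr =>
      (abs_le.mp (hab r ⟨hr.1, by linarith [hr.2, hx.2]⟩)).1)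
    have j2 := S.u2 c x P c0 hx.1 (by linarith [hx.2]) (fun r hr =>
      (abs_le.mp (hab r ⟨hr.1, by linarith [hr.2, hx.2]⟩)).2)
    have hle : P * (x - c) ≤ P * l := mul_le_mul_of_nonneg_left (by linarith [hx.2]) hP0.le
    have hfin : μ ≤ P * l := by
      rw [hμ, abs_le]
      constructor <;> linarith
    have hPe : P = (l * C1) ^ (1 / s) * μ := by
      rw [hP, hD, show C1 * μ ^ s * l = (l * C1) * μ ^ s by ring,
        Real.mul_rpow (by positivity) (by positivity), ← Real.rpow_mul hμ0.le,
        mul_one_div_cancel hs.ne', Real.rpow_one]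
    rw [hPe] at hfin
    have : μ * (l * (l * C1) ^ (1 / s)) < μ * 1 := mul_lt_mul_of_pos_left hl1 hμ0
    linarith
  have key : ∀ j, j + 1 ≤ 2 * k → 1 ≤ j → τ 1 + j * l ≤ τ (j + 1) := by
    intro j
    induction j with
    | zero => intro _ h; omega
    | succ j ih =>
      intro h1 _
      have h2 := step (j + 1) (by omega) h1
      rcases Nat.eq_zero_or_pos j with h | h
      · subst h; push_cast; simp only [zero_add] at h2 ⊢; linarith
      · have := ih (by omega) h
        push_cast; linarith
  have h3 := key (2 * k - 1) (by omega) (by omega)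
  have h4 : ((2 * k - 1 : ℕ) : ℝ) = 2 * k - 1 := by
    rw [Nat.cast_sub (by omega)]; push_cast; ring
  rw [h4] at h3
  linarith [(hτ1 1).1, (hτ1 (2 * k - 1 + 1)).2]


theorem chainGlobal {a g u w : ℝ → ℝ} (S : Sys a g u w) (hmono : Monotone a)
    (ho : ∀ x, a (-x) = - a x) (K : ℕ) (τ σ : ℕ → ℝ) (h0 : τ 0 = 0) (h1 : τ K = 1)
    (hτ : ∀ j < K, τ j ≤ τ (j + 1)) (hτ1 : ∀ j, 0 ≤ τ j ∧ τ j ≤ 1) (hσ : ∀ j, σ j = 1 ∨ σ j = -1)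
    (hsu : ∀ j < K, ∀ t ∈ Set.Icc (τ j) (τ (j + 1)), 0 ≤ σ j * u t)
    (C0 : ℝ) (hC0 : 0 ≤ C0)
    (hg : ∀ s ∈ Set.Icc (0:ℝ) 1, ∀ e : ℝ, (e = 1 ∨ e = -1) → 0 ≤ e * u s → -C0 ≤ e * g s)
    (A P Q : ℕ → ℝ) (n : ℕ) (hP0 : ∀ i < n, 0 ≤ P i) (hP : ∀ i < n, a (A i + C0) ≤ P i)
    (hQ0 : ∀ i < n, 0 ≤ Q i)
    (hQ : ∀ i < n, ∀ s ∈ Set.Icc (0:ℝ) 1, |u s| ≤ A i + P i → |g s| ≤ Q i)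
    (hA : ∀ i, A (i + 1) = A i + P i + C0 + Q i) (i : ℕ) (hi : i + K ≤ n) (t0 : ℝ) (ht0 : 0 ≤ t0)
    (hb : |u t0| ≤ A i ∧ |w t0| ≤ A i) :
    ∀ t ∈ Set.Icc t0 1, |u t| ≤ A (i + K) ∧ |w t| ≤ A (i + K) := by
  have hAm : ∀ j, j ≤ K → A i ≤ A (i + j) := by
    intro j
    induction j with
    | zero => intro _; simp
    | succ j ih =>
      intro hj
      have := ih (by omega)
      rw [← add_assoc, hA]
      linarith [hP0 (i + j) (by omega), hQ0 (i + j) (by omega)]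
  have key : ∀ j, j ≤ K → ∀ t ∈ Set.Icc t0 (τ j), |u t| ≤ A (i + j) ∧ |w t| ≤ A (i + j) := by
    intro j
    induction j with
    | zero =>
      intro _ t ht
      rw [h0] at ht
      have : t = t0 := le_antisymm (by linarith [ht.2]) ht.1
      rw [this]; simpa using hb
    | succ j ih =>
      intro hj t ht
      have ihj := ih (by omega)
      have hin : i + j < n := by omega
      by_cases hle : t ≤ τ j
      · have := ihj t ⟨ht.1, hle⟩
        rw [← add_assoc, hA]
        constructor <;> linarith [hP0 (i + j) hin, hQ0 (i + j) hin]
      · push Not at hle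
        have hr : |u (max t0 (τ j))| ≤ A (i + j) ∧ |w (max t0 (τ j))| ≤ A (i + j) := by
          rcases le_total t0 (τ j) with h | h
          · rw [max_eq_right h]; exact ihj _ ⟨h, le_rfl⟩
          · rw [max_eq_left h]
            have := hAm j (by omega)
            exact ⟨by linarith [hb.1], by linarith [hb.2]⟩
        have habs : ∀ x : ℝ, |σ j * x| = |x| := by
          intro x
          rcases hσ j with h | h <;> rw [h] <;> simp
        have hin01 : ∀ s ∈ Set.Icc (max t0 (τ j)) (τ (j + 1)), s ∈ Set.Icc (0:ℝ) 1 := fun s hs =>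
          ⟨ht0.trans ((le_max_left _ _).trans hs.1), hs.2.trans (hτ1 _).2⟩
        have hinp : ∀ s ∈ Set.Icc (max t0 (τ j)) (τ (j + 1)), s ∈ Set.Icc (τ j) (τ (j + 1)) := fun s hs =>
          ⟨(le_max_right _ _).trans hs.1, hs.2⟩
        have := chainStep (S.sflip ho (σ j) (hσ j)) hmono (max t0 (τ j)) (τ (j + 1)) (A (i + j)) C0
          (P (i + j)) (Q (i + j)) (ht0.trans (le_max_left _ _)) (hτ1 _).2
          (fun s hs => hsu j (by omega) s (hinp s hs)) hC0
          (fun s hs => hg s (hin01 s hs) _ (hσ j) (hsu j (by omega) s (hinp s hs)))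
          (hP0 _ hin) (hP _ hin) (hQ0 _ hin)
          (fun s hs hus => by
            have h3 := hQ (i + j) hin s (hin01 s hs) (by
              rw [← habs, abs_of_nonneg (hsu j (by omega) s (hinp s hs))]; exact hus)
            rw [← habs] at h3
            exact (le_abs_self _).trans h3)
          (by rw [habs]; exact hr.1) (by rw [habs]; exact hr.2) t ⟨max_le ht.1 hle.le, ht.2⟩
        rw [habs, habs] at this
        rw [← add_assoc, hA]
        exact this
  intro t ht
  exact key K le_rfl t ⟨ht.1, by rw [h1]; exact ht.2⟩

theorem upperBound {a g u w : ℝ → ℝ} (S : Sys a g u w) (hmono : Monotone a)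
    (ho : ∀ x, a (-x) = - a x) (K : ℕ) (hK : 0 < K) (τ σ : ℕ → ℝ) (h0 : τ 0 = 0) (h1 : τ K = 1)
    (hτ : ∀ j < K, τ j ≤ τ (j + 1)) (hτ1 : ∀ j, 0 ≤ τ j ∧ τ j ≤ 1) (hσ : ∀ j, σ j = 1 ∨ σ j = -1)
    (hsu : ∀ j < K, ∀ t ∈ Set.Icc (τ j) (τ (j + 1)), 0 ≤ σ j * u t)
    (hu01 : u 1 = u 0) (hw01 : w 1 = w 0)
    (C0 : ℝ) (hC0 : 0 ≤ C0)
    (hg : ∀ s ∈ Set.Icc (0:ℝ) 1, ∀ e : ℝ, (e = 1 ∨ e = -1) → 0 ≤ e * u s → -C0 ≤ e * g s)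
    (A P Q : ℕ → ℝ) (hP0 : ∀ i < 2 * K, 0 ≤ P i) (hP : ∀ i < 2 * K, a (A i + C0) ≤ P i)
    (hQ0 : ∀ i < 2 * K, 0 ≤ Q i)
    (hQ : ∀ i < 2 * K, ∀ s ∈ Set.Icc (0:ℝ) 1, |u s| ≤ A i + P i → |g s| ≤ Q i)
    (hA : ∀ i, A (i + 1) = A i + P i + C0 + Q i)
    (L R : ℝ) (hL : 3 * L = 1 / K) (hR : 0 ≤ R) (hRA : R ≤ A 0)
    (β : ℝ → ℝ) (hβ : ∀ x, R ≤ x → 0 ≤ β x)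
    (hgβ : ∀ s ∈ Set.Icc (0:ℝ) 1, ∀ e : ℝ, (e = 1 ∨ e = -1) → ∀ x, R ≤ x → x ≤ e * u s → β x ≤ e * g s)
    (hG : ∀ x, R ≤ x → 2 * x < L / 3 * a (β x * L / 6))
    (hA0 : R < L * a (A 0 - C0)) :
    ∀ t ∈ Set.Icc (0:ℝ) 1, |u t| ≤ A (2 * K) ∧ |w t| ≤ A (2 * K) := by
  have hKr : (0:ℝ) < K := by exact_mod_cast hK
  have hLpos : 0 < L := by
    have : (0:ℝ) < 1 / K := by positivity
    linarith
  obtain ⟨j, hj, hlen⟩ := longPiece τ K h0 h1 hK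
  rw [← hL] at hlen
  have c0 := (hτ1 j).1
  have d1 := (hτ1 (j + 1)).2
  set c := τ j
  set d := τ (j + 1)
  have S' := S.sflip ho (σ j) (hσ j)
  have hex : ∃ s ∈ Set.Icc (c + L) (c + L + L), σ j * u s < R := by
    by_contra! h
    have h01 : ∀ s ∈ Set.Icc (c + L) (c + L + L), s ∈ Set.Icc (0:ℝ) 1 := fun s hs =>
      ⟨by linarith [hs.1], by linarith [hs.2]⟩
    exact hump S' hmono ho (c + L) L R (by linarith) hLpos (by linarith) hR h β hβ
      (fun s hs x hx hxu => hgβ s (h01 s hs) _ (hσ j) x hx hxu) hG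
  obtain ⟨s, hs, hus⟩ := hex
  have hap : 0 ≤ a (A 0 - C0) := by
    by_contra! h
    have := mul_neg_of_pos_of_neg hLpos h
    linarith
  have hsl := slopeBound S' hmono ho c d s L R C0 (A 0) c0 d1 hLpos hs.1 (by linarith [hs.2])
    (fun r hr => hsu j hj r hr) hC0
    (fun r hr => hg r ⟨by linarith [hr.1], by linarith [hr.2]⟩ _ (hσ j) (hsu j hj r hr)) hus.le hA0 hap
  have habs : ∀ x : ℝ, |σ j * x| = |x| := by
    intro x
    rcases hσ j with h | h <;> rw [h] <;> simp
  rw [habs] at hsl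
  have hus' : |u s| ≤ A 0 := by
    rw [← habs, abs_of_nonneg (hsu j hj s ⟨by linarith [hs.1], by linarith [hs.2]⟩)]
    linarith
  have CG := chainGlobal S hmono ho K τ σ h0 h1 hτ hτ1 hσ hsu C0 hC0 hg A P Q (2 * K) hP0 hP hQ0 hQ hA
  have st1 := CG 0 (by omega) s (by linarith [hs.1]) ⟨hus', hsl⟩ 1 ⟨by linarith [hs.2], le_rfl⟩
  rw [hu01, hw01, zero_add] at st1
  have := CG K (by omega) 0 le_rfl st1
  rwa [← two_mul] at this


noncomputable def clip (M x : ℝ) : ℝ := max (-M) (min x M)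

theorem clip_neg {M : ℝ} (hM : 0 ≤ M) (x : ℝ) : clip M (-x) = - clip M x := by
  unfold clip
  rcases le_total x M with h1 | h1 <;> rcases le_total (-M) x with h2 | h2
  · rw [min_eq_left (by linarith), min_eq_left h1, max_eq_right (by linarith), max_eq_right h2]
  · rw [min_eq_right (by linarith), min_eq_left h1, max_eq_right (by linarith), max_eq_left h2]; ring
  · rw [min_eq_left (by linarith), min_eq_right h1, max_eq_left (by linarith), max_eq_right (by linarith)]
  · have : x = M := by linarith
    have : M = 0 := by linarith
    subst this; subst x; simp

theorem clip_nonneg_eq {M x : ℝ} (hM : 0 ≤ M) (hx : 0 ≤ x) : clip M x = min x M := by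
  unfold clip
  rw [max_eq_right]
  have : 0 ≤ min x M := le_min hx hM
  linarith

theorem clip_self {M x : ℝ} (hx : |x| ≤ M) : clip M x = x := by
  rw [abs_le] at hx
  unfold clip
  rw [min_eq_left hx.2, max_eq_right hx.1]

theorem clip_abs {M : ℝ} (hM : 0 ≤ M) (x : ℝ) : |clip M x| ≤ M := by
  unfold clip
  rw [abs_le]
  exact ⟨le_max_left _ _, max_le (by linarith) (min_le_right _ _)⟩

theorem clip_cont (M : ℝ) : Continuous (clip M) := by unfold clip; fun_prop

theorem clip_mono (M : ℝ) : Monotone (clip M) := by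
  intro x y h
  unfold clip
  exact max_le_max_left _ (min_le_min_right _ h)

theorem soft_mono (M : ℝ) : Monotone (fun x => x - clip M x) := by
  intro x y h
  have h1 : clip M y ≤ clip M x + (y - x) := by
    unfold clip
    have h3 := le_max_left (-M) (min x M)
    have h4 := le_max_right (-M) (min x M)
    refine max_le (by linarith) ?_
    rcases le_total x M with h2 | h2
    · rw [min_eq_left h2] at h4 ⊢
      linarith [min_le_left y M]
    · rw [min_eq_right h2] at h4 ⊢
      linarith [min_le_right y M]
  simp only
  linarith

theorem clip_abs_le {M : ℝ} (hM : 0 ≤ M) (x : ℝ) : |clip M x| ≤ |x| := by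
  have key : ∀ x, 0 ≤ x → |clip M x| ≤ |x| := by
    intro x hx
    rw [clip_nonneg_eq hM hx, abs_of_nonneg (le_min hx hM), abs_of_nonneg hx]
    exact min_le_left _ _
  rcases le_total 0 x with h | h
  · exact key x h
  · have := key (-x) (by linarith)
    rwa [clip_neg hM, abs_neg, abs_neg] at this

theorem soft_abs {M : ℝ} (hM : 0 ≤ M) (x : ℝ) : |x - clip M x| ≤ |x| := by
  have key : ∀ x, 0 ≤ x → |x - clip M x| ≤ |x| := by
    intro x hx
    rw [clip_nonneg_eq hM hx, abs_of_nonneg (by linarith [min_le_left x M]), abs_of_nonneg hx]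
    linarith [le_min hx hM]
  rcases le_total 0 x with h | h
  · exact key x h
  · have := key (-x) (by linarith)
    rw [clip_neg hM, abs_neg, ← abs_neg] at this
    rwa [show -(-x - -clip M x) = x - clip M x by ring] at this

noncomputable def aFun (α S Om δ w : ℝ) : ℝ :=
  sp α (clip S (w - clip δ w)) + Om * ((w - clip δ w) - clip S (w - clip δ w))

theorem aFun_odd {α S Om δ : ℝ} (hS : 0 ≤ S) (hδ : 0 ≤ δ) (w : ℝ) :
    aFun α S Om δ (-w) = - aFun α S Om δ w := by
  unfold aFun
  rw [clip_neg hδ, show -w - -clip δ w = -(w - clip δ w) by ring, clip_neg hS, sp_neg]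
  ring

theorem aFun_mono {α S Om δ : ℝ} (hα : 0 < α) (hOm : 0 ≤ Om) : Monotone (aFun α S Om δ) := by
  intro x y h
  have h1 := soft_mono δ h
  simp only at h1
  unfold aFun
  have h2 := sp_mono hα (clip_mono S h1)
  have h3 := mul_le_mul_of_nonneg_left (soft_mono S h1) hOm
  simp only at h3
  linarith

theorem aFun_cont {α S Om δ : ℝ} (hα : 0 < α) : Continuous (aFun α S Om δ) := by
  unfold aFun
  have := sp_cont hα
  have := clip_cont S
  have := clip_cont δ
  fun_prop

theorem aFun_zero {α S Om δ w : ℝ} (hα : 0 < α) (hS : 0 ≤ S) (hw : |w| ≤ δ) : aFun α S Om δ w = 0 := by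
  unfold aFun
  rw [clip_self hw, sub_self, clip_nonneg_eq hS le_rfl, min_eq_left hS, sp_nonneg_eq hα le_rfl,
    Real.zero_rpow hα.ne']
  simp

theorem aFun_small {α S Om δ w : ℝ} (hδ : 0 ≤ δ) (hw : |w| ≤ S) :
    aFun α S Om δ w = sp α (w - clip δ w) := by
  unfold aFun
  rw [clip_self ((soft_abs hδ w).trans hw)]; ring

theorem aFun_le {α S Om δ w : ℝ} (hα : 0 < α) (hδ : 0 ≤ δ) (hw : |w| ≤ S) :
    |aFun α S Om δ w| ≤ |w| ^ α := by
  rw [aFun_small hδ hw, sp_abs hα]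
  exact Real.rpow_le_rpow (abs_nonneg _) (soft_abs hδ w) hα.le

theorem aFun_shift {α S Om δ y : ℝ} (hα : 0 < α) (hδ : 0 ≤ δ) (hS : 0 ≤ S) (hy : 0 ≤ y) :
    aFun α S Om δ (y + δ) = (min y S) ^ α + Om * (y - min y S) := by
  unfold aFun
  have : y + δ - clip δ (y + δ) = y := by
    rw [clip_nonneg_eq hδ (by linarith), min_eq_right (by linarith)]; ring
  rw [this, clip_nonneg_eq hS hy, sp_nonneg_eq hα (le_min hy hS)]

theorem aFun_asym {α S Om δ : ℝ} (hα : 0 < α) (hδ : 0 ≤ δ) (hS : 0 ≤ S) (hOm : 0 ≤ Om) (w : ℝ) :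
    |aFun α S Om δ w - Om * w| ≤ S ^ α + Om * S + Om * δ := by
  unfold aFun
  set y := w - clip δ w with hy
  have h1 : |sp α (clip S y)| ≤ S ^ α := by
    rw [sp_abs hα]
    exact Real.rpow_le_rpow (abs_nonneg _) (clip_abs hS y) hα.le
  have h2 := clip_abs hS y
  have h3 := clip_abs hδ w
  have e : sp α (clip S y) + Om * (y - clip S y) - Om * w = sp α (clip S y) - Om * clip S y - Om * clip δ w := by
    rw [hy]; ring
  rw [e]
  refine (abs_sub _ _).trans ?_
  refine (add_le_add_left (abs_sub _ _) _).trans ?_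
  rw [abs_mul, abs_mul, abs_of_nonneg hOm]
  have := mul_le_mul_of_nonneg_left h2 hOm
  have := mul_le_mul_of_nonneg_left h3 hOm
  linarith

/-- from asymptotic linearity and vanishing near zero to a linear bound -/
theorem linOfAsym (c Om δ D : ℝ) (hδ : 0 < δ) (hD : 0 ≤ D) (hOm : 0 ≤ Om) (x : ℝ) (h1 : |c - Om * x| ≤ D)
    (h2 : |x| ≤ δ → c = 0) : |c| ≤ (D / δ + Om) * |x| := by
  rcases le_total |x| δ with h | h
  · rw [h2 h, abs_zero]; positivity
  · have : |c| ≤ D + Om * |x| := by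
      have e : c = (c - Om * x) + Om * x := by ring
      rw [e]
      refine (abs_add_le _ _).trans ?_
      rw [abs_mul, abs_of_nonneg hOm]
      linarith
    have h3 : D ≤ D / δ * |x| := by
      rw [div_mul_eq_mul_div, le_div_iff₀ hδ]
      exact mul_le_mul_of_nonneg_left h hD
    linarith

noncomputable def ramp (δ u : ℝ) : ℝ := max 0 (min 1 (|u| / δ - 1))

theorem ramp_nonneg (δ u : ℝ) : 0 ≤ ramp δ u := le_max_left _ _
theorem ramp_le_one (δ u : ℝ) : ramp δ u ≤ 1 := max_le zero_le_one (min_le_left _ _)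
theorem ramp_zero {δ u : ℝ} (hδ : 0 < δ) (hu : |u| ≤ δ) : ramp δ u = 0 := by
  unfold ramp
  apply max_eq_left
  refine (min_le_right _ _).trans ?_
  have : |u| / δ ≤ 1 := (div_le_one hδ).mpr hu
  linarith
theorem ramp_one {δ u : ℝ} (hδ : 0 < δ) (hu : 2 * δ ≤ |u|) : ramp δ u = 1 := by
  unfold ramp
  have : 2 ≤ |u| / δ := (le_div_iff₀ hδ).mpr hu
  rw [min_eq_left (by linarith), max_eq_right zero_le_one]
theorem ramp_cont (δ : ℝ) : Continuous (ramp δ) := by unfold ramp; fun_prop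

noncomputable def bFun (b0 : ℝ → ℝ → ℝ) (M Om δ t u : ℝ) : ℝ :=
  b0 t (clip M u) * ramp δ u + Om * (u - clip M u)

theorem bFun_cont {b0 : ℝ → ℝ → ℝ} {M Om δ : ℝ} (h : ∀ t, Continuous (b0 t)) (t : ℝ) :
    Continuous (bFun b0 M Om δ t) := by
  unfold bFun
  have := h t
  have := ramp_cont δ
  have := clip_cont M
  fun_prop

theorem bFun_meas {b0 : ℝ → ℝ → ℝ} {M Om δ : ℝ} (h : Measurable (Function.uncurry b0)) :
    Measurable (Function.uncurry (bFun b0 M Om δ)) := by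
  have h1 : Measurable fun x : ℝ × ℝ => b0 x.1 (clip M x.2) :=
    h.comp (measurable_fst.prodMk ((clip_cont M).measurable.comp measurable_snd))
  have h2 : Measurable fun x : ℝ × ℝ => ramp δ x.2 := (ramp_cont δ).measurable.comp measurable_snd
  have h3 : Measurable fun x : ℝ × ℝ => Om * (x.2 - clip M x.2) :=
    (measurable_snd.sub ((clip_cont M).measurable.comp measurable_snd)).const_mul Om
  exact (h1.mul h2).add h3

theorem bFun_zero {b0 : ℝ → ℝ → ℝ} {M Om δ t u : ℝ} (hδ : 0 < δ) (hδM : δ ≤ M) (hu : |u| ≤ δ) :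
    bFun b0 M Om δ t u = 0 := by
  unfold bFun
  rw [ramp_zero hδ hu, clip_self (hu.trans hδM)]; simp

theorem bFun_small {b0 : ℝ → ℝ → ℝ} {M Om δ t u : ℝ} (hu : |u| ≤ M) :
    bFun b0 M Om δ t u = b0 t u * ramp δ u := by
  unfold bFun
  rw [clip_self hu]; simp

theorem bFun_asym {b0 : ℝ → ℝ → ℝ} {M Om δ B : ℝ} (hM : 0 ≤ M) (hOm : 0 ≤ Om)
    (hB : ∀ t u, |u| ≤ M → |b0 t u| ≤ B) (t u : ℝ) :
    |bFun b0 M Om δ t u - Om * u| ≤ B + Om * M := by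
  unfold bFun
  have h1 := hB t _ (clip_abs hM u)
  have h2 : |b0 t (clip M u) * ramp δ u| ≤ B := by
    rw [abs_mul, abs_of_nonneg (ramp_nonneg δ u)]
    have := mul_le_mul_of_nonneg_left (ramp_le_one δ u) (abs_nonneg (b0 t (clip M u)))
    linarith
  have e : b0 t (clip M u) * ramp δ u + Om * (u - clip M u) - Om * u =
    b0 t (clip M u) * ramp δ u - Om * clip M u := by ring
  rw [e]
  refine (abs_sub _ _).trans ?_
  rw [abs_mul Om, abs_of_nonneg hOm]
  have := mul_le_mul_of_nonneg_left (clip_abs hM u) hOm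
  linarith

theorem sclip {M : ℝ} (hM : 0 ≤ M) (e x : ℝ) (he : e = 1 ∨ e = -1) : e * clip M x = clip M (e * x) := by
  rcases he with rfl | rfl
  · simp
  · simp [clip_neg hM]

theorem bFun_sign {b0 : ℝ → ℝ → ℝ} {M Om δ C0 R Kc s : ℝ} (hOm : 0 ≤ Om) (hM : 0 ≤ M)
    (hC0 : 0 ≤ C0) (hKc : 0 ≤ Kc)
    (h1 : ∀ t u e, (e = 1 ∨ e = -1) → 0 ≤ e * u → |u| ≤ R → -C0 ≤ e * b0 t u)
    (h2 : ∀ t u e, (e = 1 ∨ e = -1) → 0 ≤ e * u → R ≤ e * u → Kc * (e * u) ^ s ≤ e * b0 t u)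
    (t u e : ℝ) (he : e = 1 ∨ e = -1) (hu : 0 ≤ e * u) : -C0 ≤ e * bFun b0 M Om δ t u := by
  have hc : 0 ≤ e * clip M u := by
    rw [sclip hM e u he, clip_nonneg_eq hM hu]; exact le_min hu hM
  have h3 : -C0 ≤ e * b0 t (clip M u) := by
    rcases le_total (|clip M u|) R with h | h
    · exact h1 t _ e he hc h
    · have habs : |clip M u| = e * clip M u := by
        rw [← abs_of_nonneg hc]
        rcases he with rfl | rfl <;> simp
      rw [habs] at h
      have := h2 t _ e he hc h
      have : 0 ≤ Kc * (e * clip M u) ^ s := by positivity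
      linarith
  have h4 : 0 ≤ e * (u - clip M u) := by
    rw [mul_sub, sclip hM e u he, clip_nonneg_eq hM hu]
    linarith [min_le_left (e * u) M]
  unfold bFun
  have e1 : e * (b0 t (clip M u) * ramp δ u + Om * (u - clip M u)) =
    (e * b0 t (clip M u)) * ramp δ u + Om * (e * (u - clip M u)) := by ring
  rw [e1]
  have := mul_nonneg hOm h4
  have := mul_le_mul_of_nonneg_right h3 (ramp_nonneg δ u)
  have := mul_le_mul_of_nonneg_left (ramp_le_one δ u) hC0
  linarith

theorem bFun_beta {b0 : ℝ → ℝ → ℝ} {M Om δ R Kc s : ℝ} (hs : 0 < s) (hOm : 0 ≤ Om) 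
    (hKc : 0 ≤ Kc) (hδ : 0 < δ) (hR : 2 * δ ≤ R) (hRM : R ≤ M)
    (h2 : ∀ t u e, (e = 1 ∨ e = -1) → 0 ≤ e * u → R ≤ e * u → Kc * (e * u) ^ s ≤ e * b0 t u)
    (t u e : ℝ) (he : e = 1 ∨ e = -1) (x : ℝ) (hx : R ≤ x) (hu : x ≤ e * u) :
    Kc * (min x M) ^ s + Om * (x - min x M) ≤ e * bFun b0 M Om δ t u := by
  have hM : 0 ≤ M := by linarith
  have hu0 : 0 ≤ e * u := by linarith
  have habs : |u| = e * u := by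
    rw [← abs_of_nonneg hu0]
    rcases he with rfl | rfl <;> simp
  have hc : e * clip M u = min (e * u) M := by rw [sclip hM e u he, clip_nonneg_eq hM hu0]
  have hcR : R ≤ e * clip M u := by rw [hc]; exact le_min (by linarith) hRM
  have h3 := h2 t (clip M u) e he (by linarith) hcR
  rw [hc] at h3
  unfold bFun
  rw [ramp_one hδ (by rw [habs]; linarith), mul_one]
  have e1 : e * (b0 t (clip M u) + Om * (u - clip M u)) =
    e * b0 t (clip M u) + Om * (e * u - e * clip M u) := by ring
  rw [e1, hc]
  have h4 : (min x M) ^ s ≤ (min (e * u) M) ^ s :=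
    Real.rpow_le_rpow (le_min (by linarith) hM) (min_le_min_right _ hu) hs.le
  have h5 := mul_le_mul_of_nonneg_left h4 hKc
  have h6 : x - min x M ≤ e * u - min (e * u) M := by
    rcases le_total x M with a | a <;> rcases le_total (e * u) M with b | b <;>
      simp only [min_eq_left, min_eq_right, a, b] <;> linarith
  have h7 := mul_le_mul_of_nonneg_left h6 hOm
  linarith

theorem growthG {s L κ Kc R M S Om δ : ℝ} (hs : 0 < s) (hL : 0 < L) (hκ : κ = L / 6) (hKc : 0 < Kc)
    (hR : 0 < R) (hRM : R ≤ M) (hK : 12 / L < (Kc * κ / 2) ^ (1 / s)) (hδ : 0 < δ)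
    (hδ2 : δ ≤ Kc * κ / 2 * (R / 2) ^ s) (hS : Kc * κ * M ^ s ≤ S) (hS0 : 0 ≤ S)
    (hO1 : 6 / L < Om * κ / 4) (hO2 : 1 ≤ Om) (hO3 : S + δ ≤ Om * M * κ / 2) (x : ℝ) (hx : R ≤ x) :
    2 * x < L / 3 * aFun (1 / s) S Om δ ((Kc * (min x M) ^ s + Om * (x - min x M)) * L / 6) := by
  have hα : 0 < 1 / s := by positivity
  have hκ0 : 0 < κ := by rw [hκ]; positivity
  have hM : 0 < M := by linarith
  have hx0 : 0 < x := by linarith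
  set β := Kc * (min x M) ^ s + Om * (x - min x M) with hβ
  have hmono := aFun_mono (α := 1 / s) (S := S) (Om := Om) (δ := δ) hα (by linarith)
  have eβ : β * L / 6 = β * κ := by rw [hκ]; ring
  rw [eβ]
  suffices h : 6 * x / L < aFun (1 / s) S Om δ (β * κ) by
    have := mul_lt_mul_of_pos_left h (show 0 < L / 3 by positivity)
    have e : L / 3 * (6 * x / L) = 2 * x := by field_simp; ring
    linarith
  have hmx : 0 ≤ x - min x M := by linarith [min_le_left x M]
  rcases le_total x (2 * M) with h | h
  · -- moderate
    have hm : x / 2 ≤ min x M := le_min (by linarith) (by linarith)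
    set y := Kc * κ / 2 * (x / 2) ^ s with hy
    have hy0 : 0 < y := by positivity
    have h1 : (x / 2) ^ s ≤ (min x M) ^ s := Real.rpow_le_rpow (by positivity) hm hs.le
    have h2 : Kc * κ * (x / 2) ^ s ≤ β * κ := by
      have h3 : Kc * (x / 2) ^ s ≤ β := by
        have := mul_le_mul_of_nonneg_left h1 hKc.le
        have := mul_nonneg (show 0 ≤ Om by linarith) hmx
        linarith
      have := mul_le_mul_of_nonneg_right h3 hκ0.le
      linarith
    have h4 : δ ≤ y := by
      refine hδ2.trans ?_
      have : (R / 2) ^ s ≤ (x / 2) ^ s := Real.rpow_le_rpow (by positivity) (by linarith) hs.le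
      exact mul_le_mul_of_nonneg_left this (by positivity)
    have h5 : y + δ ≤ β * κ := by rw [hy] at h4 ⊢; linarith
    have h6 : y ≤ S := by
      refine le_trans ?_ hS
      have : (x / 2) ^ s ≤ M ^ s := Real.rpow_le_rpow (by positivity) (by linarith) hs.le
      have h7 := mul_le_mul_of_nonneg_left this (show 0 ≤ Kc * κ by positivity)
      have : 0 ≤ Kc * κ * (x / 2) ^ s := by positivity
      rw [hy]; linarith
    have h8 := hmono h5
    rw [aFun_shift hα hδ.le hS0 hy0.le, min_eq_left h6, sub_self, mul_zero, add_zero] at h8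
    refine lt_of_lt_of_le ?_ h8
    rw [hy, Real.mul_rpow (by positivity) (by positivity), ← Real.rpow_mul (by positivity),
      mul_one_div_cancel hs.ne', Real.rpow_one]
    have := mul_lt_mul_of_pos_right hK (show 0 < x / 2 by positivity)
    refine lt_of_eq_of_lt ?_ this
    field_simp; ring
  · have hm : min x M = M := min_eq_right (by linarith)
    have h3 : Om * x / 2 ≤ β := by
      rw [hβ, hm]
      have : 0 ≤ Kc * M ^ s := by positivity
      nlinarith
    have h4 : Om * x / 2 * κ ≤ β * κ := mul_le_mul_of_nonneg_right h3 hκ0.le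
    have h5 : S + δ ≤ Om * x * κ / 4 := by
      refine hO3.trans ?_
      have : Om * κ * (2 * M) ≤ Om * κ * x := by gcongr
      linarith
    set y := Om * x * κ / 4 + S with hy
    have hq : 0 < Om * x * κ / 4 := by positivity
    have h6 : y + δ ≤ β * κ := by linarith
    have h8 := hmono h6
    rw [aFun_shift hα hδ.le hS0 (by linarith), min_eq_right (by linarith)] at h8
    refine lt_of_lt_of_le ?_ h8
    have h9 : 0 ≤ S ^ (1 / s) := by positivity
    have h10 : Om * x * κ / 4 ≤ Om * (y - S) := by
      rw [hy, add_sub_cancel_right]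
      nlinarith
    have h11 := mul_lt_mul_of_pos_right hO1 hx0
    have : 6 * x / L = 6 / L * x := by ring
    rw [this]
    linarith


set_option maxHeartbeats 3200000 in
theorem tier2 (b0 : ℝ → ℝ → ℝ) (hb0c : ∀ t, Continuous (b0 t)) (hb0m : Measurable (Function.uncurry b0))
    (s : ℝ) (hs : 0 < s) (Bd : ℝ → ℝ) (hBd0 : ∀ x, 0 ≤ x → 0 ≤ Bd x)
    (hBdm : ∀ x y, 0 ≤ x → x ≤ y → Bd x ≤ Bd y) (hBd : ∀ t u, |b0 t u| ≤ Bd |u|)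
    (C0 R Kc L κ : ℝ) (hC0 : 0 ≤ C0) (hR : 0 < R) (hKc : 0 < Kc) (k : ℕ) (hk : 1 ≤ k)
    (hL : 3 * L = 1 / ((2 * k + 1 : ℕ) : ℝ)) (hκ : κ = L / 6)
    (hK : 12 / L < (Kc * κ / 2) ^ (1 / s))
    (h1 : ∀ t u e, (e = 1 ∨ e = -1) → 0 ≤ e * u → |u| ≤ R → -C0 ≤ e * b0 t u)
    (h2 : ∀ t u e, (e = 1 ∨ e = -1) → 0 ≤ e * u → R ≤ e * u → Kc * (e * u) ^ s ≤ e * b0 t u)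
    (C1 l r0 : ℝ) (hC1 : 0 < C1) (hl : 0 < l) (hl1 : l * (l * C1) ^ (1 / s) < 1)
    (hkl : 1 < (2 * k - 1) * l) (h3 : ∀ t u, |u| ≤ r0 → |b0 t u| ≤ C1 * |u| ^ s) :
    ∃ Ast δ0 : ℝ, 0 < δ0 ∧ ∀ δ, 0 < δ → δ ≤ δ0 → ∃ u w : ℝ → ℝ, Continuous u ∧ Continuous w ∧
      u 1 = u 0 ∧ w 1 = w 0 ∧
      (∀ t ∈ Set.Icc (0:ℝ) 1, u t = u 0 + ∫ r in (0:ℝ)..t, sp (1 / s) (w r - clip δ (w r))) ∧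
      (∀ t ∈ Set.Icc (0:ℝ) 1, w t = w 0 - ∫ r in (0:ℝ)..t, b0 r (u r) * ramp δ (u r)) ∧
      (∀ t ∈ Set.Icc (0:ℝ) 1, |u t| ≤ Ast ∧ |w t| ≤ Ast) ∧
      ∃ t ∈ Set.Icc (0:ℝ) 1, r0 < |u t| := by
  have hα : 0 < 1 / s := by positivity
  have hLpos : 0 < L := by
    have : (0:ℝ) < 1 / ((2 * k + 1 : ℕ) : ℝ) := by positivity
    linarith
  have hκ0 : 0 < κ := by rw [hκ]; positivity
  set y0 : ℝ := ((R + 1) / L) ^ s with hy0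
  have hy0p : 0 < y0 := by positivity
  have hy0e : y0 ^ (1 / s) = (R + 1) / L := by
    rw [hy0, ← Real.rpow_mul (by positivity), mul_one_div_cancel hs.ne', Real.rpow_one]
  set Pf : ℝ → ℝ := fun A => (A + C0) ^ (1 / s) with hPf
  set Qf : ℝ → ℝ := fun A => Bd (A + Pf A) with hQf
  set A : ℕ → ℝ := fun n => Nat.rec (R + C0 + 2 + y0) (fun _ x => x + Pf x + C0 + Qf x) n with hA
  have A0 : A 0 = R + C0 + 2 + y0 := rfl
  have As : ∀ i, A (i + 1) = A i + Pf (A i) + C0 + Qf (A i) := fun i => rfl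
  have Apos : ∀ i, 0 ≤ A i := by
    intro i
    induction i with
    | zero => rw [A0]; positivity
    | succ i ih =>
      rw [As]
      have p1 : 0 ≤ Pf (A i) := by simp only [hPf]; positivity
      have := hBd0 (A i + Pf (A i)) (by positivity)
      simp only [hQf]
      positivity
  have Ppos : ∀ i, 0 ≤ Pf (A i) := fun i => by
    have := Apos i
    simp only [hPf]; positivity
  have Qpos : ∀ i, 0 ≤ Qf (A i) := fun i => hBd0 _ (add_nonneg (Apos i) (Ppos i))
  have Amono : Monotone A := monotone_nat_of_le_succ fun i => by
    rw [As]; linarith [Ppos i, Qpos i]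
  set n := 2 * (2 * k + 1) with hn
  set M : ℝ := A n + R + 1 with hM
  have hMp : 1 < M := by linarith [Apos n]
  set S : ℝ := A n + C0 + 1 + Kc * κ * M ^ s with hS
  have hKM : 0 ≤ Kc * κ * M ^ s := by positivity
  have hSp : 0 < S := by linarith [Apos n]
  set Om : ℝ := 2 * Real.pi * k + 1 + 24 / (L * κ) + 2 * (S + 1) / (M * κ) with hOm
  have hpi := Real.pi_pos
  have o1 : 0 ≤ 2 * Real.pi * k := by positivity
  have o2 : 0 ≤ 24 / (L * κ) := by positivity
  have o3 : 0 ≤ 2 * (S + 1) / (M * κ) := by positivity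
  have hOm1 : 1 ≤ Om := by linarith
  have hOmk : 2 * Real.pi * k < Om := by linarith
  have hO1 : 6 / L < Om * κ / 4 := by
    have h5 : (24 / (L * κ) + 1) * κ ≤ Om * κ := mul_le_mul_of_nonneg_right (by linarith) hκ0.le
    have h6 : 24 / (L * κ) * κ = 24 / L := by field_simp
    have h7 : 6 / L = 24 / L / 4 := by ring
    linarith
  have hO3 : S + 1 ≤ Om * M * κ / 2 := by
    have h5 : 2 * (S + 1) / (M * κ) * (M * κ) ≤ Om * (M * κ) :=
      mul_le_mul_of_nonneg_right (by linarith) (by positivity)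
    rw [div_mul_cancel₀ _ (by positivity)] at h5
    linarith
  refine ⟨A n, min 1 (min (R / 2) (Kc * κ / 2 * (R / 2) ^ s)), by positivity, ?_⟩
  intro δ hδ hδ0
  have d1 : δ ≤ 1 := hδ0.trans (min_le_left _ _)
  have d2 : δ ≤ R / 2 := hδ0.trans ((min_le_right _ _).trans (min_le_left _ _))
  have d3 : δ ≤ Kc * κ / 2 * (R / 2) ^ s := hδ0.trans ((min_le_right _ _).trans (min_le_right _ _))
  have hM0 : 0 ≤ M := by linarith
  have hOm0 : 0 ≤ Om := by linarith
  have hBM : ∀ t u, |u| ≤ M → |b0 t u| ≤ Bd M := fun t u hu =>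
    (hBd t u).trans (hBdm _ _ (abs_nonneg u) hu)
  set a := aFun (1 / s) S Om δ with ha
  set b := bFun b0 M Om δ with hb
  set D1 := S ^ (1 / s) + Om * S + Om * δ with hD1
  set D2 := Bd M + Om * M with hD2
  have hD1p : 0 ≤ D1 := by positivity
  have hD2p : 0 ≤ D2 := by have := hBd0 M hM0; positivity
  set D := D1 + D2 with hD
  set C := D / δ + Om + D with hC
  have hDp : 0 ≤ D := by positivity
  have hDd : 0 ≤ D / δ := by positivity
  have aas : ∀ w, |a w - Om * w| ≤ D1 := aFun_asym hα hδ.le hSp.le hOm0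
  have bas : ∀ t u, |b t u - Om * u| ≤ D2 := bFun_asym hM0 hOm0 hBM
  have az : ∀ w, |w| ≤ δ → a w = 0 := fun w hw => aFun_zero hα hSp.le hw
  have bz : ∀ t u, |u| ≤ δ → b t u = 0 := fun t u hu => bFun_zero hδ (by linarith) hu
  have amono : Monotone a := aFun_mono hα hOm0
  have aodd : ∀ x, a (-x) = - a x := aFun_odd hSp.le hδ.le
  have acont : Continuous a := aFun_cont hα
  have bmeas : Measurable (Function.uncurry b) := bFun_meas hb0m
  have bcont : ∀ t, Continuous (b t) := bFun_cont hb0c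
  have alin : ∀ w, |a w| ≤ C * |w| := fun w => by
    refine (linOfAsym (a w) Om δ D hδ hDp hOm0 w ((aas w).trans (by linarith)) (az w)).trans ?_
    exact mul_le_mul_of_nonneg_right (by linarith) (abs_nonneg _)
  have blin : ∀ t u, |b t u| ≤ C * |u| := fun t u => by
    refine (linOfAsym (b t u) Om δ D hδ hDp hOm0 u ((bas t u).trans (by linarith)) (bz t u)).trans ?_
    exact mul_le_mul_of_nonneg_right (by linarith) (abs_nonneg _)
  have hCp : 0 ≤ C := by positivity
  obtain ⟨ζ, zc, z1, z2, z3⟩ := tier1 a b acont bcont bmeas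
    C Om δ hδ hCp alin blin
    (fun w => (aas w).trans (by linarith)) (fun t u => (bas t u).trans (by linarith)) az bz k hk hOmk
  set u : ℝ → ℝ := fun t => (Complex.exp (ζ t)).im with hu
  set w : ℝ → ℝ := fun t => (Complex.exp (ζ t)).re with hw
  have cu : Continuous u := Complex.continuous_im.comp (Complex.continuous_exp.comp zc)
  have cw : Continuous w := Complex.continuous_re.comp (Complex.continuous_exp.comp zc)
  have hper : Complex.exp (ζ 1) = Complex.exp (ζ 0) := by
    rw [z1, Complex.exp_add]
    have : Complex.exp (2 * Real.pi * k * Complex.I) = 1 := by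
      rw [show (2 * Real.pi * k * Complex.I : ℂ) = k * (2 * Real.pi * Complex.I) by ring]
      exact Complex.exp_nat_mul_two_pi_mul_I k
    rw [this, mul_one]
  have hu01 : u 1 = u 0 := by simp only [hu, hper]
  have hw01 : w 1 = w 0 := by simp only [hw, hper]
  have Sy : Sys a (fun r => b r (u r)) u w := by
    refine Sys.ofInt a _ u w cu cw ?_ ?_ z2 z3
    · intro r t _ _ _
      exact (acont.comp cw).intervalIntegrable _ _
    · intro r t _ _ _
      have hdom : IntervalIntegrable (fun x => C * |u x|) volume r t :=
        (continuous_const.mul cu.abs).intervalIntegrable _ _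
      refine hdom.mono_fun (bmeas.comp (measurable_id.prodMk cu.measurable)).aestronglyMeasurable ?_
      refine Filter.Eventually.of_forall fun x => ?_
      simp only [Real.norm_eq_abs]
      exact (blin x (u x)).trans (le_abs_self _)
  have a0 : a 0 = 0 := az 0 (by simpa using hδ.le)
  obtain ⟨τ, σ, t0, t1, t2, t3, t4, t5, t6⟩ := pieces Sy (fun x hx => by
    have := amono hx; rwa [a0] at this) aodd ζ zc k (fun t => rfl) (fun t => rfl) z1
  have hAP : ∀ i < n, A i + Pf (A i) + C0 ≤ A n := by
    intro i hi
    have := Amono (show i + 1 ≤ n by omega)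
    rw [As] at this
    linarith [Qpos i]
  have ub := upperBound Sy amono aodd (2 * k + 1) (by omega) τ σ t0 t1 (fun j hj => t2 j (by omega)) t3 t4
    (fun j hj => t5 j (by omega)) hu01 hw01 C0 hC0
    (fun r _ e he hue => bFun_sign hOm0 hM0 hC0 hKc.le h1 h2 r (u r) e he hue)
    A (fun i => Pf (A i)) (fun i => Qf (A i)) (fun i _ => Ppos i)
    (fun i hi => by
      have h5 := hAP i hi
      have h6 : |A i + C0| = A i + C0 := abs_of_nonneg (add_nonneg (Apos i) hC0)
      have h7 := aFun_le (α := 1 / s) (S := S) (Om := Om) (δ := δ) (w := A i + C0) hα hδ.le (by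
        rw [h6]; linarith [Ppos i])
      rw [h6] at h7
      exact (le_abs_self _).trans h7)
    (fun i _ => Qpos i)
    (fun i hi r _ hur => by
      have h5 := hAP i hi
      simp only [hb]
      rw [bFun_small (by linarith), abs_mul, abs_of_nonneg (ramp_nonneg _ _)]
      have h6 := mul_le_mul_of_nonneg_left (ramp_le_one δ (u r)) (abs_nonneg (b0 r (u r)))
      have h7 := (hBd r (u r)).trans (hBdm _ _ (abs_nonneg _) hur)
      linarith)
    As L R hL hR.le (by rw [A0]; linarith)
    (fun x => Kc * (min x M) ^ s + Om * (x - min x M))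
    (fun x hx => by
      have : 0 ≤ x - min x M := by linarith [min_le_left x M]
      have : 0 ≤ min x M := le_min (by linarith) hM0
      positivity)
    (fun r _ e he x hx hxu => bFun_beta hs hOm0 hKc.le hδ (by linarith) (by linarith [Apos n]) h2 r (u r) e he x hx hxu)
    (growthG hs hLpos hκ hKc hR (by linarith [Apos n]) hK hδ d3 (by linarith [Apos n]) hSp.le hO1 hOm1 (by linarith))
    (by
      have h5 : y0 + δ ≤ A 0 - C0 := by rw [A0]; linarith
      have h6 := amono h5
      have h7 : y0 ≤ S := by
        have := Amono (Nat.zero_le n)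
        rw [A0] at this
        linarith
      rw [ha, aFun_shift hα hδ.le hSp.le hy0p.le, min_eq_left h7, sub_self, mul_zero, add_zero, hy0e] at h6
      have h8 := mul_le_mul_of_nonneg_left h6 hLpos.le
      rw [mul_div_cancel₀ _ hLpos.ne'] at h8
      linarith)
  have eb : ∀ r ∈ Set.Icc (0:ℝ) 1, b r (u r) = b0 r (u r) * ramp δ (u r) := fun r hr =>
    bFun_small (by linarith [(ub r hr).1])
  have ea : ∀ r ∈ Set.Icc (0:ℝ) 1, a (w r) = sp (1 / s) (w r - clip δ (w r)) := fun r hr =>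
    aFun_small hδ.le (by linarith [(ub r hr).2])
  refine ⟨u, w, cu, cw, hu01, hw01, ?_, ?_, ub, ?_⟩
  · intro t ht
    refine (z2 t ht).trans ?_
    congr 1
    apply integral_congr
    intro r hr
    rw [Set.uIcc_of_le ht.1] at hr
    exact ea r ⟨hr.1, hr.2.trans ht.2⟩
  · intro t ht
    refine (z3 t ht).trans ?_
    congr 1
    apply integral_congr
    intro r hr
    rw [Set.uIcc_of_le ht.1] at hr
    exact eb r ⟨hr.1, hr.2.trans ht.2⟩
  · by_contra! hsm
    refine lowerBound Sy k hk τ t2 t3 t6 s C1 l hs hC1 hl hl1 hkl ?_ ?_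
    · intro t ht
      exact aFun_le hα hδ.le (by linarith [(ub t ht).2])
    · intro t ht
      rw [eb t ht, abs_mul, abs_of_nonneg (ramp_nonneg _ _)]
      have h6 := mul_le_mul_of_nonneg_left (ramp_le_one δ (u t)) (abs_nonneg (b0 t (u t)))
      have h7 := h3 t (u t) (hsm t ht)
      linarith


theorem intBdd (c : ℝ → ℝ) (hc : Measurable c) (B : ℝ)
    (hB : ∀ r ∈ Set.Icc (0:ℝ) 1, |c r| ≤ B) (a b : ℝ) (ha : a ∈ Set.Icc (0:ℝ) 1)
    (hb : b ∈ Set.Icc (0:ℝ) 1) : IntervalIntegrable c volume a b := by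
  rw [intervalIntegrable_iff]
  refine Measure.integrableOn_of_bounded (M := B) (by simp [Set.uIoc]) hc.aestronglyMeasurable ?_
  rw [ae_restrict_iff' measurableSet_uIoc]
  refine Filter.Eventually.of_forall fun r hr => hB r ?_
  rw [Set.uIoc, Set.mem_Ioc] at hr
  exact ⟨(le_min ha.1 hb.1).trans hr.1.le, hr.2.trans (max_le ha.2 hb.2)⟩

theorem lipOfInt (x c : ℝ → ℝ) (hc : Measurable c) (B : ℝ)
    (hB : ∀ r ∈ Set.Icc (0:ℝ) 1, |c r| ≤ B)
    (hx : ∀ t ∈ Set.Icc (0:ℝ) 1, x t = x 0 + ∫ r in (0:ℝ)..t, c r)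
    (a b : ℝ) (ha : a ∈ Set.Icc (0:ℝ) 1) (hb : b ∈ Set.Icc (0:ℝ) 1) :
    |x a - x b| ≤ B * |a - b| := by
  have h0 : (0:ℝ) ∈ Set.Icc (0:ℝ) 1 := by simp
  have e : x a - x b = ∫ r in b..a, c r := by
    rw [hx a ha, hx b hb, ← integral_add_adjacent_intervals (intBdd c hc B hB 0 b h0 hb)
      (intBdd c hc B hB b a hb ha)]
    ring
  rw [e]
  rw [← Real.norm_eq_abs]
  refine intervalIntegral.norm_integral_le_of_norm_le_const fun r hr => hB r ?_
  rw [Set.uIoc, Set.mem_Ioc] at hr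
  exact ⟨(le_min hb.1 ha.1).trans hr.1.le, hr.2.trans (max_le hb.2 ha.2)⟩

open Filter Topology in
theorem tier3 (b0 : ℝ → ℝ → ℝ) (hb0c : ∀ t, Continuous (b0 t)) (hb0m : Measurable (Function.uncurry b0))
    (s : ℝ) (hs : 0 < s) (Bd : ℝ → ℝ)
    (hBdm : ∀ x y, 0 ≤ x → x ≤ y → Bd x ≤ Bd y) (hBd : ∀ t u, |b0 t u| ≤ Bd |u|)
    (r0 : ℝ) (hz : ∀ t, b0 t 0 = 0) (Ast δ0 : ℝ) (hδ0 : 0 < δ0)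
    (H : ∀ δ, 0 < δ → δ ≤ δ0 → ∃ u w : ℝ → ℝ, Continuous u ∧ Continuous w ∧
      u 1 = u 0 ∧ w 1 = w 0 ∧
      (∀ t ∈ Set.Icc (0:ℝ) 1, u t = u 0 + ∫ r in (0:ℝ)..t, sp (1 / s) (w r - clip δ (w r))) ∧
      (∀ t ∈ Set.Icc (0:ℝ) 1, w t = w 0 - ∫ r in (0:ℝ)..t, b0 r (u r) * ramp δ (u r)) ∧
      (∀ t ∈ Set.Icc (0:ℝ) 1, |u t| ≤ Ast ∧ |w t| ≤ Ast) ∧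
      ∃ t ∈ Set.Icc (0:ℝ) 1, r0 < |u t|) :
    ∃ u w : ℝ → ℝ, Continuous u ∧ Continuous w ∧ u 1 = u 0 ∧ w 1 = w 0 ∧
      (∀ t ∈ Set.Icc (0:ℝ) 1, u t = u 0 + ∫ r in (0:ℝ)..t, sp (1 / s) (w r)) ∧
      (∀ t ∈ Set.Icc (0:ℝ) 1, w t = w 0 - ∫ r in (0:ℝ)..t, b0 r (u r)) ∧
      ∃ t ∈ Set.Icc (0:ℝ) 1, r0 ≤ |u t| := by
  have hα : 0 < 1 / s := by positivity
  have I0 : (0:ℝ) ∈ Set.Icc (0:ℝ) 1 := by simp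
  have I1 : (1:ℝ) ∈ Set.Icc (0:ℝ) 1 := by simp
  obtain ⟨d, hd0, hd1, hdl⟩ : ∃ d : ℕ → ℝ, (∀ n, 0 < d n) ∧ (∀ n, d n ≤ δ0) ∧ Tendsto d atTop (𝓝 0) := by
    refine ⟨fun n => δ0 * (1 / ((n:ℝ) + 1)), fun n => by positivity, fun n => ?_, ?_⟩
    · have : 1 / ((n:ℝ) + 1) ≤ 1 := by
        rw [div_le_one (by positivity)]; linarith [(Nat.cast_nonneg n : (0:ℝ) ≤ n)]
      have := mul_le_mul_of_nonneg_left this hδ0.le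
      linarith
    · have := (tendsto_one_div_add_atTop_nhds_zero_nat (𝕜 := ℝ)).const_mul δ0
      simpa using this
  choose u w cu cw hu01 hw01 hu hw hb τ hτ hτr using fun n => H (d n) (hd0 n) (hd1 n)
  have hA : 0 ≤ Ast := (abs_nonneg _).trans (hb 0 0 I0).1
  obtain ⟨ts, hts, ψ, hψ, hψl⟩ := isCompact_Icc.tendsto_subseq hτ
  have mu : ∀ n, Measurable fun r => sp (1 / s) (w n r - clip (d n) (w n r)) := fun n => by
    have := (sp_cont hα).comp ((cw n).sub ((clip_cont (d n)).comp (cw n)))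
    exact this.measurable
  have mw : ∀ n, Measurable fun r => b0 r (u n r) * ramp (d n) (u n r) := fun n => by
    have h1 : Measurable fun r => b0 r (u n r) := hb0m.comp (measurable_id.prodMk (cu n).measurable)
    exact h1.mul ((ramp_cont _).comp (cu n)).measurable
  have bu : ∀ n, ∀ r ∈ Set.Icc (0:ℝ) 1, |sp (1 / s) (w n r - clip (d n) (w n r))| ≤ Ast ^ (1 / s) := by
    intro n r hr
    rw [sp_abs hα]
    exact Real.rpow_le_rpow (abs_nonneg _) ((soft_abs (hd0 n).le _).trans (hb n r hr).2) hα.le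
  have bw : ∀ n, ∀ r ∈ Set.Icc (0:ℝ) 1, |b0 r (u n r) * ramp (d n) (u n r)| ≤ Bd Ast := by
    intro n r hr
    rw [abs_mul, abs_of_nonneg (ramp_nonneg _ _)]
    have h6 := mul_le_mul_of_nonneg_left (ramp_le_one (d n) (u n r)) (abs_nonneg (b0 r (u n r)))
    have h7 := (hBd r (u n r)).trans (hBdm _ _ (abs_nonneg _) (hb n r hr).1)
    linarith
  have lu : ∀ n a b, a ∈ Set.Icc (0:ℝ) 1 → b ∈ Set.Icc (0:ℝ) 1 → |u n a - u n b| ≤ Ast ^ (1/s) * |a - b| :=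
    fun n a b ha hb' => lipOfInt (u n) _ (mu n) _ (bu n) (hu n) a b ha hb'
  have lw : ∀ n a b, a ∈ Set.Icc (0:ℝ) 1 → b ∈ Set.Icc (0:ℝ) 1 → |w n a - w n b| ≤ Bd Ast * |a - b| := by
    intro n a b ha hb'
    refine lipOfInt (w n) (fun r => -(b0 r (u n r) * ramp (d n) (u n r))) (mw n).neg _
      (fun r hr => by rw [abs_neg]; exact bw n r hr) (fun t ht => ?_) a b ha hb'
    rw [intervalIntegral.integral_neg, ← sub_eq_add_neg]
    exact hw n t ht
  have hBA : 0 ≤ Bd Ast := (abs_nonneg _).trans (bw 0 0 I0)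
  have hP : 0 ≤ Ast ^ (1/s) := by positivity
  set K : NNReal := ⟨Ast ^ (1/s) + Bd Ast, by positivity⟩ with hK
  let pr : ℝ → ℝ := fun t => max 0 (min t 1)
  have prI : ∀ t, pr t ∈ Set.Icc (0:ℝ) 1 := fun t =>
    ⟨le_max_left _ _, max_le zero_le_one (min_le_right _ _)⟩
  have prE : ∀ t ∈ Set.Icc (0:ℝ) 1, pr t = t := fun t ht => by
    simp only [pr]; rw [min_eq_left ht.2, max_eq_right ht.1]
  have prL : ∀ a b, |pr a - pr b| ≤ |a - b| := by
    intro a b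
    have h1 := abs_max_sub_max_le_max 0 (min a 1) 0 (min b 1)
    have h2 := abs_min_sub_min_le_max a 1 b 1
    exact h1.trans (max_le (by simp) (h2.trans (max_le le_rfl (by simp))))
  obtain ⟨φ, hφ, G, hG, hlim⟩ := lipSubseq (fun n t => ⟨w (ψ n) (pr t), u (ψ n) (pr t)⟩) K (by
    intro n
    refine LipschitzWith.of_dist_le_mul fun a b => ?_
    rw [dist_eq_norm, Real.dist_eq]
    refine (Complex.norm_le_abs_re_add_abs_im _).trans ?_
    have h1 := lu (ψ n) _ _ (prI a) (prI b)
    have h2 := lw (ψ n) _ _ (prI a) (prI b)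
    have h3 := mul_le_mul_of_nonneg_left (prL a b) hP
    have h4 := mul_le_mul_of_nonneg_left (prL a b) hBA
    have e : (K : ℝ) = Ast ^ (1/s) + Bd Ast := rfl
    simp only [Complex.sub_re, Complex.sub_im]
    rw [e, add_mul]
    linarith) (Ast + Ast) (by
    intro n
    refine (Complex.norm_le_abs_re_add_abs_im _).trans ?_
    have := hb (ψ n) _ (prI 0)
    simp only
    linarith)
  set χ : ℕ → ℕ := fun n => ψ (φ n) with hχ
  have χt : Tendsto χ atTop atTop := hψ.tendsto_atTop.comp hφ.tendsto_atTop
  have lim_u : ∀ t ∈ Set.Icc (0:ℝ) 1, Tendsto (fun n => u (χ n) t) atTop (𝓝 (G t).im) := by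
    intro t ht
    have := (Complex.continuous_im.tendsto _).comp (hlim t)
    simp only [Function.comp_def, prE t ht] at this
    exact this
  have lim_w : ∀ t ∈ Set.Icc (0:ℝ) 1, Tendsto (fun n => w (χ n) t) atTop (𝓝 (G t).re) := by
    intro t ht
    have := (Complex.continuous_re.tendsto _).comp (hlim t)
    simp only [Function.comp_def, prE t ht] at this
    exact this
  have dχ : Tendsto (fun n => d (χ n)) atTop (𝓝 0) := hdl.comp χt
  have cU : Continuous fun t => (G t).im := Complex.continuous_im.comp hG.continuous
  have cW : Continuous fun t => (G t).re := Complex.continuous_re.comp hG.continuous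
  refine ⟨fun t => (G t).im, fun t => (G t).re, cU, cW, ?_, ?_, ?_, ?_, ts, hts, ?_⟩
  · refine tendsto_nhds_unique (lim_u 1 I1) ?_
    simp only [hu01]
    exact lim_u 0 I0
  · refine tendsto_nhds_unique (lim_w 1 I1) ?_
    simp only [hw01]
    exact lim_w 0 I0
  · intro t ht
    refine tendsto_nhds_unique (lim_u t ht) ?_
    have e : (fun n => u (χ n) t) = fun n => u (χ n) 0 +
        ∫ r in (0:ℝ)..t, sp (1 / s) (w (χ n) r - clip (d (χ n)) (w (χ n) r)) :=
      funext fun n => hu (χ n) t ht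
    rw [e]
    refine (lim_u 0 I0).add ?_
    refine intLimit (fun n _ x => sp (1 / s) (x - clip (d (χ n)) x)) (fun _ x => sp (1/s) x)
      (fun n => ?_) (fun n => w (χ n)) (fun t => (G t).re) (fun n => (cw _).measurable) (Ast ^ (1/s))
      (fun n r hr => bu (χ n) r hr) (fun r hr => ?_) t ht (fun _ => t) (fun _ => ht) tendsto_const_nhds
    · have : Continuous fun z : ℝ × ℝ => sp (1 / s) (z.2 - clip (d (χ n)) z.2) :=
        (sp_cont hα).comp (continuous_snd.sub ((clip_cont _).comp continuous_snd))
      exact this.measurable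
    · refine ((sp_cont hα).tendsto _).comp ?_
      have h0 : Tendsto (fun n => clip (d (χ n)) (w (χ n) r)) atTop (𝓝 0) :=
        squeeze_zero_norm (fun n => clip_abs (hd0 _).le _) dχ
      simpa using (lim_w r hr).sub h0
  · intro t ht
    refine tendsto_nhds_unique (lim_w t ht) ?_
    have e : (fun n => w (χ n) t) = fun n => w (χ n) 0 -
        ∫ r in (0:ℝ)..t, b0 r (u (χ n) r) * ramp (d (χ n)) (u (χ n) r) :=
      funext fun n => hw (χ n) t ht
    rw [e]
    refine (lim_w 0 I0).sub ?_
    refine intLimit (fun n r x => b0 r x * ramp (d (χ n)) x) b0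
      (fun n => ?_) (fun n => u (χ n)) (fun t => (G t).im) (fun n => (cu _).measurable) (Bd Ast)
      (fun n r hr => bw (χ n) r hr) (fun r hr => ?_) t ht (fun _ => t) (fun _ => ht) tendsto_const_nhds
    · exact hb0m.mul ((ramp_cont _).measurable.comp measurable_snd)
    · have hl := ((hb0c r).tendsto _).comp (lim_u r hr)
      by_cases h0 : (G r).im = 0
      · rw [h0, hz r] at hl ⊢
        refine squeeze_zero_norm (fun n => ?_) (by simpa using hl.abs)
        simp only [Real.norm_eq_abs, abs_mul, abs_of_nonneg (ramp_nonneg _ _), Function.comp_apply]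
        have h6 := mul_le_mul_of_nonneg_left (ramp_le_one (d (χ n)) (u (χ n) r)) (abs_nonneg (b0 r (u (χ n) r)))
        linarith
      · refine hl.congr' ?_
        have h1 := (lim_u r hr).abs
        have h2 : Tendsto (fun n => 2 * d (χ n)) atTop (𝓝 0) := by simpa using dχ.const_mul 2
        filter_upwards [h2.eventually_lt h1 (abs_pos.mpr h0)] with n hn
        simp only [Function.comp_apply]
        rw [ramp_one (hd0 _) hn.le, mul_one]
  · have h1 := (lim_u ts hts).abs
    have h2 : Tendsto (fun n => Ast ^ (1/s) * |τ (χ n) - ts|) atTop (𝓝 0) := by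
      have := (((hψl.comp hφ.tendsto_atTop).sub_const ts).abs).const_mul (Ast ^ (1/s))
      simpa using this
    have h3 := h1.add h2
    rw [add_zero] at h3
    refine ge_of_tendsto' h3 fun n => ?_
    have h4 := lu (χ n) _ _ (hτ (χ n)) hts
    have h5 := abs_sub_abs_le_abs_sub (u (χ n) (τ (χ n))) (u (χ n) ts)
    linarith [hτr (χ n)]


theorem systemSol (p q Cf lam CV : ℝ) (hp : 1 < p) (hq : p < q)
    (V : ℝ → ℝ) (hVmeas : Measurable V) (hVbdd : ∀ t, |V t| ≤ CV)
    (f : ℝ → ℝ → ℝ) (hfc : Continuous (Function.uncurry f))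
    (hgrowth : ∀ t u, |f t u| ≤ Cf * (1 + |u| ^ (q - 1)))
    (hsign : ∀ t u, 0 ≤ f t u * u)
    (hsuper : ∀ K : ℝ, ∃ R : ℝ, ∀ t u, R ≤ |u| → K * |u| ^ p ≤ f t u * u)
    (hsmall : ∀ ε > 0, ∃ δ > 0, ∀ t u, |u| ≤ δ → |f t u| ≤ ε * |u| ^ (p - 1)) :
    ∃ u w : ℝ → ℝ, Continuous u ∧ Continuous w ∧ u 1 = u 0 ∧ w 1 = w 0 ∧
      (∀ t ∈ Set.Icc (0:ℝ) 1, u t = u 0 + ∫ r in (0:ℝ)..t, sp (1 / (p - 1)) (w r)) ∧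
      (∀ t ∈ Set.Icc (0:ℝ) 1, w t = w 0 -
        ∫ r in (0:ℝ)..t, (f r (u r) - (1 - lam * V r) * sp (p - 1) (u r))) ∧
      ∃ t ∈ Set.Icc (0:ℝ) 1, u t ≠ 0 := by
  obtain ⟨s, hs⟩ : ∃ s, s = p - 1 := ⟨_, rfl⟩
  have hs0 : 0 < s := by linarith
  rw [← hs] at hsmall ⊢
  obtain ⟨r0, hr0, hr0f⟩ := hsmall 1 one_pos
  have hCV : 0 ≤ CV := (abs_nonneg _).trans (hVbdd 0)
  obtain ⟨CW, hCWe⟩ : ∃ CW, CW = 1 + |lam| * CV := ⟨_, rfl⟩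
  have hCW : 1 ≤ CW := by rw [hCWe]; have := mul_nonneg (abs_nonneg lam) hCV; linarith
  have hW : ∀ t, |1 - lam * V t| ≤ CW := by
    intro t
    have h1 := abs_sub 1 (lam * V t)
    have h2 := mul_le_mul_of_nonneg_left (hVbdd t) (abs_nonneg lam)
    rw [abs_mul, abs_one] at h1
    linarith
  have hf0 : ∀ t, f t 0 = 0 := by
    intro t
    have := hr0f t 0 (by simpa using hr0.le)
    rw [abs_zero, Real.zero_rpow hs0.ne', mul_zero] at this
    exact abs_eq_zero.mp (le_antisymm this (abs_nonneg _))
  obtain ⟨b0, hb0⟩ : ∃ b0 : ℝ → ℝ → ℝ, b0 = fun r x => f r x - (1 - lam * V r) * sp s x := ⟨_, rfl⟩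
  have hbv : ∀ r x, b0 r x = f r x - (1 - lam * V r) * sp s x := fun r x => by rw [hb0]
  have hb0c : ∀ t, Continuous (b0 t) := by
    intro t
    rw [hb0]
    have h1 : Continuous (f t) := hfc.comp (Continuous.prodMk_right t)
    exact h1.sub (continuous_const.mul (sp_cont hs0))
  have hb0m : Measurable (Function.uncurry b0) := by
    rw [hb0]
    have h1 : Measurable fun z : ℝ × ℝ => (1 - lam * V z.1) * sp s z.2 :=
      (measurable_const.sub ((hVmeas.comp measurable_fst).const_mul lam)).mul
        ((sp_cont hs0).measurable.comp measurable_snd)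
    exact hfc.measurable.sub h1
  have hWs : ∀ t u, |(1 - lam * V t) * sp s u| ≤ CW * |u| ^ s := by
    intro t u
    rw [abs_mul, sp_abs hs0]
    exact mul_le_mul_of_nonneg_right (hW t) (by positivity)
  have hbabs : ∀ t u, |b0 t u| ≤ |f t u| + CW * |u| ^ s := by
    intro t u
    rw [hbv]
    exact (abs_sub _ _).trans (by linarith [hWs t u])
  obtain ⟨l, hl⟩ : ∃ l, l = 1 / (2 * (CW + 1)) := ⟨_, rfl⟩
  have hl0 : 0 < l := by rw [hl]; positivity
  have hl1 : l * (l * (CW + 1)) ^ (1 / s) < 1 := by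
    have e : l * (CW + 1) = 1 / 2 := by rw [hl]; field_simp
    rw [e]
    have h1 : ((1:ℝ)/2) ^ (1/s) ≤ 1 := Real.rpow_le_one (by norm_num) (by norm_num) (by positivity)
    have h2 : l ≤ 1 / 2 := by
      rw [← e]
      nlinarith
    nlinarith
  obtain ⟨k0, hk0⟩ := exists_nat_gt (1 / l)
  obtain ⟨k, hkk⟩ : ∃ k, k = k0 + 1 := ⟨_, rfl⟩
  have hk : 1 ≤ k := by omega
  have hkl : 1 < (2 * (k:ℝ) - 1) * l := by
    rw [hkk]; push_cast
    rw [div_lt_iff₀ hl0] at hk0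
    have : 0 ≤ (k0:ℝ) * l := by positivity
    nlinarith
  obtain ⟨L, hL⟩ : ∃ L : ℝ, L = 1 / ((2 * k + 1 : ℕ) : ℝ) / 3 := ⟨_, rfl⟩
  have hL0 : 0 < L := by rw [hL]; positivity
  obtain ⟨Kc, hKc⟩ : ∃ Kc : ℝ, Kc = 2 / (L / 6) * (12 / L + 1) ^ s := ⟨_, rfl⟩
  have hKc0 : 0 < Kc := by rw [hKc]; positivity
  have hK : 12 / L < (Kc * (L / 6) / 2) ^ (1 / s) := by
    have e : Kc * (L / 6) / 2 = (12 / L + 1) ^ s := by rw [hKc]; field_simp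
    rw [e, ← Real.rpow_mul (by positivity), mul_one_div_cancel hs0.ne', Real.rpow_one]
    linarith
  obtain ⟨R', hR'⟩ := hsuper (Kc + CW)
  obtain ⟨R, hRe⟩ : ∃ R, R = max R' 1 := ⟨_, rfl⟩
  have hR1 : 1 ≤ R := by rw [hRe]; exact le_max_right _ _
  have hRR : R' ≤ R := by rw [hRe]; exact le_max_left _ _
  have habs : ∀ u e : ℝ, (e = 1 ∨ e = -1) → 0 ≤ e * u → |u| = e * u := by
    rintro u e (rfl | rfl) h
    · rw [one_mul] at h ⊢; exact abs_of_nonneg h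
    · rw [abs_of_nonpos (by linarith)]; ring
  have hee : ∀ e : ℝ, (e = 1 ∨ e = -1) → e * e = 1 := by
    rintro e (rfl | rfl) <;> norm_num
  have heb : ∀ t u e, (e = 1 ∨ e = -1) → e * f t u - CW * |u| ^ s ≤ e * b0 t u := by
    intro t u e he
    rw [hbv, mul_sub]
    have h1 := hWs t u
    have h2 : |e * ((1 - lam * V t) * sp s u)| ≤ CW * |u| ^ s := by
      have : |e| = 1 := by rcases he with rfl | rfl <;> simp
      rw [abs_mul, this, one_mul]; exact h1
    linarith [le_abs_self (e * ((1 - lam * V t) * sp s u))]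
  obtain ⟨Ast, δ0, hδ0, H⟩ := tier2 b0 hb0c hb0m s hs0 (fun x => |Cf| * (1 + x ^ (q - 1)) + CW * x ^ s)
    (fun x hx => by positivity) (fun x y hx hxy => by
      have h1 := Real.rpow_le_rpow hx hxy (by linarith : 0 ≤ q - 1)
      have h2 := Real.rpow_le_rpow hx hxy hs0.le
      have h3 := mul_le_mul_of_nonneg_left h1 (abs_nonneg Cf)
      have h4 := mul_le_mul_of_nonneg_left h2 (by linarith : 0 ≤ CW)
      simp only [mul_add]
      linarith)
    (fun t u => by
      refine (hbabs t u).trans ?_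
      have h1 := hgrowth t u
      have h2 := mul_le_mul_of_nonneg_right (le_abs_self Cf) (by positivity : 0 ≤ 1 + |u| ^ (q - 1))
      linarith)
    (CW * R ^ s) R Kc L (L / 6) (by positivity) (by linarith) hKc0 k hk (by rw [hL]; ring) rfl hK
    (by
      intro t u e he h0 hu
      have h1 := heb t u e he
      have h2 := mul_le_mul_of_nonneg_left (Real.rpow_le_rpow (abs_nonneg u) hu hs0.le) (by linarith : 0 ≤ CW)
      have h3 : 0 ≤ e * f t u := by
        rcases h0.eq_or_lt with h | h
        · have : u = 0 := by
            have := habs u e he h0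
            rw [← h] at this
            exact abs_eq_zero.mp this
          rw [this, hf0]; simp
        · have h4 : e * f t u * (e * u) = f t u * u := by linear_combination (f t u * u) * hee e he
          have h5 := hsign t u
          rw [← h4] at h5
          exact nonneg_of_mul_nonneg_left h5 h
      linarith)
    (by
      intro t u e he h0 hu
      have h1 := heb t u e he
      have ha := habs u e he h0
      have h2 := hR' t u (by rw [ha]; linarith)
      rw [ha] at h1 h2
      have hpos : 0 < e * u := by linarith
      have h4 : e * f t u * (e * u) = f t u * u := by linear_combination (f t u * u) * hee e he
      have h5 : (e * u) ^ p = (e * u) ^ s * (e * u) := by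
        rw [show p = s + 1 by linarith, Real.rpow_add hpos, Real.rpow_one]
      rw [← h4, h5, ← mul_assoc] at h2
      have h6 := le_of_mul_le_mul_right h2 hpos
      linarith)
    (CW + 1) l r0 (by linarith) hl0 hl1 hkl (by
      intro t u hu
      have h1 := hbabs t u
      have h2 := hr0f t u hu
      linarith)
  obtain ⟨u, w, cu, cw, hu1, hw1, hu, hw, t, ht, htr⟩ := tier3 b0 hb0c hb0m s hs0
    (fun x => |Cf| * (1 + x ^ (q - 1)) + CW * x ^ s)
    (fun x y hx hxy => by
      have h1 := Real.rpow_le_rpow hx hxy (by linarith : 0 ≤ q - 1)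
      have h2 := Real.rpow_le_rpow hx hxy hs0.le
      have h3 := mul_le_mul_of_nonneg_left h1 (abs_nonneg Cf)
      have h4 := mul_le_mul_of_nonneg_left h2 (by linarith : 0 ≤ CW)
      simp only [mul_add]
      linarith)
    (fun t u => by
      refine (hbabs t u).trans ?_
      have h1 := hgrowth t u
      have h2 := mul_le_mul_of_nonneg_right (le_abs_self Cf) (by positivity : 0 ≤ 1 + |u| ^ (q - 1))
      linarith)
    r0 (fun t => by rw [hbv, hf0, sp_nonneg_eq hs0 le_rfl, Real.zero_rpow hs0.ne']; ring) Ast δ0 hδ0 H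
  refine ⟨u, w, cu, cw, hu1, hw1, hu, fun t ht => ?_, t, ht, fun h => ?_⟩
  · rw [hw t ht, hb0]
  · rw [h, abs_zero] at htr; linarith


theorem byParts (c w v : ℝ → ℝ) (hc : IntervalIntegrable c volume 0 1)
    (hw : ∀ t ∈ Set.Icc (0:ℝ) 1, w t = w 0 - ∫ r in (0:ℝ)..t, c r) (hw1 : w 1 = w 0)
    (hv : ContDiff ℝ 1 v) (hv1 : v 1 = v 0) :
    ∫ t in (0:ℝ)..1, w t * deriv v t = ∫ t in (0:ℝ)..1, c t * v t := by
  have hdc : Continuous (deriv v) := hv.continuous_deriv le_rfl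
  have hdv : Differentiable ℝ v := hv.differentiable (by norm_num)
  have hJ : ∀ t, ∫ r in (0:ℝ)..t, deriv v r = v t - v 0 := fun t =>
    integral_deriv_eq_sub (fun x _ => hdv x) (hdc.intervalIntegrable _ _)
  have hJac := (hdc.intervalIntegrable (μ := volume) 0 1).absolutelyContinuousOnInterval_intervalIntegral
    (c := 0) (by simp)
  have hIac := hc.absolutelyContinuousOnInterval_intervalIntegral (c := 0) (by simp)
  have key := hIac.integral_mul_deriv_eq_deriv_mul hJac
  simp only [hJ] at key
  have hI1 : ∫ r in (0:ℝ)..1, c r = 0 := by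
    have := hw 1 (by simp); linarith
  have hcv : IntervalIntegrable (fun t => c t * v t) volume 0 1 :=
    hc.mul_continuousOn hv.continuous.continuousOn
  have e1 : ∫ t in (0:ℝ)..1, (∫ r in (0:ℝ)..t, c r) * deriv (fun t => v t - v 0) t =
      - ∫ t in (0:ℝ)..1, w t * deriv v t := by
    have : ∫ t in (0:ℝ)..1, w t * deriv v t =
        ∫ t in (0:ℝ)..1, (w 0 * deriv v t - (∫ r in (0:ℝ)..t, c r) * deriv v t) := by
      apply integral_congr
      intro t ht
      rw [Set.uIcc_of_le zero_le_one] at ht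
      simp only
      rw [hw t ht]; ring
    rw [this, intervalIntegral.integral_sub ((hdc.intervalIntegrable _ _).const_mul _)
      ((hdc.intervalIntegrable _ _).continuousOn_mul hIac.continuousOn),
      intervalIntegral.integral_const_mul, hJ, hv1]
    simp
  have e2 : ∫ t in (0:ℝ)..1, deriv (fun x => ∫ r in (0:ℝ)..x, c r) t * (v t - v 0) =
      ∫ t in (0:ℝ)..1, c t * v t := by
    have : ∫ t in (0:ℝ)..1, deriv (fun x => ∫ r in (0:ℝ)..x, c r) t * (v t - v 0) =
        ∫ t in (0:ℝ)..1, (c t * v t - c t * v 0) := by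
      apply intervalIntegral.integral_congr_ae
      filter_upwards [hc.ae_hasDerivAt_integral] with t ht htI
      rw [(ht (Set.uIoc_subset_uIcc htI) 0 (by simp)).deriv]
      ring
    rw [this, intervalIntegral.integral_sub hcv (hc.mul_const _), intervalIntegral.integral_mul_const, hI1]
    simp
  rw [e1, e2, hI1, hv1] at key
  simp at key
  exact key

theorem finalStep (p lam CV : ℝ) (hp : 1 < p)
    (V : ℝ → ℝ) (hVmeas : Measurable V) (hVbdd : ∀ t, |V t| ≤ CV)
    (f : ℝ → ℝ → ℝ) (hfc : Continuous (Function.uncurry f))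
    (u w : ℝ → ℝ) (cu : Continuous u) (cw : Continuous w) (hu1 : u 1 = u 0) (hw1 : w 1 = w 0)
    (hu : ∀ t ∈ Set.Icc (0:ℝ) 1, u t = u 0 + ∫ r in (0:ℝ)..t, sp (1 / (p - 1)) (w r))
    (hw : ∀ t ∈ Set.Icc (0:ℝ) 1, w t = w 0 -
        ∫ r in (0:ℝ)..t, (f r (u r) - (1 - lam * V r) * sp (p - 1) (u r)))
    (hne : ∃ t ∈ Set.Icc (0:ℝ) 1, u t ≠ 0) :
    ∃ u : ℝ → ℝ, Function.Periodic u 1 ∧ Differentiable ℝ u ∧ u ≠ 0 ∧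
      ∀ v : ℝ → ℝ, Function.Periodic v 1 → ContDiff ℝ 1 v →
        (∫ t in (0 : ℝ)..1,
            (|deriv u t| ^ (p - 2) * (deriv u t * deriv v t) +
             |u t| ^ (p - 2) * (u t * v t))) =
        lam * (∫ t in (0 : ℝ)..1, V t * (|u t| ^ (p - 2) * (u t * v t))) +
        ∫ t in (0 : ℝ)..1, f t (u t) * v t := by
  have hs : 0 < p - 1 := by linarith
  have hα : 0 < 1 / (p - 1) := by positivity
  obtain ⟨wp, hwp⟩ : ∃ wp : ℝ → ℝ, wp = w ∘ Int.fract := ⟨_, rfl⟩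
  have cwp : Continuous wp := by
    rw [hwp]; exact ContinuousOn.comp_fract'' cw.continuousOn hw1.symm
  have pwp : Function.Periodic wp 1 := fun t => by rw [hwp]; simp
  have ewp : ∀ t ∈ Set.Icc (0:ℝ) 1, wp t = w t := by
    intro t ht
    rw [hwp, Function.comp_apply]
    rcases ht.2.eq_or_lt with h | h
    · rw [h, Int.fract_one, hw1]
    · rw [Int.fract_eq_self.mpr ⟨ht.1, h⟩]
  obtain ⟨g, hg⟩ : ∃ g : ℝ → ℝ, g = fun r => sp (1 / (p - 1)) (wp r) := ⟨_, rfl⟩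
  have cg : Continuous g := by rw [hg]; exact (sp_cont hα).comp cwp
  have pg : Function.Periodic g 1 := fun t => by simp only [hg]; rw [pwp]
  obtain ⟨U, hU⟩ : ∃ U : ℝ → ℝ, U = fun t => u 0 + ∫ r in (0:ℝ)..t, g r := ⟨_, rfl⟩
  have eU : ∀ t ∈ Set.Icc (0:ℝ) 1, U t = u t := by
    intro t ht
    rw [hU, hu t ht]
    simp only
    congr 1
    apply integral_congr
    intro r hr
    rw [Set.uIcc_of_le ht.1] at hr
    simp only [hg]
    rw [ewp r ⟨hr.1, hr.2.trans ht.2⟩]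
  have dU : ∀ t, HasDerivAt U (g t) t := by
    intro t
    rw [hU]
    exact (integral_hasDerivAt_right (cg.intervalIntegrable _ _)
      (cg.stronglyMeasurableAtFilter _ _) cg.continuousAt).const_add _
  have hg1 : ∫ r in (0:ℝ)..1, g r = 0 := by
    have h1 := eU 1 (by simp)
    rw [hU] at h1
    simp only at h1
    linarith
  refine ⟨U, ?_, fun t => (dU t).differentiableAt, ?_, ?_⟩
  · intro t
    rw [hU]
    simp only
    rw [← integral_add_adjacent_intervals (cg.intervalIntegrable 0 t) (cg.intervalIntegrable t (t + 1)),
      pg.intervalIntegral_add_eq t 0, zero_add, hg1, add_zero]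
  · obtain ⟨t, ht, h0⟩ := hne
    intro h
    apply h0
    rw [← eU t ht, h]; rfl
  · intro v pv cv
    have hv1 : v 1 = v 0 := by simpa using pv 0
    have I0 : (0:ℝ) ∈ Set.Icc (0:ℝ) 1 := by simp
    have I1 : (1:ℝ) ∈ Set.Icc (0:ℝ) 1 := by simp
    have cf : Continuous fun t => f t (u t) := hfc.comp (continuous_id.prodMk cu)
    have cs : Continuous fun t => sp (p - 1) (u t) := (sp_cont hs).comp cu
    have csv : Continuous fun t => sp (p - 1) (u t) * v t := cs.mul cv.continuous
    have iV : IntervalIntegrable V volume 0 1 := intBdd V hVmeas CV (fun r _ => hVbdd r) 0 1 I0 I1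
    have iVs : IntervalIntegrable (fun t => V t * (sp (p - 1) (u t) * v t)) volume 0 1 :=
      iV.mul_continuousOn csv.continuousOn
    have iW : IntervalIntegrable (fun r => (1 - lam * V r) * sp (p - 1) (u r)) volume 0 1 :=
      (intervalIntegrable_const.sub (iV.const_mul lam)).mul_continuousOn cs.continuousOn
    have ic : IntervalIntegrable (fun r => f r (u r) - (1 - lam * V r) * sp (p - 1) (u r)) volume 0 1 :=
      (cf.intervalIntegrable 0 1).sub iW
    have key := byParts _ w v ic hw hw1 cv hv1
    have cwv : Continuous fun t => w t * deriv v t := cw.mul (cv.continuous_deriv le_rfl)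
    have ifv : IntervalIntegrable (fun t => f t (u t) * v t) volume 0 1 :=
      (cf.mul cv.continuous).intervalIntegrable 0 1
    have e1 : (∫ t in (0 : ℝ)..1, (|deriv U t| ^ (p - 2) * (deriv U t * deriv v t) +
             |U t| ^ (p - 2) * (U t * v t))) =
        ∫ t in (0:ℝ)..1, (w t * deriv v t + sp (p - 1) (u t) * v t) := by
      apply integral_congr
      intro t ht
      rw [Set.uIcc_of_le zero_le_one] at ht
      simp only
      rw [(dU t).deriv, eU t ht, ← mul_assoc, ← mul_assoc, sp_eq hp, sp_eq hp]
      simp only [hg]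
      rw [sp_inv hs, ewp t ht]
    have e2 : ∫ t in (0 : ℝ)..1, V t * (|U t| ^ (p - 2) * (U t * v t)) =
        ∫ t in (0:ℝ)..1, V t * (sp (p - 1) (u t) * v t) := by
      apply integral_congr
      intro t ht
      rw [Set.uIcc_of_le zero_le_one] at ht
      simp only
      rw [eU t ht, ← mul_assoc (|u t| ^ (p - 2)), sp_eq hp]
    have e3 : ∫ t in (0 : ℝ)..1, f t (U t) * v t = ∫ t in (0:ℝ)..1, f t (u t) * v t := by
      apply integral_congr
      intro t ht
      rw [Set.uIcc_of_le zero_le_one] at ht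
      simp only
      rw [eU t ht]
    have e4 : ∫ t in (0:ℝ)..1, (f t (u t) - (1 - lam * V t) * sp (p - 1) (u t)) * v t =
        ∫ t in (0:ℝ)..1, ((f t (u t) * v t - sp (p - 1) (u t) * v t) +
          lam * (V t * (sp (p - 1) (u t) * v t))) := by
      congr 1
      funext t
      ring
    rw [e1, e2, e3, intervalIntegral.integral_add (cwv.intervalIntegrable 0 1) (csv.intervalIntegrable 0 1),
      key, e4, intervalIntegral.integral_add (ifv.sub (csv.intervalIntegrable 0 1)) (iVs.const_mul lam),
      intervalIntegral.integral_sub ifv (csv.intervalIntegrable 0 1), intervalIntegral.integral_const_mul]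
    ring

/-- Existence of a nontrivial periodic solution of the one-dimensional `p`-Laplacian problem
`-Δ_p u + |u|^{p-2}u = λV(t)|u|^{p-2}u + f(t,u)`, `u(0)=u(1)`, `u'(0)=u'(1)`, for every
`λ ∈ ℝ`, when `V ∈ L^∞` and `f` are `1`-periodic in `t` and `f` satisfies (f₁)–(f₄). The
solution is expressed in weak form, testing against `1`-periodic `C¹` functions. -/
theorem stmt_19 (p q Cf θ lam CV : ℝ) (hp : 1 < p) (hq : p < q) (hθ : 1 ≤ θ)
    (V : ℝ → ℝ) (hVper : Function.Periodic V 1)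
    (hVmeas : Measurable V) (hVbdd : ∀ t, |V t| ≤ CV)
    (f : ℝ → ℝ → ℝ) (hfc : Continuous (Function.uncurry f))
    (hfper : ∀ t u, f (t + 1) u = f t u)
    (hgrowth : ∀ t u, |f t u| ≤ Cf * (1 + |u| ^ (q - 1)))
    (hsign : ∀ t u, 0 ≤ f t u * u)
    (hsuper : ∀ K : ℝ, ∃ R : ℝ, ∀ t u, R ≤ |u| → K * |u| ^ p ≤ f t u * u)
    (hsmall : ∀ ε > 0, ∃ δ > 0, ∀ t u, |u| ≤ δ → |f t u| ≤ ε * |u| ^ (p - 1))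
    (F : ℝ → ℝ → ℝ) (hF : ∀ t u, F t u = ∫ s in (0 : ℝ)..u, f t s)
    (hf4 : ∀ t u, ∀ s ∈ Set.Icc (0 : ℝ) 1,
      f t (s * u) * (s * u) - p * F t (s * u) ≤ θ * (f t u * u - p * F t u)) :
    ∃ u : ℝ → ℝ, Function.Periodic u 1 ∧ Differentiable ℝ u ∧ u ≠ 0 ∧
      ∀ v : ℝ → ℝ, Function.Periodic v 1 → ContDiff ℝ 1 v →
        (∫ t in (0 : ℝ)..1,
            (|deriv u t| ^ (p - 2) * (deriv u t * deriv v t) +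
             |u t| ^ (p - 2) * (u t * v t))) =
        lam * (∫ t in (0 : ℝ)..1, V t * (|u t| ^ (p - 2) * (u t * v t))) +
        ∫ t in (0 : ℝ)..1, f t (u t) * v t := by
  obtain ⟨u, w, cu, cw, hu1, hw1, hu, hw, hne⟩ := systemSol p q Cf lam CV hp hq V hVmeas hVbdd f hfc
    hgrowth hsign hsuper hsmall
  exact finalStep p lam CV hp V hVmeas hVbdd f hfc u w cu cw hu1 hw1 hu hw hne
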